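/- Let k>0 and R>0. Let W = [0,∞)³ ⊂ ℝ³, S_R = interior(W) ∩ B_R, and Γ_R = ∂W ∩ B_R. Let q : ℝ³ → ℂ be bounded measurable with q = 1 on B_R \ closure(S_R), and suppose there exist α>1/4 and C≥0 with |q(x)−q(y)| ≤ C|x−y|^α for all x,y ∈ closure(S_R), and q(0) ≠ 1. Let v₁, v₂ : ℝ³ → ℂ be C² on B_R and satisfy Δv₁ + k²v₁ = 0 and Δv₂ + k² q v₂ = 0 pointwise on B_R, with v₁ = v₂ and ∇v₁ = ∇v₂ on Γ_R. Then v₁ = v₂ ≡ 0 on B_R. -/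

import Mathlib

open MeasureTheory Metric Set Real



/-- The Euclidean Laplacian of a function `u : ℝ³ → ℂ`:
`Δu(x) = ∑ i, ∂²u/∂xᵢ²(x)`. -/
noncomputable def laplacian3 (u : EuclideanSpace ℝ (Fin 3) → ℂ)
    (x : EuclideanSpace ℝ (Fin 3)) : ℂ :=
  ∑ i : Fin 3,
    fderiv ℝ (fun y => fderiv ℝ u y (EuclideanSpace.single i (1 : ℝ))) x
      (EuclideanSpace.single i (1 : ℝ))

/-- The closed first octant `[0,∞)³` in ℝ³. -/
def octant : Set (EuclideanSpace ℝ (Fin 3)) := {x | ∀ i, 0 ≤ x i}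

/-- Euclidean three-space. -/
abbrev E3 := EuclideanSpace ℝ (Fin 3)

/-- Standard basis vectors. -/
noncomputable def ee (i : Fin 3) : E3 := EuclideanSpace.single i (1 : ℝ)

/-- Partial derivatives. -/
noncomputable def pd {F : Type*} [NormedAddCommGroup F] [NormedSpace ℝ F] (i : Fin 3)
    (u : E3 → F) (x : E3) : F := fderiv ℝ u x (ee i)

/-- Laplacian, for functions with values in any normed space. -/
noncomputable def lap {F : Type*} [NormedAddCommGroup F] [NormedSpace ℝ F]
    (u : E3 → F) (x : E3) : F := ∑ i : Fin 3, pd i (pd i u) x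

theorem laplacian3_eq (u : E3 → ℂ) (x : E3) : laplacian3 u x = lap u x := rfl

section basics
variable {F : Type*} [NormedAddCommGroup F] [NormedSpace ℝ F]

theorem ee_apply (i j : Fin 3) : ee i j = if j = i then 1 else 0 := by
  simp [ee]

theorem norm_ee (i : Fin 3) : ‖ee i‖ = 1 := by simp [ee]

theorem hasLine {u : E3 → F} {x : E3} (h : DifferentiableAt ℝ u x) (i : Fin 3) :
    HasDerivAt (fun t : ℝ => u (x + t • ee i)) (pd i u x) 0 :=
  h.hasFDerivAt.hasLineDerivAt (ee i)

theorem hasLine_coord (x : E3) (i j : Fin 3) :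
    HasDerivAt (fun t : ℝ => (x + t • ee i) j) (if j = i then 1 else 0) 0 := by
  have : HasDerivAt (fun t : ℝ => x j + t * (ee i j)) (1 * ee i j) 0 :=
    ((hasDerivAt_id (0:ℝ)).mul_const _).const_add _
  simpa [ee_apply] using this

theorem pd_eq_of_hasLine {u : E3 → F} {x : E3} {i : Fin 3} {d : F} (h : DifferentiableAt ℝ u x)
    (h2 : HasDerivAt (fun t : ℝ => u (x + t • ee i)) d 0) : pd i u x = d :=
  (hasLine h i).unique h2

theorem contDiff_pd {u : E3 → F} {n : ℕ∞} {i : Fin 3} (h : ContDiff ℝ (n + 1) u) :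
    ContDiff ℝ n (pd i u) := by
  unfold pd
  exact (h.fderiv_right le_rfl).clm_apply contDiff_const

theorem contDiffAt_pd {u : E3 → F} {n m : WithTop ℕ∞} {i : Fin 3} {x : E3} (h : ContDiffAt ℝ m u x)
    (hnm : n + 1 ≤ m) :
    ContDiffAt ℝ n (pd i u) x := by
  unfold pd
  exact (h.fderiv_right hnm).clm_apply contDiffAt_const

theorem pd_congr {u v : E3 → F} {x : E3} (i : Fin 3) (h : u =ᶠ[nhds x] v) : pd i u x = pd i v x := by
  unfold pd; rw [h.fderiv_eq]

theorem pd_congr' {u v : E3 → F} {x : E3} (i : Fin 3) (h : u =ᶠ[nhds x] v) :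
    pd i u =ᶠ[nhds x] pd i v := by
  unfold pd
  filter_upwards [h.fderiv (𝕜 := ℝ)] with y hy
  rw [hy]

theorem lap_congr {u v : E3 → F} {x : E3} (h : u =ᶠ[nhds x] v) : lap u x = lap v x := by
  unfold lap
  exact Finset.sum_congr rfl fun i _ => pd_congr i (pd_congr' i h)

theorem pd_symm {u : E3 → F} {x : E3} (h : ContDiffAt ℝ 2 u x) (i j : Fin 3) :
    pd i (pd j u) x = pd j (pd i u) x := by
  have hs : IsSymmSndFDerivAt ℝ u x := h.isSymmSndFDerivAt (by simp)
  have hd : DifferentiableAt ℝ (fderiv ℝ u) x :=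
    (h.fderiv_right (m := 1) (by norm_num)).differentiableAt (by simp)
  have key : ∀ a b : Fin 3, pd a (pd b u) x = fderiv ℝ (fderiv ℝ u) x (ee a) (ee b) := by
    intro a b
    change fderiv ℝ (fun y => fderiv ℝ u y (ee b)) x (ee a) = _
    rw [fderiv_clm_apply hd (differentiableAt_const _)]
    simp
  rw [key, key, hs.eq]

theorem x_decomp (x : E3) : x = ∑ i, x i • ee i := by
  ext j
  simp [ee_apply, Finset.sum_apply]

theorem norm_sq_E3 (x : E3) : ‖x‖ ^ 2 = x 0 ^ 2 + x 1 ^ 2 + x 2 ^ 2 := by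
  rw [EuclideanSpace.norm_sq_eq]; simp [Fin.sum_univ_three]

/-- The basic integration by parts. -/
theorem ibp {V d : E3 → ℝ} {i : Fin 3} (hV : ContDiff ℝ 1 V) {K : Set E3} (hK : IsCompact K)
    (hVK : ∀ x ∉ K, V x = 0)
    (hd : ∀ x, HasDerivAt (fun t : ℝ => V (x + t • ee i)) (d x) 0) :
    Integrable d ∧ ∫ x, d x = 0 := by
  have hcs : HasCompactSupport V := HasCompactSupport.intro hK hVK
  have hdiff : Differentiable ℝ V := hV.differentiable (by simp)
  have hdeq : d = fun x => fderiv ℝ V x (ee i) := by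
    funext x
    exact (pd_eq_of_hasLine (hdiff x) (hd x)).symm
  have hcont : Continuous (fun x => fderiv ℝ V x (ee i)) :=
    (hV.continuous_fderiv (by simp)).clm_apply continuous_const
  have hcs2 : HasCompactSupport (fun x => fderiv ℝ V x (ee i)) := hcs.fderiv_apply ℝ (ee i)
  have hint := hcont.integrable_of_hasCompactSupport (μ := volume) hcs2
  rw [hdeq]
  refine ⟨hint, ?_⟩
  have := integral_mul_fderiv_eq_neg_fderiv_mul_of_integrable (𝕜 := ℝ) (μ := (volume : Measure E3))
    (f := fun _ => (1:ℝ)) (g := V) (v := ee i) (by simp) (by simpa using hint)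
    (by simpa using hV.continuous.integrable_of_hasCompactSupport hcs)
    (fun x _ => differentiableAt_const _) (fun x _ => hdiff x)
  simpa using this

theorem ibp3 {V d : Fin 3 → E3 → ℝ} {D : E3 → ℝ} (hV : ∀ i, ContDiff ℝ 1 (V i)) {K : Set E3}
    (hK : IsCompact K) (hVK : ∀ i, ∀ x ∉ K, V i x = 0)
    (hd : ∀ i x, HasDerivAt (fun t : ℝ => V i (x + t • ee i)) (d i x) 0)
    (hD : ∀ x, D x = d 0 x + d 1 x + d 2 x) : ∫ x, D x = 0 := by
  have A := fun i => ibp (hV i) hK (hVK i) (hd i)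
  have e : D = fun x => d 0 x + d 1 x + d 2 x := funext hD
  rw [e]
  have h3 := integral_add ((A 0).1.add (A 1).1) (A 2).1
  have h2 := integral_add (A 0).1 (A 1).1
  have h3' : ∫ x, (d 0 x + d 1 x + d 2 x) = (∫ x, (d 0 x + d 1 x)) + ∫ x, d 2 x := h3
  rw [h3', h2, (A 0).2, (A 1).2, (A 2).2]
  simp

theorem contDiff_pd' {u : E3 → F} {n m : WithTop ℕ∞} {i : Fin 3} (h : ContDiff ℝ m u)
    (hnm : n + 1 ≤ m) : ContDiff ℝ n (pd i u) := by
  unfold pd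
  exact (h.fderiv_right hnm).clm_apply contDiff_const

theorem pd_zero (i : Fin 3) : pd i (fun _ : E3 => (0 : F)) = fun _ => 0 := by
  funext x; simp [pd]

theorem lap_zero : lap (fun _ : E3 => (0 : F)) = fun _ => 0 := by
  funext x; simp [lap, pd_zero]

theorem lap_three (u : E3 → F) (x : E3) :
    lap u x = pd 0 (pd 0 u) x + pd 1 (pd 1 u) x + pd 2 (pd 2 u) x := by
  simp [lap, Fin.sum_univ_three]

theorem pd_eq {u : E3 → F} {x : E3} {L : E3 →L[ℝ] F} (h : HasFDerivAt u L x) (i : Fin 3) :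
    pd i u x = L (ee i) := by
  unfold pd; rw [h.fderiv]

theorem pd_clm {G : Type*} [NormedAddCommGroup G] [NormedSpace ℝ G] (L : F →L[ℝ] G) {u : E3 → F}
    {x : E3} (h : DifferentiableAt ℝ u x) (i : Fin 3) :
    pd i (fun y => L (u y)) x = L (pd i u x) := by
  exact pd_eq (u := fun y => L (u y)) (L.hasFDerivAt.comp x h.hasFDerivAt) i

theorem diff_near {u : E3 → F} {x : E3} (h : ContDiffAt ℝ 2 u x) :
    ∀ᶠ y in nhds x, DifferentiableAt ℝ u y := by
  filter_upwards [h.eventually (by simp)] with y hy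
  exact hy.differentiableAt (by simp)

theorem pd_diffAt {u : E3 → F} {x : E3} (h : ContDiffAt ℝ 2 u x) (i : Fin 3) :
    DifferentiableAt ℝ (pd i u) x :=
  (contDiffAt_pd (n := 1) h (by norm_num)).differentiableAt (by simp)

theorem lap_clm {G : Type*} [NormedAddCommGroup G] [NormedSpace ℝ G] (L : F →L[ℝ] G) {u : E3 → F}
    {x : E3} (h : ContDiffAt ℝ 2 u x) :
    lap (fun y => L (u y)) x = L (lap u x) := by
  unfold lap
  rw [map_sum]
  refine Finset.sum_congr rfl fun i _ => ?_
  rw [← pd_clm L (pd_diffAt h i) i]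
  apply pd_congr
  filter_upwards [diff_near h] with y hy
  exact pd_clm L hy i

theorem pd_smul {g : E3 → ℝ} {u : E3 → F} {x : E3} (hg : DifferentiableAt ℝ g x)
    (h : DifferentiableAt ℝ u x) (i : Fin 3) :
    pd i (fun y => g y • u y) x = g x • pd i u x + pd i g x • u x := by
  refine (pd_eq (u := fun y => g y • u y) (hg.hasFDerivAt.smul h.hasFDerivAt) i).trans ?_
  simp [pd]

theorem pd_add {u v : E3 → F} {x : E3} (hu : DifferentiableAt ℝ u x)
    (hv : DifferentiableAt ℝ v x) (i : Fin 3) :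
    pd i (fun y => u y + v y) x = pd i u x + pd i v x := by
  refine (pd_eq (u := fun y => u y + v y) (hu.hasFDerivAt.add hv.hasFDerivAt) i).trans ?_
  simp [pd]

theorem pd_sub {u v : E3 → F} {x : E3} (hu : DifferentiableAt ℝ u x)
    (hv : DifferentiableAt ℝ v x) (i : Fin 3) :
    pd i (fun y => u y - v y) x = pd i u x - pd i v x := by
  refine (pd_eq (u := fun y => u y - v y) (hu.hasFDerivAt.sub hv.hasFDerivAt) i).trans ?_
  simp [pd]

theorem lap_sub {u v : E3 → F} {x : E3} (hu : ContDiffAt ℝ 2 u x)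
    (hv : ContDiffAt ℝ 2 v x) :
    lap (fun y => u y - v y) x = lap u x - lap v x := by
  unfold lap
  rw [← Finset.sum_sub_distrib]
  refine Finset.sum_congr rfl fun i _ => ?_
  rw [← pd_sub (pd_diffAt hu i) (pd_diffAt hv i) i]
  apply pd_congr
  filter_upwards [diff_near hu, diff_near hv] with y hy hy2
  exact pd_sub hy hy2 i

theorem lap_smul {g : E3 → ℝ} {u : E3 → F} {x : E3} (hg : ContDiffAt ℝ 2 g x)
    (h : ContDiffAt ℝ 2 u x) :
    lap (fun y => g y • u y) x = g x • lap u x + (2:ℝ) • ∑ i, pd i g x • pd i u x + lap g x • u x := by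
  unfold lap
  rw [Finset.smul_sum, Finset.smul_sum, Finset.sum_smul, ← Finset.sum_add_distrib,
    ← Finset.sum_add_distrib]
  refine Finset.sum_congr rfl fun i _ => ?_
  have h1 := pd_diffAt hg i
  have h2 := pd_diffAt h i
  have h3 := hg.differentiableAt (by simp)
  have h4 := h.differentiableAt (by simp)
  rw [pd_congr i (v := fun y => g y • pd i u y + pd i g y • u y) (by
    filter_upwards [diff_near hg, diff_near h] with y hy hy2
    exact pd_smul hy hy2 i)]
  rw [pd_add (u := fun y => g y • pd i u y) (v := fun y => pd i g y • u y) (h3.smul h2) (h1.smul h4), pd_smul h3 h2, pd_smul h1 h4, two_smul]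
  abel

/-- Radial functions. -/
theorem pd_radial {G : ℝ → ℝ} {G' : ℝ} {x : E3} (h : HasDerivAt G G' (‖x‖ ^ 2)) (i : Fin 3) :
    pd i (fun y => G (‖y‖ ^ 2)) x = 2 * x i * G' := by
  have h1 : HasFDerivAt (fun y : E3 => ‖y‖ ^ 2) (2 • (innerSL ℝ x)) x :=
    (hasStrictFDerivAt_norm_sq x).hasFDerivAt
  have h2 := h.comp_hasFDerivAt x h1
  unfold pd
  change fderiv ℝ (G ∘ fun y => ‖y‖ ^ 2) x _ = _
  rw [h2.fderiv]
  simp [ee, EuclideanSpace.inner_single_right]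
  ring

theorem pd_coord (x : E3) (i j : Fin 3) : pd i (fun y : E3 => y j) x = if j = i then 1 else 0 :=
  pd_eq_of_hasLine (by fun_prop) (hasLine_coord x i j)

theorem lap_radial {G G1 : ℝ → ℝ} {G2 : ℝ} {x : E3}
    (h : ∀ᶠ t in nhds (‖x‖ ^ 2), HasDerivAt G (G1 t) t) (h2 : HasDerivAt G1 G2 (‖x‖ ^ 2)) :
    lap (fun y => G (‖y‖ ^ 2)) x = 6 * G1 (‖x‖ ^ 2) + 4 * ‖x‖ ^ 2 * G2 := by
  have hc : Continuous (fun y : E3 => ‖y‖ ^ 2) := by fun_prop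
  have key : ∀ i, pd i (pd i (fun y => G (‖y‖ ^ 2))) x = 2 * G1 (‖x‖ ^ 2) + 4 * x i ^ 2 * G2 := by
    intro i
    rw [pd_congr i (v := fun y => (2 * y i) • G1 (‖y‖ ^ 2)) (by
      filter_upwards [hc.continuousAt.eventually h] with y hy
      exact pd_radial hy i)]
    have hd : DifferentiableAt ℝ (fun y : E3 => G1 (‖y‖ ^ 2)) x :=
      h2.differentiableAt.comp x (hasStrictFDerivAt_norm_sq x).hasFDerivAt.differentiableAt
    have e : pd i (fun y : E3 => 2 * y i) x = 2 := by
      have h0 := pd_smul (g := fun _ => (2:ℝ)) (u := fun y : E3 => y i) (x := x) (by fun_prop)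
        (by fun_prop) i
      simp only [smul_eq_mul] at h0
      rw [h0, pd_coord]; simp [pd]
    rw [pd_smul (by fun_prop) hd, pd_radial h2, e]
    simp; ring
  rw [lap, Finset.sum_congr rfl fun i _ => key i, Fin.sum_univ_three]
  have := norm_sq_E3 x
  linear_combination (-4) * G2 * this

end basics


theorem lin_carleman_core {y : E3 → ℝ} (hy : ContDiff ℝ 2 y) {δ : ℝ} (hδ : 0 < δ)
    (hsupp : ∀ x, δ < ‖x‖ → y x = 0) (θ : E3) :
    ‖θ‖ ^ 2 * ∫ x, (y x) ^ 2 ≤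
      δ ^ 2 * ∫ x, (lap y x + 2 * (∑ i, θ i * pd i y x) + ‖θ‖ ^ 2 * y x) ^ 2 := by
  have hK : IsCompact (closedBall (0:E3) δ) := isCompact_closedBall _ _
  have hyK : ∀ x ∉ closedBall (0:E3) δ, y x = 0 := by
    intro x hx; apply hsupp; simpa using hx
  have hev : ∀ x ∉ closedBall (0:E3) δ, y =ᶠ[nhds x] fun _ => 0 := by
    intro x hx
    filter_upwards [(isClosed_closedBall (x := (0:E3)) (ε := δ)).isOpen_compl.mem_nhds hx] with z hz
    exact hyK z hz
  have hpd0 : ∀ i, ∀ x ∉ closedBall (0:E3) δ, pd i y x = 0 := by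
    intro i x hx
    rw [pd_congr i (hev x hx)]; simp [pd]
  have hpdc : ∀ i, ContDiff ℝ 1 (pd i y) := fun i => contDiff_pd' hy (by norm_num)
  have hy1 : ContDiff ℝ 1 y := hy.of_le (by norm_num)
  have hpdc0 : ∀ i j, Continuous (pd i (pd j y)) := fun i j =>
    (contDiff_pd' (n := 0) (hpdc j) (by norm_num)).continuous
  have hly : ∀ i x, HasDerivAt (fun t : ℝ => y (x + t • ee i)) (pd i y x) 0 :=
    fun i x => hasLine (hy1.differentiable (by simp) x) i
  have hlp : ∀ i j x, HasDerivAt (fun t : ℝ => pd j y (x + t • ee i)) (pd i (pd j y) x) 0 :=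
    fun i j x => hasLine ((hpdc j).differentiable (by simp) x) i
  have hsy : ∀ i j x, pd i (pd j y) x = pd j (pd i y) x := fun i j x => pd_symm hy.contDiffAt i j
  set N : ℝ := ‖θ‖ ^ 2 with hN
  have hNe : N = θ 0 ^ 2 + θ 1 ^ 2 + θ 2 ^ 2 := norm_sq_E3 θ
  set g : E3 → ℝ := fun x => θ 0 * pd 0 y x + θ 1 * pd 1 y x + θ 2 * pd 2 y x with hg
  have hgc : ContDiff ℝ 1 g := by
    have h0 := hpdc 0; have h1 := hpdc 1; have h2 := hpdc 2
    fun_prop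
  have hgl : ∀ i x, HasDerivAt (fun t : ℝ => g (x + t • ee i)) (θ 0 * pd i (pd 0 y) x +
      θ 1 * pd i (pd 1 y) x + θ 2 * pd i (pd 2 y) x) 0 := fun i x =>
    (((hlp i 0 x).const_mul _).add ((hlp i 1 x).const_mul _)).add ((hlp i 2 x).const_mul _)
  have hg0 : ∀ x ∉ closedBall (0:E3) δ, g x = 0 := by
    intro x hx; simp [hg, hpd0 _ x hx]
  have I1 : ∀ h : E3 → ℝ, Continuous h → (∀ x ∉ closedBall (0:E3) δ, h x = 0) → Integrable h :=
    fun h hc h0 => hc.integrable_of_hasCompactSupport (HasCompactSupport.intro hK h0)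
  have hlap : ∀ x, lap y x = pd 0 (pd 0 y) x + pd 1 (pd 1 y) x + pd 2 (pd 2 y) x := fun x => by
    simp [lap, Fin.sum_univ_three]
  have hlapc : Continuous (lap y) := by
    have : lap y = fun x => pd 0 (pd 0 y) x + pd 1 (pd 1 y) x + pd 2 (pd 2 y) x := funext hlap
    rw [this]
    exact ((hpdc0 0 0).add (hpdc0 1 1)).add (hpdc0 2 2)
  have hlap0 : ∀ x ∉ closedBall (0:E3) δ, lap y x = 0 := by
    intro x hx
    rw [lap_congr (hev x hx), lap_zero]
  have hQ : ∫ x, (lap y x + N * y x) * g x = 0 := by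
    refine ibp3 (V := fun j x => pd j y x * g x - 1/2 * θ j * (pd 0 y x ^ 2 + pd 1 y x ^ 2 + pd 2 y x ^ 2)
      + 1/2 * N * θ j * (y x) ^ 2)
      (fun j => by have h0 := hpdc 0; have h1 := hpdc 1; have h2 := hpdc 2; have h3 := hpdc j; fun_prop)
      hK (by intro j x hx; simp [hpd0 _ x hx, hyK x hx])
      (fun j x => ((((hlp j j x).mul (hgl j x)).sub
      (((((hlp j 0 x).pow 2).add ((hlp j 1 x).pow 2)).add ((hlp j 2 x).pow 2)).const_mul _)).add
      (((hly j x).pow 2).const_mul _))) ?_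
    intro x
    simp only [hg, hlap, hsy 1 0 x, hsy 2 0 x, hsy 2 1 x, zero_smul, add_zero]
    ring
  have hP : ∫ x, (N * y x ^ 2 + 2 * (θ 0 * x 0 + θ 1 * x 1 + θ 2 * x 2) * y x * g x) = 0 := by
    refine ibp3 (V := fun j x => (θ 0 * x 0 + θ 1 * x 1 + θ 2 * x 2) * θ j * (y x) ^ 2)
      (fun j => by fun_prop)
      hK (by intro j x hx; simp [hyK x hx])
      (fun j x => (((((hasLine_coord x j 0).const_mul _).add ((hasLine_coord x j 1).const_mul _)).add
       ((hasLine_coord x j 2).const_mul _)).mul_const _).mul ((hly j x).pow 2)) ?_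
    intro x
    simp [hg, hNe]
    ring
  have hyc := hy1.continuous
  have hgcc := hgc.continuous
  have iy2 : Integrable (fun x => y x ^ 2) := I1 _ (by fun_prop) (by intro x hx; simp [hyK x hx])
  have ig2 : Integrable (fun x => g x ^ 2) := I1 _ (by fun_prop) (by intro x hx; simp [hg0 x hx])
  have iQ : Integrable (fun x => (lap y x + N * y x) * g x) :=
    I1 _ (by fun_prop) (by intro x hx; simp [hg0 x hx])
  have iG : Integrable (fun x => (lap y x + 2 * (∑ i, θ i * pd i y x) + N * y x) ^ 2) := by
    have e : (fun x => (lap y x + 2 * (∑ i, θ i * pd i y x) + N * y x) ^ 2) =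
      fun x => (lap y x + 2 * g x + N * y x) ^ 2 := by
      funext x; simp [hg, Fin.sum_univ_three]
    rw [e]
    exact I1 _ (by fun_prop) (by intro x hx; simp [hg0 x hx, hyK x hx, hlap0 x hx])
  have st1 : 4 * ∫ x, g x ^ 2 ≤ ∫ x, (lap y x + 2 * (∑ i, θ i * pd i y x) + N * y x) ^ 2 := by
    have : ∫ x, (4 * g x ^ 2 + 4 * ((lap y x + N * y x) * g x)) ≤
        ∫ x, (lap y x + 2 * (∑ i, θ i * pd i y x) + N * y x) ^ 2 := by
      apply integral_mono ((ig2.const_mul 4).add (iQ.const_mul 4)) iG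
      intro x
      have e : (∑ i, θ i * pd i y x) = g x := by simp [hg, Fin.sum_univ_three]
      simp only [e, Pi.add_apply]
      nlinarith [sq_nonneg (lap y x + N * y x)]
    rw [integral_add (ig2.const_mul 4) (iQ.const_mul 4), integral_const_mul, integral_const_mul, hQ]
      at this
    linarith
  have st2 : N * ∫ x, y x ^ 2 ≤ 4 * δ ^ 2 * ∫ x, g x ^ 2 := by
    have : ∫ x, (1/2 * N * y x ^ 2 - 2 * δ ^ 2 * g x ^ 2) ≤
        ∫ x, (N * y x ^ 2 + 2 * (θ 0 * x 0 + θ 1 * x 1 + θ 2 * x 2) * y x * g x) := by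
      apply integral_mono ((iy2.const_mul (1/2 * N)).sub (ig2.const_mul (2 * δ ^ 2)))
      · exact I1 _ (by fun_prop) (by intro x hx; simp [hg0 x hx, hyK x hx])
      intro x
      by_cases hx : x ∈ closedBall (0:E3) δ
      · have hxn : ‖x‖ ≤ δ := by simpa using hx
        have hin : (θ 0 * x 0 + θ 1 * x 1 + θ 2 * x 2) ^ 2 ≤ N * δ ^ 2 := by
          have h1 : (θ 0 * x 0 + θ 1 * x 1 + θ 2 * x 2) ^ 2 ≤ N * ‖x‖ ^ 2 := by
            rw [hNe, norm_sq_E3]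
            nlinarith [sq_nonneg (θ 0 * x 1 - θ 1 * x 0), sq_nonneg (θ 0 * x 2 - θ 2 * x 0),
              sq_nonneg (θ 1 * x 2 - θ 2 * x 1)]
          have h2 : ‖x‖ ^ 2 ≤ δ ^ 2 := by gcongr
          have hN0 : 0 ≤ N := by positivity
          nlinarith
        set a := θ 0 * x 0 + θ 1 * x 1 + θ 2 * x 2
        change 1/2 * N * y x ^ 2 - 2 * δ ^ 2 * g x ^ 2 ≤ N * y x ^ 2 + 2 * a * y x * g x
        have h4 : a ^ 2 * y x ^ 2 ≤ N * δ ^ 2 * y x ^ 2 := by gcongr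
        have hδ2 : 0 < δ ^ 2 := by positivity
        have h5 : 0 ≤ (a * y x + 2 * δ ^ 2 * g x) ^ 2 := sq_nonneg _
        have h6 : 0 ≤ δ ^ 2 * (1/2 * N * y x ^ 2 + 2 * δ ^ 2 * g x ^ 2 + 2 * a * y x * g x) := by
          nlinarith
        have h7 := nonneg_of_mul_nonneg_right h6 hδ2
        linarith
      · simp [hg0 x hx, hyK x hx]
    rw [hP, integral_sub (iy2.const_mul (1/2 * N)) (ig2.const_mul (2 * δ ^ 2)), integral_const_mul,
      integral_const_mul] at this
    linarith
  calc N * ∫ x, y x ^ 2 ≤ 4 * δ ^ 2 * ∫ x, g x ^ 2 := st2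
    _ = δ ^ 2 * (4 * ∫ x, g x ^ 2) := by ring
    _ ≤ _ := by gcongr


theorem pd_exp_lin (θ x : E3) (i : Fin 3) :
    pd i (fun y : E3 => Real.exp (∑ j, θ j * y j)) x = Real.exp (∑ j, θ j * x j) * θ i := by
  apply pd_eq_of_hasLine (by fun_prop)
  have h := (((hasLine_coord x i 0).const_mul (θ 0)).add ((hasLine_coord x i 1).const_mul (θ 1))).add
    ((hasLine_coord x i 2).const_mul (θ 2))
  have h2 := h.exp
  simp only [Fin.sum_univ_three]
  refine h2.congr_deriv ?_
  fin_cases i <;> simp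

theorem lap_exp_lin (θ x : E3) :
    lap (fun y : E3 => Real.exp (∑ j, θ j * y j)) x = Real.exp (∑ j, θ j * x j) * ‖θ‖ ^ 2 := by
  have : ∀ i, pd i (pd i (fun y : E3 => Real.exp (∑ j, θ j * y j))) x =
      Real.exp (∑ j, θ j * x j) * θ i ^ 2 := by
    intro i
    rw [show pd i (fun y : E3 => Real.exp (∑ j, θ j * y j)) =
      fun y => Real.exp (∑ j, θ j * y j) • θ i from funext fun y => pd_exp_lin θ y i]
    rw [pd_smul (by fun_prop) (by fun_prop), pd_exp_lin]
    simp [pd]; ring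
  rw [lap, Finset.sum_congr rfl fun i _ => this i, norm_sq_E3, Fin.sum_univ_three]
  ring

theorem lin_carleman_real {f : E3 → ℝ} (hf : ContDiff ℝ 2 f) {δ : ℝ} (hδ : 0 < δ)
    (hsupp : ∀ x, δ < ‖x‖ → f x = 0) (θ : E3) :
    ‖θ‖ ^ 2 * ∫ x, Real.exp (-(2 * ∑ j, θ j * x j)) * (f x) ^ 2 ≤
      δ ^ 2 * ∫ x, Real.exp (-(2 * ∑ j, θ j * x j)) * (lap f x) ^ 2 := by
  set y : E3 → ℝ := fun x => Real.exp (-(∑ j, θ j * x j)) * f x with hy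
  have hyc : ContDiff ℝ 2 y := by
    apply ContDiff.mul _ hf
    fun_prop
  have hfy : f = fun x => Real.exp (∑ j, θ j * x j) • y x := by
    funext x; simp [hy, ← mul_assoc, ← Real.exp_add]
  have hlf : ∀ x, Real.exp (-(∑ j, θ j * x j)) * lap f x =
      lap y x + 2 * (∑ i, θ i * pd i y x) + ‖θ‖ ^ 2 * y x := by
    intro x
    conv_lhs => rw [hfy]
    rw [lap_smul (by fun_prop) hyc.contDiffAt, lap_exp_lin]
    simp only [pd_exp_lin]
    simp only [smul_eq_mul, Fin.sum_univ_three]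
    have : Real.exp (-(θ 0 * x 0 + θ 1 * x 1 + θ 2 * x 2)) *
      Real.exp (θ 0 * x 0 + θ 1 * x 1 + θ 2 * x 2) = 1 := by
      rw [← Real.exp_add, neg_add_cancel, Real.exp_zero]
    linear_combination (lap y x + 2 * (θ 0 * pd 0 y x + θ 1 * pd 1 y x + θ 2 * pd 2 y x)
      + ‖θ‖ ^ 2 * y x) * this
  have h := lin_carleman_core hyc hδ (by intro x hx; simp [hy, hsupp x hx]) θ
  have e1 : ∀ x : E3, Real.exp (-(2 * ∑ j, θ j * x j)) = Real.exp (-(∑ j, θ j * x j)) ^ 2 := by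
    intro x; rw [← Real.exp_nat_mul]; congr 1; push_cast; ring
  simp only [← hlf] at h
  simp only [hy, mul_pow] at h
  simpa only [e1] using h

/-- Linear Carleman estimate. -/
theorem lin_carleman {f : E3 → ℂ} (hf : ContDiff ℝ 2 f) {δ : ℝ} (hδ : 0 < δ)
    (hsupp : ∀ x, δ < ‖x‖ → f x = 0) (θ : E3) :
    ‖θ‖ ^ 2 * ∫ x, Real.exp (-(2 * ∑ j, θ j * x j)) * ‖f x‖ ^ 2 ≤
      δ ^ 2 * ∫ x, Real.exp (-(2 * ∑ j, θ j * x j)) * ‖lap f x‖ ^ 2 := by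
  have hK : IsCompact (closedBall (0:E3) δ) := isCompact_closedBall _ _
  have hyK : ∀ x ∉ closedBall (0:E3) δ, f x = 0 := by
    intro x hx; apply hsupp; simpa using hx
  have hl0 : ∀ x ∉ closedBall (0:E3) δ, lap f x = 0 := by
    intro x hx
    rw [lap_congr (v := fun _ => 0), lap_zero]
    filter_upwards [(isClosed_closedBall (x := (0:E3)) (ε := δ)).isOpen_compl.mem_nhds hx] with z hz
    exact hyK z hz
  have hlc : Continuous (lap f) := by
    have : lap f = fun x => pd 0 (pd 0 f) x + pd 1 (pd 1 f) x + pd 2 (pd 2 f) x :=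
      funext (lap_three f)
    rw [this]
    have h := fun i => (contDiff_pd' (n := 0) (i := i) (contDiff_pd' (n := 1) (i := i) hf (by norm_num))
      (by norm_num)).continuous
    exact ((h 0).add (h 1)).add (h 2)
  have hr : ∀ x, lap (fun y => (f y).re) x = (lap f x).re := fun x =>
    lap_clm Complex.reCLM hf.contDiffAt
  have hi : ∀ x, lap (fun y => (f y).im) x = (lap f x).im := fun x =>
    lap_clm Complex.imCLM hf.contDiffAt
  have h1 := lin_carleman_real (f := fun x => (f x).re) (Complex.reCLM.contDiff.comp hf) hδ
    (by intro x hx; simp [hsupp x hx]) θ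
  have h2 := lin_carleman_real (f := fun x => (f x).im) (Complex.imCLM.contDiff.comp hf) hδ
    (by intro x hx; simp [hsupp x hx]) θ
  simp only [hr, hi] at h1 h2
  have I1 : ∀ h : E3 → ℝ, Continuous h → (∀ x ∉ closedBall (0:E3) δ, h x = 0) → Integrable h :=
    fun h hc h0 => hc.integrable_of_hasCompactSupport (HasCompactSupport.intro hK h0)
  have hfc := hf.continuous
  have split : ∀ g : E3 → ℂ, Continuous g → (∀ x ∉ closedBall (0:E3) δ, g x = 0) →
      ∫ x, Real.exp (-(2 * ∑ j, θ j * x j)) * ‖g x‖ ^ 2 =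
      (∫ x, Real.exp (-(2 * ∑ j, θ j * x j)) * (g x).re ^ 2) +
      ∫ x, Real.exp (-(2 * ∑ j, θ j * x j)) * (g x).im ^ 2 := by
    intro g hg hg0
    rw [← integral_add]
    · congr 1; funext x
      rw [← mul_add, Complex.sq_norm, Complex.normSq_apply]; ring
    · exact I1 _ (by fun_prop) (by intro x hx; simp [hg0 x hx])
    · exact I1 _ (by fun_prop) (by intro x hx; simp [hg0 x hx])
  rw [split f hfc hyK, split _ hlc hl0]
  linarith


set_option maxHeartbeats 1000000 in
theorem polar_core {z : E3 → ℝ} (hz : ContDiff ℝ 2 z)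
    (hsupp : ∀ x, 1 < ‖x‖ → z x = 0) {τ : ℝ} (hτ : 3 ≤ τ) :
    τ ^ 3 * ∫ x, ‖x‖ ^ 2 * (z x) ^ 2 ≤
      ∫ x : E3, (‖x‖ ^ 2 * lap z x + (2 + 2 * (τ * (1 - ‖x‖ ^ 2 / 2))) * (∑ i, x i * pd i z x)
        + (2 + (τ * (1 - ‖x‖ ^ 2 / 2)) ^ 2 + 3 * (τ * (1 - ‖x‖ ^ 2 / 2)) - τ * ‖x‖ ^ 2) * z x) ^ 2 := by
  have hK : IsCompact (closedBall (0:E3) 1) := isCompact_closedBall _ _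
  have hzK : ∀ x ∉ closedBall (0:E3) 1, z x = 0 := by
    intro x hx; apply hsupp; simpa using hx
  have hev : ∀ x ∉ closedBall (0:E3) 1, z =ᶠ[nhds x] fun _ => 0 := by
    intro x hx
    filter_upwards [(isClosed_closedBall (x := (0:E3)) (ε := 1)).isOpen_compl.mem_nhds hx] with y hy
    exact hzK y hy
  have hpd0 : ∀ i, ∀ x ∉ closedBall (0:E3) 1, pd i z x = 0 := by
    intro i x hx
    rw [pd_congr i (hev x hx)]; simp [pd]
  have hpdc : ∀ i, ContDiff ℝ 1 (pd i z) := fun i => contDiff_pd' hz (by norm_num)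
  have hz1 : ContDiff ℝ 1 z := hz.of_le (by norm_num)
  have hpdc0 : ∀ i j, Continuous (pd i (pd j z)) := fun i j =>
    (contDiff_pd' (n := 0) (hpdc j) (by norm_num)).continuous
  have hlz : ∀ i x, HasDerivAt (fun t : ℝ => z (x + t • ee i)) (pd i z x) 0 :=
    fun i x => hasLine (hz1.differentiable (by simp) x) i
  have hlp : ∀ i j x, HasDerivAt (fun t : ℝ => pd j z (x + t • ee i)) (pd i (pd j z) x) 0 :=
    fun i j x => hasLine ((hpdc j).differentiable (by simp) x) i
  have hsy : ∀ i j x, pd i (pd j z) x = pd j (pd i z) x := fun i j x => pd_symm hz.contDiffAt i j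
  have I1 : ∀ h : E3 → ℝ, Continuous h → (∀ x ∉ closedBall (0:E3) 1, h x = 0) → Integrable h :=
    fun h hc h0 => hc.integrable_of_hasCompactSupport (HasCompactSupport.intro hK h0)
  have hlap : ∀ x, lap z x = pd 0 (pd 0 z) x + pd 1 (pd 1 z) x + pd 2 (pd 2 z) x := lap_three z
  have hlapc : Continuous (lap z) := by
    rw [show lap z = fun x => pd 0 (pd 0 z) x + pd 1 (pd 1 z) x + pd 2 (pd 2 z) x from funext hlap]
    exact ((hpdc0 0 0).add (hpdc0 1 1)).add (hpdc0 2 2)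
  have hlap0 : ∀ x ∉ closedBall (0:E3) 1, lap z x = 0 := by
    intro x hx
    rw [lap_congr (hev x hx), lap_zero]
  have hzc := hz1.continuous
  have hpc := fun i => (hpdc i).continuous
  have hpc0 := hpc 0
  have hpc1 := hpc 1
  have hpc2 := hpc 2
  -- abbreviations
  set s : E3 → ℝ := fun x => x 0 ^ 2 + x 1 ^ 2 + x 2 ^ 2 with hs
  have hsn : ∀ x : E3, ‖x‖ ^ 2 = s x := norm_sq_E3
  have hsc : ContDiff ℝ 1 s := by fun_prop
  have hsl : ∀ i x, HasDerivAt (fun t : ℝ => s (x + t • ee i)) (2 * x i) 0 := by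
    intro i x
    refine ((((hasLine_coord x i 0).pow 2).add ((hasLine_coord x i 1).pow 2)).add
      ((hasLine_coord x i 2).pow 2)).congr_deriv ?_
    fin_cases i <;> simp
  set D : E3 → ℝ := fun x => x 0 * pd 0 z x + x 1 * pd 1 z x + x 2 * pd 2 z x with hD
  have hDc : ContDiff ℝ 1 D := by
    have h0 := hpdc 0; have h1 := hpdc 1; have h2 := hpdc 2
    fun_prop
  have hDl : ∀ i x, HasDerivAt (fun t : ℝ => D (x + t • ee i))
      (pd i z x + (x 0 * pd i (pd 0 z) x + x 1 * pd i (pd 1 z) x + x 2 * pd i (pd 2 z) x)) 0 := by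
    intro i x
    refine ((((hasLine_coord x i 0).mul (hlp i 0 x)).add ((hasLine_coord x i 1).mul (hlp i 1 x))).add
      ((hasLine_coord x i 2).mul (hlp i 2 x))).congr_deriv ?_
    fin_cases i <;> simp <;> ring
  have hD0 : ∀ x ∉ closedBall (0:E3) 1, D x = 0 := by
    intro x hx; simp [hD, hpd0 _ x hx]
  have hDcc := hDc.continuous
  have hscc := hsc.continuous
  have hGl : ∀ i x, HasDerivAt (fun t : ℝ => pd 0 z (x + t • ee i) ^ 2 + pd 1 z (x + t • ee i) ^ 2
      + pd 2 z (x + t • ee i) ^ 2) (2 * (pd 0 z x * pd i (pd 0 z) x + pd 1 z x * pd i (pd 1 z) x +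
        pd 2 z x * pd i (pd 2 z) x)) 0 := by
    intro i x
    refine ((((hlp i 0 x).pow 2).add ((hlp i 1 x).pow 2)).add ((hlp i 2 x).pow 2)).congr_deriv ?_
    simp; ring
  have hpl : ∀ i x, HasDerivAt (fun t : ℝ => τ * (1 - s (x + t • ee i) / 2)) (-(τ * x i)) 0 := by
    intro i x
    refine ((((hsl i x).div_const 2).const_sub 1).const_mul τ).congr_deriv ?_
    ring
  have hxl : ∀ (i : Fin 3) (x : E3), HasDerivAt (fun t : ℝ => (x + t • ee i) i) 1 0 := by
    intro i x; simpa using hasLine_coord x i i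
  have key : ∫ x, (2 * ((s x * lap z x + 2 * D x + (2 + (τ * (1 - s x / 2)) ^ 2) * z x) *
      (2 * (τ * (1 - s x / 2)) * D x + (3 * (τ * (1 - s x / 2)) - τ * s x) * z x)) -
      (4 * τ * s x * (D x + 3/2 * z x) ^ 2 + (-4 * τ * s x + 4 * (τ * (1 - s x / 2)) ^ 2 * τ * s x) *
        z x ^ 2)) = 0 := by
    refine ibp3 (V := fun j x =>
      2 * ((2 * (τ * (1 - s x / 2)) * (D x + 3/2 * z x) - τ * (s x * z x)) *
        (s x * pd j z x + 3/2 * (x j * z x)))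
      - 2 * ((τ * (1 - s x / 2)) * ((s x * (pd 0 z x ^ 2 + pd 1 z x ^ 2 + pd 2 z x ^ 2) + 3 * (z x * D x)
        + 9/4 * z x ^ 2) * x j))
      + 2 * τ * (s x * (z x ^ 2 * x j)) + 2 * (((τ * (1 - s x / 2)) ^ 2 - 1/4) *
       ((τ * (1 - s x / 2)) * (z x ^ 2 * x j))))
      (fun j => by have h0 := hpdc 0; have h1 := hpdc 1; have h2 := hpdc 2; have h3 := hpdc j; fun_prop)
      hK (by intro j x hx; simp [hpd0 _ x hx, hzK x hx])
      (fun j x => ((((((((hpl j x).const_mul 2).mul ((hDl j x).add ((hlz j x).const_mul (3/2)))).sub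
        (((hsl j x).mul (hlz j x)).const_mul τ)).mul (((hsl j x).mul (hlp j j x)).add
          (((hxl j x).mul (hlz j x)).const_mul (3/2)))).const_mul 2).sub
        (((hpl j x).mul (((((hsl j x).mul (hGl j x)).add (((hlz j x).mul (hDl j x)).const_mul 3)).add
          (((hlz j x).pow 2).const_mul (9/4))).mul (hxl j x))).const_mul 2)).add
        (((hsl j x).mul (((hlz j x).pow 2).mul (hxl j x))).const_mul (2*τ))).add
        (((((hpl j x).pow 2).sub_const (1/4)).mul ((hpl j x).mul (((hlz j x).pow 2).mul (hxl j x)))).const_mul 2))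
      ?_
    intro x
    simp only [hD, hs, hlap, hsy 1 0 x, hsy 2 0 x, hsy 2 1 x, zero_smul, add_zero, Pi.mul_apply,
      Pi.add_apply, Pi.sub_apply, Pi.pow_apply]
    ring
  have e : ∀ x : E3, (‖x‖ ^ 2 * lap z x + (2 + 2 * (τ * (1 - ‖x‖ ^ 2 / 2))) * (∑ i, x i * pd i z x)
        + (2 + (τ * (1 - ‖x‖ ^ 2 / 2)) ^ 2 + 3 * (τ * (1 - ‖x‖ ^ 2 / 2)) - τ * ‖x‖ ^ 2) * z x) ^ 2 =
      ((s x * lap z x + 2 * D x + (2 + (τ * (1 - s x / 2)) ^ 2) * z x) +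
      (2 * (τ * (1 - s x / 2)) * D x + (3 * (τ * (1 - s x / 2)) - τ * s x) * z x)) ^ 2 := by
    intro x
    rw [hsn, Fin.sum_univ_three]
    simp only [hD]; ring
  simp only [e]
  simp only [hsn]
  set Sf : E3 → ℝ := fun x => s x * lap z x + 2 * D x + (2 + (τ * (1 - s x / 2)) ^ 2) * z x with hSf
  set Af : E3 → ℝ := fun x => 2 * (τ * (1 - s x / 2)) * D x + (3 * (τ * (1 - s x / 2)) - τ * s x) * z x
    with hAf
  have hSc : Continuous Sf := by fun_prop
  have hAc : Continuous Af := by fun_prop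
  have hS0 : ∀ x ∉ closedBall (0:E3) 1, Sf x = 0 := by
    intro x hx; simp [hSf, hD0 x hx, hzK x hx, hlap0 x hx]
  have hA0 : ∀ x ∉ closedBall (0:E3) 1, Af x = 0 := by
    intro x hx; simp [hAf, hD0 x hx, hzK x hx]
  rw [← integral_const_mul, ← sub_nonneg, ← integral_sub]
  · have : (0:ℝ) ≤ ∫ x, ((Sf x + Af x) ^ 2 - τ ^ 3 * (s x * z x ^ 2) - 2 *
      (2 * (Sf x * Af x) -
      (4 * τ * s x * (D x + 3/2 * z x) ^ 2 + (-4 * τ * s x + 4 * (τ * (1 - s x / 2)) ^ 2 * τ * s x) *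
        z x ^ 2))) := by
      apply integral_nonneg
      intro x
      by_cases hx : x ∈ closedBall (0:E3) 1
      · have hs1 : s x ≤ 1 := by
          rw [← hsn]; have : ‖x‖ ≤ 1 := by simpa using hx
          nlinarith [norm_nonneg x]
        have hs0 : 0 ≤ s x := by rw [← hsn]; positivity
        set p := τ * (1 - s x / 2)
        have hp : τ / 2 ≤ p := by
          change τ / 2 ≤ τ * (1 - s x / 2); nlinarith
        have hp2 : τ ^ 2 / 4 ≤ p ^ 2 := by nlinarith
        have h1 : 0 ≤ (Sf x - Af x) ^ 2 := sq_nonneg _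
        have h2 : 0 ≤ τ * s x * (D x + 3/2 * z x) ^ 2 := by positivity
        have h3 : 0 ≤ τ * s x * (8 * p ^ 2 - 8 - τ ^ 2) * z x ^ 2 := by
          have : 0 ≤ 8 * p ^ 2 - 8 - τ ^ 2 := by nlinarith
          positivity
        change 0 ≤ (Sf x + Af x) ^ 2 - τ ^ 3 * (s x * z x ^ 2) - 2 * (2 * (Sf x * Af x) -
          (4 * τ * s x * (D x + 3/2 * z x) ^ 2 + (-4 * τ * s x + 4 * p ^ 2 * τ * s x) * z x ^ 2))
        have h4 : (Sf x + Af x) ^ 2 - τ ^ 3 * (s x * z x ^ 2) - 2 * (2 * (Sf x * Af x) -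
          (4 * τ * s x * (D x + 3/2 * z x) ^ 2 + (-4 * τ * s x + 4 * p ^ 2 * τ * s x) * z x ^ 2)) =
          (Sf x - Af x) ^ 2 + 8 * (τ * s x * (D x + 3/2 * z x) ^ 2) +
          τ * s x * (8 * p ^ 2 - 8 - τ ^ 2) * z x ^ 2 := by ring
        rw [h4]
        linarith
      · simp [hD0 x hx, hzK x hx, hS0 x hx]
        positivity
    rw [integral_sub, integral_const_mul, key] at this
    · simpa using this
    · exact I1 _ (by fun_prop) (by intro x hx; simp [hzK x hx, hS0 x hx, hA0 x hx])
    · exact I1 _ (by fun_prop) (by intro x hx; simp [hzK x hx, hS0 x hx, hD0 x hx])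
  · exact I1 _ (by fun_prop) (by intro x hx; simp [hlap0 x hx, hD0 x hx, hzK x hx])
  · exact I1 _ (by fun_prop) (by intro x hx; simp [hzK x hx])


/-- The polar Carleman weight. -/
noncomputable def Wt (n : ℕ) (x : E3) : ℝ :=
  ((‖x‖ ^ 2) ^ n)⁻¹ * Real.exp ((2 * n - 1) * ‖x‖ ^ 2 / 4)

theorem Wt_contDiffAt (n : ℕ) {x : E3} (hx : x ≠ 0) : ContDiffAt ℝ 2 (Wt n) x := by
  unfold Wt
  have h : ContDiff ℝ 2 (fun x : E3 => ‖x‖ ^ 2) := contDiff_norm_sq ℝ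
  apply ContDiffAt.mul
  · apply ContDiffAt.inv
    · exact (h.pow n).contDiffAt
    · positivity
  · apply ContDiffAt.exp
    apply ContDiffAt.div_const
    exact (contDiff_const.mul h).contDiffAt

theorem Wt_mul (n : ℕ) {f : E3 → ℝ} (hf : ContDiff ℝ 2 f) {ε : ℝ} (hε : 0 < ε)
    (h0 : ∀ x, ‖x‖ < ε → f x = 0) : ContDiff ℝ 2 (fun x => Wt n x * f x) := by
  rw [contDiff_iff_contDiffAt]
  intro x
  by_cases hx : x = 0
  · apply (contDiffAt_const (c := (0:ℝ))).congr_of_eventuallyEq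
    rw [hx]
    filter_upwards [Metric.ball_mem_nhds (0:E3) hε] with y hy
    rw [h0 y (by simpa using hy)]; simp
  · exact (Wt_contDiffAt n hx).mul hf.contDiffAt

theorem polar_real {f : E3 → ℝ} (hf : ContDiff ℝ 2 f) {ε : ℝ} (hε : 0 < ε)
    (h0 : ∀ x, ‖x‖ < ε → f x = 0)
    (hsupp : ∀ x, 1 < ‖x‖ → f x = 0) {n : ℕ} (hn : 2 ≤ n) :
    (2 * n - 1 : ℝ) ^ 3 * ∫ x, ‖x‖ ^ 2 * (Wt n x * f x) ^ 2 ≤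
      ∫ x : E3, (‖x‖ ^ 2 * (Wt n x * lap f x)) ^ 2 := by
  have hn2 : (2:ℝ) ≤ n := by exact_mod_cast hn
  set τ : ℝ := 2 * n - 1 with hτ
  set z : E3 → ℝ := fun x => Wt n x * f x with hz
  have hzc : ContDiff ℝ 2 z := Wt_mul n hf hε h0
  have h := polar_core hzc (by intro x hx; simp [hz, hsupp x hx]) (τ := τ) (by rw [hτ]; linarith)
  refine h.trans (le_of_eq ?_)
  congr 1
  funext x
  congr 1
  by_cases hx : x = 0
  · have e0 : z =ᶠ[nhds x] fun _ => 0 := by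
      rw [hx]
      filter_upwards [Metric.ball_mem_nhds (0:E3) hε] with y hy
      simp [hz, h0 y (by simpa using hy)]
    rw [e0.eq_of_nhds, lap_congr e0, lap_zero]
    simp [hx]
  · set G : ℝ → ℝ := fun t => t ^ n * Real.exp (-(τ * t / 4)) with hG
    have hGd : ∀ t : ℝ, 0 < t → HasDerivAt G (G t * (n / t - τ / 4)) t := by
      intro t ht
      have e1 : HasDerivAt (fun t : ℝ => Real.exp (-(τ * t / 4))) (Real.exp (-(τ * t / 4)) * (-(τ * 1 / 4))) t :=
        ((((hasDerivAt_id t).const_mul τ).div_const 4).neg).exp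
      refine ((hasDerivAt_pow n t).mul e1).congr_deriv ?_
      obtain ⟨m, rfl⟩ : ∃ m, n = m + 1 := ⟨n - 1, by omega⟩
      simp only [hG, Nat.add_sub_cancel]
      field_simp
      ring
    have hs : 0 < ‖x‖ ^ 2 := by positivity
    have hG2 : HasDerivAt (fun t => G t * (n / t - τ / 4))
      (G (‖x‖ ^ 2) * ((n / ‖x‖ ^ 2 - τ / 4) ^ 2 - n / (‖x‖ ^ 2) ^ 2)) (‖x‖ ^ 2) := by
      have e1 : HasDerivAt (fun t : ℝ => (n:ℝ) / t - τ / 4) (-n / (‖x‖ ^ 2) ^ 2) (‖x‖ ^ 2) := by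
        refine ((((hasDerivAt_const (‖x‖^2) (n:ℝ)).div (hasDerivAt_id _) hs.ne')).sub_const _).congr_deriv ?_
        simp
      refine ((hGd _ hs).mul e1).congr_deriv ?_
      ring
    have hfz : f = fun x => G (‖x‖ ^ 2) • z x := by
      funext y
      by_cases hy : y = 0
      · simp [hy, hz, h0 0 (by simpa using hε)]
      · have : 0 < ‖y‖ ^ 2 := by positivity
        simp only [hz, Wt, hG, smul_eq_mul, ← hτ]
        rw [Real.exp_neg]
        field_simp
    have hnsq : ContDiff ℝ 2 (fun x : E3 => ‖x‖ ^ 2) := contDiff_norm_sq ℝ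
    have hWG : Wt n x * G (‖x‖ ^ 2) = 1 := by
      simp only [Wt, hG, ← hτ]
      rw [Real.exp_neg]
      field_simp
    conv_rhs => rw [hfz]
    rw [lap_smul (by
      apply ContDiff.contDiffAt
      simp only [hG]
      apply ContDiff.mul (hnsq.pow n)
      apply ContDiff.exp
      exact ((contDiff_const.mul hnsq).div_const _).neg) hzc.contDiffAt,
      lap_radial (G1 := fun t => G t * (n / t - τ / 4)) (by
        filter_upwards [lt_mem_nhds hs] with t ht using hGd t ht) hG2]
    simp only [pd_radial (hGd _ hs), smul_eq_mul]
    rw [show (∑ i, 2 * x i * (G (‖x‖ ^ 2) * (n / ‖x‖ ^ 2 - τ / 4)) * pd i z x) =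
      2 * (G (‖x‖ ^ 2) * (n / ‖x‖ ^ 2 - τ / 4)) * ∑ i, x i * pd i z x by
        rw [Finset.mul_sum]; exact Finset.sum_congr rfl fun i _ => by ring]
    set s := ‖x‖ ^ 2
    set g := G s
    set D := ∑ i, x i * pd i z x
    have e2 : s * (Wt n x * (g * lap z x + 2 * (2 * (g * (n / s - τ / 4)) * D) +
      (6 * (g * (n / s - τ / 4)) + 4 * s * (g * ((n / s - τ / 4) ^ 2 - n / s ^ 2))) * z x)) =
      (Wt n x * g) * (s * (lap z x + 2 * (2 * (n / s - τ / 4) * D) +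
      (6 * (n / s - τ / 4) + 4 * s * ((n / s - τ / 4) ^ 2 - n / s ^ 2)) * z x)) := by ring
    rw [e2, hWG, one_mul]
    have hnτ : (n:ℝ) = (τ + 1) / 2 := by rw [hτ]; ring
    rw [hnτ]
    field_simp
    ring

/-- Polar Carleman estimate. -/
theorem polar_carleman {f : E3 → ℂ} (hf : ContDiff ℝ 2 f) {ε : ℝ} (hε : 0 < ε)
    (h0 : ∀ x, ‖x‖ < ε → f x = 0)
    (hsupp : ∀ x, 1 < ‖x‖ → f x = 0) {n : ℕ} (hn : 2 ≤ n) :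
    (2 * n - 1 : ℝ) ^ 3 * ∫ x, ‖x‖ ^ 2 * (Wt n x * ‖f x‖) ^ 2 ≤
      ∫ x : E3, (‖x‖ ^ 2 * (Wt n x * ‖lap f x‖)) ^ 2 := by
  have hK : IsCompact (closedBall (0:E3) 1 \ ball 0 ε) := (isCompact_closedBall _ _).diff isOpen_ball
  have hyK : ∀ x ∉ closedBall (0:E3) 1 \ ball 0 ε, f x = 0 := by
    intro x hx
    by_cases h : ‖x‖ < ε
    · exact h0 x h
    · apply hsupp; by_contra h1
      exact hx ⟨by simpa using h1, by simpa using h⟩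
  have hl0 : ∀ x ∉ closedBall (0:E3) 1 \ ball 0 ε, lap f x = 0 := by
    intro x hx
    rw [lap_congr (v := fun _ => 0), lap_zero]
    filter_upwards [hK.isClosed.isOpen_compl.mem_nhds hx] with z hz
    exact hyK z hz
  have hlc : Continuous (lap f) := by
    have : lap f = fun x => pd 0 (pd 0 f) x + pd 1 (pd 1 f) x + pd 2 (pd 2 f) x :=
      funext (lap_three f)
    rw [this]
    have h := fun i => (contDiff_pd' (n := 0) (i := i) (contDiff_pd' (n := 1) (i := i) hf (by norm_num))
      (by norm_num)).continuous
    exact ((h 0).add (h 1)).add (h 2)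
  have hr : ∀ x, lap (fun y => (f y).re) x = (lap f x).re := fun x =>
    lap_clm Complex.reCLM hf.contDiffAt
  have hi : ∀ x, lap (fun y => (f y).im) x = (lap f x).im := fun x =>
    lap_clm Complex.imCLM hf.contDiffAt
  have h1 := polar_real (f := fun x => (f x).re) (Complex.reCLM.contDiff.comp hf) hε
    (by intro x hx; simp [h0 x hx]) (by intro x hx; simp [hsupp x hx]) hn
  have h2 := polar_real (f := fun x => (f x).im) (Complex.imCLM.contDiff.comp hf) hε
    (by intro x hx; simp [h0 x hx]) (by intro x hx; simp [hsupp x hx]) hn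
  simp only [hr, hi] at h1 h2
  have I1 : ∀ h : E3 → ℝ, (∀ x ≠ 0, ContinuousAt h x) → (∀ x ∉ closedBall (0:E3) 1 \ ball 0 ε, h x = 0) → Integrable h := by
    intro h hc hh0
    refine Continuous.integrable_of_hasCompactSupport ?_ (HasCompactSupport.intro hK hh0)
    rw [continuous_iff_continuousAt]
    intro x
    by_cases hx : x = 0
    · refine (continuousAt_const (y := (0:ℝ))).congr (Filter.EventuallyEq.symm ?_)
      rw [hx]
      filter_upwards [Metric.ball_mem_nhds (0:E3) hε] with y hy
      exact hh0 y (fun h => h.2 hy)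
    · exact hc x hx
  have hfc := hf.continuous
  have hWc : ∀ x : E3, x ≠ 0 → ContinuousAt (Wt n) x := fun x hx => (Wt_contDiffAt n hx).continuousAt
  have cc : ∀ g : E3 → ℝ, Continuous g → (∀ x ∉ closedBall (0:E3) 1 \ ball 0 ε, g x = 0) →
      ∀ a : E3 → ℝ, Continuous a → Integrable (fun x => a x * (Wt n x * g x) ^ 2) := by
    intro g hg hg0 a ha
    apply I1
    · intro x hx
      exact ha.continuousAt.mul (((hWc x hx).mul hg.continuousAt).pow 2)
    · intro x hx; simp [hg0 x hx]
  have split : ∀ g : E3 → ℂ, Continuous g → (∀ x ∉ closedBall (0:E3) 1 \ ball 0 ε, g x = 0) →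
      ∀ a : E3 → ℝ, Continuous a →
      ∫ x, a x * (Wt n x * ‖g x‖) ^ 2 =
      (∫ x, a x * (Wt n x * (g x).re) ^ 2) + ∫ x, a x * (Wt n x * (g x).im) ^ 2 := by
    intro g hg hg0 a ha
    rw [← integral_add]
    · congr 1; funext x
      rw [mul_pow, Complex.sq_norm, Complex.normSq_apply]; ring
    · exact cc _ (by fun_prop) (by intro x hx; simp [hg0 x hx]) a ha
    · exact cc _ (by fun_prop) (by intro x hx; simp [hg0 x hx]) a ha
  simp only [mul_pow (‖_‖ ^ 2) (Wt n _ * _) 2] at h1 h2 ⊢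
  rw [split f hfc hyK _ (by fun_prop), split _ hlc hl0 _ (by fun_prop)]
  linarith


section affine
variable {F : Type*} [NormedAddCommGroup F] [NormedSpace ℝ F]

theorem pd_affine {u : E3 → F} (a : ℝ) (b : E3) {x : E3} (h : DifferentiableAt ℝ u (a • x + b)) (i : Fin 3) :
    pd i (fun y => u (a • y + b)) x = a • pd i u (a • x + b) := by
  have h1 : HasFDerivAt (fun y : E3 => a • y + b) (a • ContinuousLinearMap.id ℝ E3) x :=
    ((hasFDerivAt_id x).const_smul a).add_const b
  have := pd_eq (u := fun y => u (a • y + b)) (h.hasFDerivAt.comp x h1) i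
  rw [this]
  simp [pd]

theorem lap_affine {u : E3 → F} (a : ℝ) (b : E3) {x : E3} (h : ContDiffAt ℝ 2 u (a • x + b)) :
    lap (fun y => u (a • y + b)) x = a ^ 2 • lap u (a • x + b) := by
  unfold lap
  rw [Finset.smul_sum]
  refine Finset.sum_congr rfl fun i _ => ?_
  have hc : ContinuousAt (fun y : E3 => a • y + b) x := by fun_prop
  rw [pd_congr i (v := fun y => a • pd i u (a • y + b)) (by
    filter_upwards [hc.eventually (diff_near h)] with y hy
    exact pd_affine a b hy i)]
  have h1 := pd_diffAt h i
  have h2 : DifferentiableAt ℝ (fun y => pd i u (a • y + b)) x :=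
    DifferentiableAt.comp (g := pd i u) (f := fun y : E3 => a • y + b) x h1 (by fun_prop)
  rw [pd_smul (g := fun _ => a) (by fun_prop) h2, pd_affine a b h1]
  simp [pd, sq, smul_smul]

theorem continuous_lap {u : E3 → F} (h : ContDiff ℝ 2 u) : Continuous (lap u) := by
  rw [show lap u = fun x => pd 0 (pd 0 u) x + pd 1 (pd 1 u) x + pd 2 (pd 2 u) x from
    funext (lap_three u)]
  have h := fun i => (contDiff_pd' (n := 0) (i := i) (contDiff_pd' (n := 1) (i := i) h (by norm_num))
      (by norm_num)).continuous
  exact ((h 0).add (h 1)).add (h 2)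

theorem continuous_pd {u : E3 → F} (h : ContDiff ℝ 2 u) (i : Fin 3) : Continuous (pd i u) :=
  (contDiff_pd' (n := 1) (i := i) h (by norm_num)).continuous

end affine

/-- Basic cutoff: zero for `‖x‖ ≤ 1`, one for `2 ≤ ‖x‖ ^ 2`. -/
noncomputable def cut0 (x : E3) : ℝ := Real.smoothTransition (‖x‖ ^ 2 - 1)

theorem cut0_contDiff {n : ℕ∞} : ContDiff ℝ n cut0 := by
  unfold cut0
  exact Real.smoothTransition.contDiff.comp ((contDiff_norm_sq ℝ).sub contDiff_const)

theorem cut0_bound : ∃ B : ℝ, 0 ≤ B ∧ ∀ x : E3, ‖x‖ ≤ 2 → (∀ i, |pd i cut0 x| ≤ B) ∧ |lap cut0 x| ≤ B := by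
  have hc : ContDiff ℝ 2 cut0 := cut0_contDiff (n := 2)
  have hK : IsCompact (closedBall (0:E3) 2) := isCompact_closedBall _ _
  obtain ⟨b, hb⟩ := hK.exists_bound_of_continuousOn (continuous_lap hc).continuousOn
  have : ∀ i, ∃ b, ∀ x ∈ closedBall (0:E3) 2, ‖pd i cut0 x‖ ≤ b := fun i =>
    hK.exists_bound_of_continuousOn (continuous_pd hc i).continuousOn
  choose a ha using this
  have ha0 : ∀ i, 0 ≤ a i := fun i => (norm_nonneg _).trans (ha i 0 (by simp))
  have hb0 : 0 ≤ b := (norm_nonneg _).trans (hb 0 (by simp))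
  refine ⟨b + ∑ i, a i, add_nonneg hb0 (Finset.sum_nonneg fun i _ => ha0 i), ?_⟩
  intro x hx
  have hx' : x ∈ closedBall (0:E3) 2 := by simpa using hx
  constructor
  · intro i
    have := ha i x hx'
    have h2 := Finset.single_le_sum (f := a) (fun i _ => ha0 i) (Finset.mem_univ i)
    rw [Real.norm_eq_abs] at this
    linarith
  · have := hb x hx'
    rw [Real.norm_eq_abs] at this
    have h2 : 0 ≤ ∑ i, a i := Finset.sum_nonneg fun i _ => ha0 i
    linarith

theorem cut0_nonneg (x : E3) : 0 ≤ cut0 x := Real.smoothTransition.nonneg _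
theorem cut0_le (x : E3) : cut0 x ≤ 1 := Real.smoothTransition.le_one _
theorem cut0_zero {x : E3} (h : ‖x‖ ≤ 1) : cut0 x = 0 :=
  Real.smoothTransition.zero_of_nonpos (by nlinarith [norm_nonneg x])
theorem cut0_one {x : E3} (h : 2 ≤ ‖x‖ ^ 2) : cut0 x = 1 :=
  Real.smoothTransition.one_of_one_le (by linarith)

/-- Properties of the scaled inner cutoff applied to a flat function. -/
theorem flat_cut {C : ℝ} {F : E3 → ℂ} (hF : ContDiff ℝ 2 F) {B : ℝ}
    (hB : ∀ x : E3, ‖x‖ ≤ 2 → (∀ i, |pd i cut0 x| ≤ B) ∧ |lap cut0 x| ≤ B)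
    {ε : ℝ} (hε : 0 < ε) (hε1 : ε ≤ 1) {x : E3} (hx : ‖x‖ ≤ 2 * ε) {m : ℝ}
    (h1 : ‖F x‖ ≤ m) (h2 : ∀ i, ‖pd i F x‖ ≤ m) (h3 : ‖lap F x‖ ≤ C * m) (hC : 0 ≤ C) :
    ‖lap (fun y => cut0 (ε⁻¹ • y + 0) • F y) x‖ ≤ (C + 7 * B) * m * (ε ^ 2)⁻¹ := by
  have hc : ContDiff ℝ 2 cut0 := cut0_contDiff (n := 2)
  have hm : 0 ≤ m := (norm_nonneg _).trans h1
  have hxs : ‖ε⁻¹ • x + 0‖ ≤ 2 := by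
    rw [add_zero, norm_smul, norm_inv, Real.norm_eq_abs, abs_of_pos hε, inv_mul_le_iff₀ hε]
    linarith
  obtain ⟨b1, b2⟩ := hB _ hxs
  have hB0 : 0 ≤ B := (abs_nonneg _).trans b2
  rw [lap_smul (g := fun y => cut0 (ε⁻¹ • y + 0)) (hc.comp (by fun_prop)).contDiffAt hF.contDiffAt, lap_affine _ _ hc.contDiffAt]
  simp only [pd_affine _ _ (hc.differentiable (by simp) _)]
  have hi1 : 1 ≤ ε⁻¹ := (one_le_inv₀ hε).2 hε1
  have t1 : ‖cut0 (ε⁻¹ • x + 0) • lap F x‖ ≤ C * m * (ε ^ 2)⁻¹ := by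
    rw [norm_smul, Real.norm_eq_abs, abs_of_nonneg (cut0_nonneg _)]
    have : cut0 (ε⁻¹ • x + 0) * ‖lap F x‖ ≤ 1 * (C * m) :=
      mul_le_mul (cut0_le _) h3 (norm_nonneg _) zero_le_one
    have h4 : 1 ≤ (ε ^ 2)⁻¹ := by rw [← inv_pow]; exact one_le_pow₀ hi1
    have h5 : 0 ≤ C * m := by positivity
    nlinarith
  have t2 : ‖(2:ℝ) • ∑ i, (ε⁻¹ • pd i cut0 (ε⁻¹ • x + 0)) • pd i F x‖ ≤ 6 * B * m * (ε ^ 2)⁻¹ := by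
    rw [norm_smul]
    have : ‖∑ i, (ε⁻¹ • pd i cut0 (ε⁻¹ • x + 0)) • pd i F x‖ ≤ ∑ i : Fin 3, B * m * (ε ^ 2)⁻¹ := by
      refine norm_sum_le_of_le _ fun i _ => ?_
      rw [norm_smul, smul_eq_mul, Real.norm_eq_abs, abs_mul, abs_of_pos (by positivity : 0 < ε⁻¹)]
      have h6 : |pd i cut0 (ε⁻¹ • x + 0)| * ‖pd i F x‖ ≤ B * m :=
        mul_le_mul (b1 i) (h2 i) (norm_nonneg _) hB0
      have h7 : ε⁻¹ ≤ (ε ^ 2)⁻¹ := by rw [← inv_pow]; nlinarith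
      have h8 : 0 ≤ B * m := by positivity
      calc ε⁻¹ * |pd i cut0 (ε⁻¹ • x + 0)| * ‖pd i F x‖ = (|pd i cut0 (ε⁻¹ • x + 0)| * ‖pd i F x‖) * ε⁻¹ := by ring
        _ ≤ B * m * (ε ^ 2)⁻¹ := by gcongr
    simp at this
    simp
    linarith
  have t3 : ‖(ε⁻¹ ^ 2 • lap cut0 (ε⁻¹ • x + 0)) • F x‖ ≤ B * m * (ε ^ 2)⁻¹ := by
    rw [norm_smul, smul_eq_mul, Real.norm_eq_abs, abs_mul, abs_of_pos (by positivity : 0 < ε⁻¹ ^ 2), inv_pow]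
    have h6 : |lap cut0 (ε⁻¹ • x + 0)| * ‖F x‖ ≤ B * m :=
        mul_le_mul b2 h1 (norm_nonneg _) hB0
    calc (ε ^ 2)⁻¹ * |lap cut0 (ε⁻¹ • x + 0)| * ‖F x‖ = (|lap cut0 (ε⁻¹ • x + 0)| * ‖F x‖) * (ε ^ 2)⁻¹ := by ring
        _ ≤ B * m * (ε ^ 2)⁻¹ := by gcongr
  refine (norm_add₃_le).trans ?_
  linarith

set_option maxHeartbeats 800000 in
/-- Strong unique continuation, local form. -/
theorem ucp_flat {F : E3 → ℂ} (hF : ContDiff ℝ 2 F) (hsupp : ∀ x, 1 < ‖x‖ → F x = 0)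
    {ρ : ℝ} (hρ : 0 < ρ) (hρ1 : ρ ≤ 1) {C : ℝ} (hC0 : 0 ≤ C)
    (hC : ∀ x, ‖x‖ < ρ → ‖lap F x‖ ≤ C * ‖F x‖)
    (hflat : ∀ K : ℕ, ∃ c : ℝ, ∃ r > 0, ∀ x, ‖x‖ < r → ‖F x‖ ≤ c * ‖x‖ ^ K ∧
      ∀ i, ‖pd i F x‖ ≤ c * ‖x‖ ^ K) :
    ∀ x, ‖x‖ < ρ / 2 → F x = 0 := by
  have hc : ContDiff ℝ 2 cut0 := cut0_contDiff (n := 2)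
  obtain ⟨B, hB0, hB⟩ := cut0_bound
  have hFc := hF.continuous
  have hlF0 : ∀ x, 1 < ‖x‖ → lap F x = 0 := by
    intro x hx
    rw [lap_congr (v := fun _ => 0), lap_zero]
    filter_upwards [(isOpen_lt continuous_const continuous_norm).mem_nhds hx] with y hy using hsupp y hy
  obtain ⟨M, hM⟩ : ∃ M, ∀ x, ‖lap F x‖ ≤ M := by
    obtain ⟨M, hM⟩ := (isCompact_closedBall (0:E3) 1).exists_bound_of_continuousOn
      (continuous_lap hF).continuousOn
    refine ⟨M, fun x => ?_⟩
    by_cases hx : ‖x‖ ≤ 1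
    · exact hM x (by simpa using hx)
    · rw [hlF0 x (not_le.1 hx), norm_zero]
      exact (norm_nonneg _).trans (hM 0 (by simp))
  have hM0 : 0 ≤ M := (norm_nonneg _).trans (hM 0)
  set vol : ℝ := (volume (closedBall (0:E3) 1)).toReal with hvol
  -- main estimate
  have main : ∀ ε0 > 0, ∀ n : ℕ, 2 ≤ n → C ^ 2 + 1 ≤ n →
      ∫ x, ({x : E3 | ε0 < ‖x‖ ∧ ‖x‖ < ρ / 2}.indicator (fun x => ‖x‖ ^ 2 * ‖F x‖ ^ 2)) x ≤
        ((ρ/2) ^ n) ^ 4 * (vol * (M ^ 2 * (((ρ ^ n)⁻¹) ^ 4 * Real.exp n))) := by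
    intro ε0 hε0 n hn hnC
    have hnR : (2:ℝ) ≤ n := by exact_mod_cast hn
    obtain ⟨c, r, hr, hcr⟩ := hflat (2 * n + 3)
    set A : ℝ := Real.exp n * ((C + 7 * B) * (|c| * 2 ^ (2 * n + 3))) with hA
    have hA0 : 0 ≤ A := by positivity
    have est : ∀ ε, 0 < ε → 2 * ε < r → 2 * ε < ρ → 2 * ε < ε0 →
        ∫ x, ({x : E3 | ε0 < ‖x‖ ∧ ‖x‖ < ρ / 2}.indicator (fun x => ‖x‖ ^ 2 * ‖F x‖ ^ 2)) x ≤
        ((ρ/2) ^ n) ^ 4 * (vol * (A ^ 2 * ε ^ 2 + M ^ 2 * (((ρ ^ n)⁻¹) ^ 4 * Real.exp n))) := by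
      intro ε hε hεr hερ hεε0
      have hε1 : ε ≤ 1 := by linarith
      set f : E3 → ℂ := fun y => cut0 (ε⁻¹ • y + 0) • F y with hf
      have hfc : ContDiff ℝ 2 f := ContDiff.smul (hc.comp (by fun_prop)) hF
      have hnε : ∀ x : E3, ‖ε⁻¹ • x + 0‖ = ‖x‖ / ε := by
        intro x
        rw [add_zero, norm_smul, norm_inv, Real.norm_eq_abs, abs_of_pos hε]; field_simp
      have hf0 : ∀ x, ‖x‖ < ε → f x = 0 := by
        intro x hx
        simp only [hf]
        rw [cut0_zero (by rw [hnε, div_le_one hε]; exact hx.le), zero_smul]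
      have hfs : ∀ x, 1 < ‖x‖ → f x = 0 := by
        intro x hx; simp [hf, hsupp x hx]
      have hfF : ∀ x, 2 * ε ≤ ‖x‖ → f =ᶠ[nhds x] F := by
        intro x hx
        have : (3/2) * ε < ‖x‖ := by linarith
        filter_upwards [(isOpen_lt continuous_const continuous_norm).mem_nhds this] with y hy
        have hy' : (3/2) * ε < ‖y‖ := hy
        simp only [hf]
        rw [cut0_one, one_smul]
        rw [hnε]
        have : 3/2 ≤ ‖y‖ / ε := by rw [le_div_iff₀ hε]; linarith
        nlinarith
      have hlf0 : ∀ x, ‖x‖ < ε → lap f x = 0 := by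
        intro x hx
        rw [lap_congr (v := fun _ => 0), lap_zero]
        filter_upwards [(isOpen_lt continuous_norm continuous_const).mem_nhds hx] with y hy using hf0 y hy
      have carl := polar_carleman hfc hε hf0 hfs hn
      have hW0 : ∀ x, 0 ≤ Wt n x := fun x => by unfold Wt; positivity
      have hWup : ∀ x : E3, ∀ a : ℝ, 0 < a → a ≤ ‖x‖ → ‖x‖ ≤ 1 →
          Wt n x ≤ ((a ^ n)⁻¹) ^ 2 * Real.exp (n / 2) := by
        intro x a ha hax hx1
        unfold Wt
        have e1 : ((a ^ n)⁻¹) ^ 2 = ((a ^ 2) ^ n)⁻¹ := by rw [inv_pow, ← pow_mul, ← pow_mul, mul_comm]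
        rw [e1]
        have : ‖x‖ ^ 2 ≤ 1 := by nlinarith [norm_nonneg x]
        have hle : (2 * (n:ℝ) - 1) * ‖x‖ ^ 2 / 4 ≤ n / 2 := by nlinarith
        have hle2 := Real.exp_le_exp.2 hle
        gcongr
      have hint : Integrable (fun x => ‖x‖ ^ 2 * (Wt n x * ‖f x‖) ^ 2) := by
        refine Continuous.integrable_of_hasCompactSupport ?_
          (HasCompactSupport.intro (isCompact_closedBall (0:E3) 1) ?_)
        · rw [continuous_iff_continuousAt]
          intro x
          by_cases hx : x = 0
          · refine (continuousAt_const (y := (0:ℝ))).congr (Filter.EventuallyEq.symm ?_)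
            rw [hx]
            filter_upwards [Metric.ball_mem_nhds (0:E3) hε] with y hy
            rw [hf0 y (by simpa using hy)]; simp
          · have h1 := (Wt_contDiffAt n hx).continuousAt
            have h2 : Continuous f := hfc.continuous
            exact (by fun_prop : ContinuousAt (fun x : E3 => ‖x‖ ^ 2) x).mul
              ((h1.mul h2.norm.continuousAt).pow 2)
        · intro x hx
          rw [hfs x (by simpa using hx)]; simp
      set I := ∫ x, ‖x‖ ^ 2 * (Wt n x * ‖f x‖) ^ 2 with hI
      have hI0 : 0 ≤ I := integral_nonneg fun x => by positivity
      have upper : ∫ x : E3, (‖x‖ ^ 2 * (Wt n x * ‖lap f x‖)) ^ 2 ≤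
          C ^ 2 * I + vol * (A ^ 2 * ε ^ 2 + M ^ 2 * (((ρ ^ n)⁻¹) ^ 4 * Real.exp n)) := by
        have e2 : C ^ 2 * I + vol * (A ^ 2 * ε ^ 2 + M ^ 2 * (((ρ ^ n)⁻¹) ^ 4 * Real.exp n)) =
          ∫ x, (C ^ 2 * (‖x‖ ^ 2 * (Wt n x * ‖f x‖) ^ 2) +
            (closedBall (0:E3) 1).indicator
              (fun _ => A ^ 2 * ε ^ 2 + M ^ 2 * (((ρ ^ n)⁻¹) ^ 4 * Real.exp n)) x) := by
          rw [integral_add (hint.const_mul _) ((integrable_indicator_iff measurableSet_closedBall).2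
            (integrableOn_const (by exact (isCompact_closedBall (0:E3) 1).measure_lt_top.ne))),
            integral_const_mul, integral_indicator measurableSet_closedBall, setIntegral_const, ← hI]
          simp [hvol, Measure.real]
        rw [e2]
        refine integral_mono_of_nonneg (Filter.Eventually.of_forall fun x => by positivity)
          ((hint.const_mul _).add ((integrable_indicator_iff measurableSet_closedBall).2
            (integrableOn_const (by exact (isCompact_closedBall (0:E3) 1).measure_lt_top.ne))))
          (Filter.Eventually.of_forall fun x => ?_)
        beta_reduce
        by_cases hx1 : ‖x‖ ≤ 1
        · rw [Set.indicator_of_mem (by simpa using hx1)]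
          have hs1 : ‖x‖ ^ 2 ≤ 1 := by nlinarith [norm_nonneg x]
          have p1 : 0 ≤ C ^ 2 * (‖x‖ ^ 2 * (Wt n x * ‖f x‖) ^ 2) := by positivity
          have p2 : 0 ≤ A ^ 2 * ε ^ 2 := by positivity
          have p3 : 0 ≤ M ^ 2 * (((ρ ^ n)⁻¹) ^ 4 * Real.exp n) := by positivity
          rcases lt_or_ge ‖x‖ ε with h1 | h1
          · rw [hlf0 x h1]; simp
            simp at p1 p2 p3
            linarith
          rcases lt_or_ge ‖x‖ (2 * ε) with h2 | h2
          · obtain ⟨k1, k2⟩ := hcr x (by linarith)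
            have hbd : ‖lap f x‖ ≤ (C + 7 * B) * (|c| * (2 * ε) ^ (2 * n + 3)) * (ε ^ 2)⁻¹ := by
              have hm : c * ‖x‖ ^ (2 * n + 3) ≤ |c| * (2 * ε) ^ (2 * n + 3) := by
                have : c ≤ |c| := le_abs_self c
                gcongr
              refine flat_cut hF hB hε hε1 h2.le (k1.trans hm) (fun i => (k2 i).trans hm) ?_ hC0
              refine (hC x (by linarith)).trans ?_
              gcongr
              exact k1.trans hm
            have hWb := hWup x ε hε h1 hx1
            have hfin : ‖x‖ ^ 2 * (Wt n x * ‖lap f x‖) ≤ A * ε := by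
              calc ‖x‖ ^ 2 * (Wt n x * ‖lap f x‖) ≤ 1 * ((((ε ^ n)⁻¹) ^ 2 * Real.exp (n / 2)) *
                    ((C + 7 * B) * (|c| * (2 * ε) ^ (2 * n + 3)) * (ε ^ 2)⁻¹)) := by
                    have := hW0 x
                    gcongr
                _ = (Real.exp (n / 2) * ((C + 7 * B) * (|c| * 2 ^ (2 * n + 3)))) * ε := by
                    rw [mul_pow]
                    have : ε ^ (2 * n + 3) = (ε ^ n) ^ 2 * ε ^ 2 * ε := by ring
                    rw [this]
                    field_simp
                _ ≤ A * ε := by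
                    rw [hA]; gcongr
                    linarith
            have : (‖x‖ ^ 2 * (Wt n x * ‖lap f x‖)) ^ 2 ≤ (A * ε) ^ 2 := by
              have := hW0 x
              gcongr
            rw [mul_pow] at this
            linarith
          have hlF : lap f x = lap F x := lap_congr (hfF x h2)
          have hfx : f x = F x := (hfF x h2).eq_of_nhds
          rcases lt_or_ge ‖x‖ ρ with h3 | h3
          · have : (‖x‖ ^ 2 * (Wt n x * ‖lap f x‖)) ^ 2 ≤ C ^ 2 * (‖x‖ ^ 2 * (Wt n x * ‖f x‖) ^ 2) := by
              have h4 : ‖lap f x‖ ≤ C * ‖f x‖ := by rw [hlF, hfx]; exact hC x h3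
              have h5 : ‖lap f x‖ ^ 2 ≤ (C * ‖f x‖) ^ 2 := by gcongr
              calc (‖x‖ ^ 2 * (Wt n x * ‖lap f x‖)) ^ 2 = (‖x‖ ^ 2) * (‖x‖ ^ 2 * (Wt n x ^ 2 * ‖lap f x‖ ^ 2)) := by ring
                _ ≤ 1 * (‖x‖ ^ 2 * (Wt n x ^ 2 * (C * ‖f x‖) ^ 2)) := by gcongr
                _ = _ := by ring
            linarith
          · have hWb := hWup x ρ hρ h3 hx1
            have : ‖x‖ ^ 2 * (Wt n x * ‖lap f x‖) ≤ 1 * ((((ρ ^ n)⁻¹) ^ 2 * Real.exp (n / 2)) * M) := by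
              rw [hlF]
              have := hW0 x
              have := hM x
              gcongr
            have h6 : (‖x‖ ^ 2 * (Wt n x * ‖lap f x‖)) ^ 2 ≤ (1 * ((((ρ ^ n)⁻¹) ^ 2 * Real.exp (n / 2)) * M)) ^ 2 := by
              have := hW0 x
              gcongr
            have h7 : (1 * ((((ρ ^ n)⁻¹) ^ 2 * Real.exp (n / 2)) * M)) ^ 2 = M ^ 2 * (((ρ ^ n)⁻¹) ^ 4 * Real.exp n) := by
              have : Real.exp n = Real.exp (n / 2) ^ 2 := by
                rw [← Real.exp_nat_mul]; congr 1; push_cast; ring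
              rw [this]; ring
            linarith
        · have hx1' := not_le.1 hx1
          have : lap f x = 0 := by
            rw [lap_congr (hfF x (by linarith)), hlF0 x hx1']
          rw [this, Set.indicator_of_notMem (by simpa using hx1)]
          simp
          positivity
      have lower : (((ρ/2) ^ n)⁻¹) ^ 4 * ∫ x, ({x : E3 | ε0 < ‖x‖ ∧ ‖x‖ < ρ / 2}.indicator (fun x => ‖x‖ ^ 2 * ‖F x‖ ^ 2)) x ≤ I := by
        rw [← integral_const_mul]
        refine integral_mono_of_nonneg (Filter.Eventually.of_forall fun x => ?_) hint
          (Filter.Eventually.of_forall fun x => ?_)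
        · have : 0 ≤ ({x : E3 | ε0 < ‖x‖ ∧ ‖x‖ < ρ / 2}.indicator (fun x => ‖x‖ ^ 2 * ‖F x‖ ^ 2)) x :=
            Set.indicator_nonneg (fun x _ => by positivity) x
          change 0 ≤ (((ρ/2) ^ n)⁻¹) ^ 4 * _
          positivity
        · by_cases hx : x ∈ {x : E3 | ε0 < ‖x‖ ∧ ‖x‖ < ρ / 2}
          · simp only [Set.indicator_of_mem hx]
            obtain ⟨x1, x2⟩ := hx
            have hfx : f x = F x := (hfF x (by linarith)).eq_of_nhds
            rw [hfx]
            have hxp : 0 < ‖x‖ := by linarith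
            have hWl : (((ρ/2) ^ n)⁻¹) ^ 2 ≤ Wt n x := by
              unfold Wt
              have e1 : (((ρ/2) ^ n)⁻¹) ^ 2 = (((ρ/2) ^ 2) ^ n)⁻¹ * 1 := by
                rw [inv_pow, ← pow_mul, ← pow_mul, mul_comm n 2, mul_one]
              rw [e1]
              gcongr
              apply Real.one_le_exp
              have : (0:ℝ) ≤ 2 * n - 1 := by linarith
              positivity
            have h5 : ((((ρ/2) ^ n)⁻¹) ^ 2) ^ 2 ≤ Wt n x ^ 2 := by gcongr
            calc (((ρ/2) ^ n)⁻¹) ^ 4 * (‖x‖ ^ 2 * ‖F x‖ ^ 2) =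
              ((((ρ/2) ^ n)⁻¹) ^ 2) ^ 2 * (‖x‖ ^ 2 * ‖F x‖ ^ 2) := by ring
              _ ≤ Wt n x ^ 2 * (‖x‖ ^ 2 * ‖F x‖ ^ 2) := by gcongr
              _ = _ := by ring
          · simp only [Set.indicator_of_notMem hx, mul_zero]
            positivity
      have hcub : C ^ 2 + 1 ≤ (2 * n - 1 : ℝ) ^ 3 := by
        have h1 : (n : ℝ) ≤ 2 * n - 1 := by linarith
        have h2 : (2 * n - 1 : ℝ) ^ 1 ≤ (2 * n - 1 : ℝ) ^ 3 := pow_le_pow_right₀ (by linarith) (by norm_num)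
        linarith
      have hfin : I ≤ vol * (A ^ 2 * ε ^ 2 + M ^ 2 * (((ρ ^ n)⁻¹) ^ 4 * Real.exp n)) := by
        have := carl.trans upper
        nlinarith
      have h9 := lower.trans hfin
      rw [inv_pow, inv_mul_le_iff₀ (by positivity)] at h9
      exact h9
    have hlim : Filter.Tendsto (fun ε : ℝ => ((ρ/2) ^ n) ^ 4 * (vol * (A ^ 2 * ε ^ 2 + M ^ 2 * (((ρ ^ n)⁻¹) ^ 4 * Real.exp n))))
        (nhdsWithin 0 (Set.Ioi 0)) (nhds (((ρ/2) ^ n) ^ 4 * (vol * (A ^ 2 * 0 ^ 2 + M ^ 2 * (((ρ ^ n)⁻¹) ^ 4 * Real.exp n))))) := by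
      apply Filter.Tendsto.mono_left _ nhdsWithin_le_nhds
      apply Continuous.tendsto (by fun_prop)
    have := ge_of_tendsto hlim (b := ∫ x, ({x : E3 | ε0 < ‖x‖ ∧ ‖x‖ < ρ / 2}.indicator (fun x => ‖x‖ ^ 2 * ‖F x‖ ^ 2)) x) (by
      have hmin : 0 < min (r/2) (min (ρ/2) (ε0/2)) := by positivity
      filter_upwards [Ioo_mem_nhdsGT hmin] with ε hε
      have h1 := hε.2
      rw [lt_min_iff, lt_min_iff] at h1
      exact est ε hε.1 (by linarith) (by linarith) (by linarith))
    simpa using this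
  -- conclusion
  have zero : ∀ ε0 > 0, ∫ x, ({x : E3 | ε0 < ‖x‖ ∧ ‖x‖ < ρ / 2}.indicator (fun x => ‖x‖ ^ 2 * ‖F x‖ ^ 2)) x ≤ 0 := by
    intro ε0 hε0
    have e : ∀ n : ℕ, ((ρ/2) ^ n) ^ 4 * (vol * (M ^ 2 * (((ρ ^ n)⁻¹) ^ 4 * Real.exp n))) =
        (vol * M ^ 2) * (Real.exp 1 / 16) ^ n := by
      intro n
      rw [div_pow ρ, div_pow, div_pow (Real.exp 1), ← Real.exp_nat_mul, mul_one]
      have : ((2:ℝ) ^ n) ^ 4 = 16 ^ n := by rw [← pow_mul, mul_comm, pow_mul]; norm_num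
      field_simp
      rw [← this]
      ring
    have hlim : Filter.Tendsto (fun n : ℕ => (vol * M ^ 2) * (Real.exp 1 / 16) ^ n) Filter.atTop
        (nhds ((vol * M ^ 2) * 0)) := by
      apply Filter.Tendsto.const_mul
      apply tendsto_pow_atTop_nhds_zero_of_lt_one (by positivity)
      have := Real.exp_one_lt_d9
      linarith
    rw [mul_zero] at hlim
    refine ge_of_tendsto hlim ?_
    filter_upwards [Filter.eventually_ge_atTop 2, Filter.eventually_ge_atTop ⌈C ^ 2 + 1⌉₊] with n h1 h2
    rw [← e n]
    exact main ε0 hε0 n h1 ((Nat.le_ceil _).trans (by exact_mod_cast h2))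
  have hne : ∀ x, x ≠ 0 → ‖x‖ < ρ / 2 → F x = 0 := by
    intro x hx0 hx
    have hxp : 0 < ‖x‖ := norm_pos_iff.2 hx0
    set U : Set E3 := {y : E3 | ‖x‖ / 2 < ‖y‖ ∧ ‖y‖ < ρ / 2} with hU
    have hUo : IsOpen U := (isOpen_lt continuous_const continuous_norm).inter
      (isOpen_lt continuous_norm continuous_const)
    have h1 := zero (‖x‖ / 2) (by positivity)
    rw [integral_indicator hUo.measurableSet] at h1
    have h2 : ∫ y in U, ‖y‖ ^ 2 * ‖F y‖ ^ 2 = 0 :=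
      le_antisymm h1 (integral_nonneg fun y => by positivity)
    have hbU : U ⊆ closedBall 0 1 := by
      intro y hy
      have := hy.2
      simp; linarith
    have hint : IntegrableOn (fun y => ‖y‖ ^ 2 * ‖F y‖ ^ 2) U :=
      ((by fun_prop : Continuous (fun y : E3 => ‖y‖ ^ 2 * ‖F y‖ ^ 2)).continuousOn.integrableOn_compact
        (isCompact_closedBall (0:E3) 1)).mono_set hbU
    rw [integral_eq_zero_iff_of_nonneg (fun y => by positivity) hint] at h2
    have h3 := Measure.eqOn_open_of_ae_eq (μ := (volume : Measure E3)) h2 hUo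
      (by fun_prop : Continuous (fun y : E3 => ‖y‖ ^ 2 * ‖F y‖ ^ 2)).continuousOn continuousOn_const
    have h4 := h3 (show x ∈ U from ⟨by linarith, hx⟩)
    simp [hx0] at h4
    exact h4
  intro x hx
  by_cases hx0 : x = 0
  · obtain ⟨c, r, hr, h⟩ := hflat 1
    have := (h x (by simpa [hx0] using hr)).1
    simpa [hx0] using this
  · exact hne x hx0 hx


/-- Cutoff equal to one on `‖x‖ ≤ δ/2` and zero for `‖x‖ ≥ 3δ/4`. -/
noncomputable def chi (δ : ℝ) (x : E3) : ℝ := 1 - cut0 ((2 / δ) • x + 0)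

theorem chi_contDiff {n : ℕ∞} (δ : ℝ) : ContDiff ℝ n (chi δ) := by
  unfold chi
  exact contDiff_const.sub (cut0_contDiff.comp (by fun_prop))

theorem chi_nonneg (δ : ℝ) (x : E3) : 0 ≤ chi δ x := by
  unfold chi; linarith [cut0_le ((2 / δ) • x + 0)]

theorem chi_le (δ : ℝ) (x : E3) : chi δ x ≤ 1 := by
  unfold chi; linarith [cut0_nonneg ((2 / δ) • x + 0)]

theorem chi_one {δ : ℝ} (hδ : 0 < δ) {x : E3} (h : ‖x‖ ≤ δ / 2) : chi δ x = 1 := by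
  unfold chi
  rw [cut0_zero, sub_zero]
  rw [add_zero, norm_smul, Real.norm_eq_abs, abs_of_pos (by positivity)]
  rw [div_mul_eq_mul_div, div_le_one hδ]; linarith

theorem chi_zero {δ : ℝ} (hδ : 0 < δ) {x : E3} (h : 3 * δ / 4 ≤ ‖x‖) : chi δ x = 0 := by
  unfold chi
  rw [cut0_one, sub_self]
  rw [add_zero, norm_smul, Real.norm_eq_abs, abs_of_pos (by positivity)]
  have : 3 / 2 ≤ 2 / δ * ‖x‖ := by
    rw [div_mul_eq_mul_div, le_div_iff₀ hδ]; linarith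
  nlinarith

theorem chi_smul_contDiff {F : Type*} [NormedAddCommGroup F] [NormedSpace ℝ F] {u : E3 → F} {δ : ℝ} {n : ℕ∞}
    (hδ : 0 < δ) (hu : ∀ x, ‖x‖ < δ → ContDiffAt ℝ n u x) :
    ContDiff ℝ n (fun x => chi δ x • u x) := by
  rw [contDiff_iff_contDiffAt]
  intro x
  by_cases hx : ‖x‖ < δ
  · exact (chi_contDiff δ).contDiffAt.smul (hu x hx)
  · have : (fun x => chi δ x • u x) =ᶠ[nhds x] fun _ => 0 := by
      have : ∀ᶠ y in nhds x, 3 * δ / 4 < ‖y‖ :=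
        continuous_norm.continuousAt.eventually (lt_mem_nhds (by linarith))
      filter_upwards [this] with y hy
      rw [chi_zero hδ hy.le, zero_smul]
    exact contDiffAt_const.congr_of_eventuallyEq this

/-- Vanishing to infinite order. -/
def FlatAt (u : E3 → ℂ) (x0 : E3) : Prop :=
  ∀ K : ℕ, ∃ c : ℝ, ∃ r > 0, ∀ x, ‖x - x0‖ < r → ‖u x‖ ≤ c * ‖x - x0‖ ^ K ∧
      ∀ i, ‖pd i u x‖ ≤ c * ‖x - x0‖ ^ K

theorem flatAt_of_zero {u : E3 → ℂ} {x0 : E3} (h : ∀ᶠ x in nhds x0, u x = 0) : FlatAt u x0 := by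
  intro K
  have h' : u =ᶠ[nhds x0] fun _ => 0 := h
  have h1 : ∀ i, pd i u =ᶠ[nhds x0] fun _ => 0 := by
    intro i
    have := pd_congr' i h'
    rwa [pd_zero] at this
  have h2 : ∀ᶠ x in nhds x0, u x = 0 ∧ ∀ i, pd i u x = 0 :=
    h.and (Filter.eventually_all.2 h1)
  obtain ⟨r, hr, hh⟩ := Metric.eventually_nhds_iff.1 h2
  refine ⟨0, r, hr, fun x hx => ?_⟩
  have := hh (y := x) (by rwa [dist_eq_norm])
  simp [this.1, this.2]

theorem ucp_local {u : E3 → ℂ} {x0 : E3} {d : ℝ} (hd : 0 < d) (hd1 : d ≤ 1)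
    (hu : ∀ x ∈ ball x0 d, ContDiffAt ℝ 2 u x) {C : ℝ} (hC0 : 0 ≤ C)
    (hC : ∀ x ∈ ball x0 d, ‖lap u x‖ ≤ C * ‖u x‖) (hflat : FlatAt u x0) :
    ∀ x ∈ ball x0 (d / 4), u x = 0 := by
  set U : E3 → ℂ := fun y => u ((1:ℝ) • y + x0) with hU
  have hmem : ∀ y : E3, ‖y‖ < d → (1:ℝ) • y + x0 ∈ ball x0 d := by
    intro y hy; simpa [dist_eq_norm] using hy
  have hUc : ∀ y, ‖y‖ < d → ContDiffAt ℝ 2 U y := by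
    intro y hy
    exact (hu _ (hmem y hy)).comp y (by fun_prop)
  set F : E3 → ℂ := fun y => chi d y • U y with hFd
  have hF : ContDiff ℝ 2 F := chi_smul_contDiff (n := 2) hd hUc
  have hloc : ∀ y : E3, ‖y‖ < d / 2 → F =ᶠ[nhds y] U := by
    intro y hy
    have : ∀ᶠ z in nhds y, ‖z‖ < d / 2 :=
        continuous_norm.continuousAt.eventually (gt_mem_nhds hy)
    filter_upwards [this] with z hz
    simp [hFd, chi_one hd hz.le]
  have hlap : ∀ y : E3, ‖y‖ < d / 2 → lap F y = lap u ((1:ℝ) • y + x0) := by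
    intro y hy
    rw [lap_congr (hloc y hy), hU, lap_affine 1 x0 (hu _ (hmem y (by linarith)))]
    simp
  have hpd : ∀ i, ∀ y : E3, ‖y‖ < d / 2 → pd i F y = pd i u ((1:ℝ) • y + x0) := by
    intro i y hy
    rw [pd_congr i (hloc y hy), hU, pd_affine 1 x0 ((hu _ (hmem y (by linarith))).differentiableAt (by simp))]
    simp
  have main := ucp_flat hF (fun x hx => by simp [hFd, chi_zero hd (x := x) (by linarith)])
    (ρ := d / 2) (by linarith) (by linarith) hC0 (fun y hy => by
      rw [hlap y hy, (hloc y hy).eq_of_nhds]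
      exact hC _ (hmem y (by linarith)))
    (by
      intro K
      obtain ⟨c, r, hr, h⟩ := hflat K
      refine ⟨c, min r (d/2), lt_min hr (by linarith), fun y hy => ?_⟩
      have hy1 := lt_of_lt_of_le hy (min_le_left _ _)
      have hy2 := lt_of_lt_of_le hy (min_le_right _ _)
      have := h ((1:ℝ) • y + x0) (by simpa using hy1)
      rw [(hloc y hy2).eq_of_nhds]
      simp only [hpd _ y hy2]
      simpa [hU] using this)
  intro x hx
  have hx' : ‖x - x0‖ < d / 2 / 2 := by
    rw [← dist_eq_norm]; have := mem_ball.1 hx; linarith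
  have := main (x - x0) hx'
  rw [(hloc (x - x0) (by linarith)).eq_of_nhds] at this
  simpa [hU] using this

theorem ucp_ball {u : E3 → ℂ} {R : ℝ} {x0 : E3} (hx0 : x0 ∈ ball (0:E3) R)
    (hu : ∀ x ∈ ball (0:E3) R, ContDiffAt ℝ 2 u x) {C : ℝ} (hC0 : 0 ≤ C)
    (hC : ∀ x ∈ ball (0:E3) R, ‖lap u x‖ ≤ C * ‖u x‖) (hflat : FlatAt u x0) :
    ∀ x ∈ ball (0:E3) R, u x = 0 := by
  have hsub : ∀ x ∈ ball (0:E3) R, ∃ d > 0, d ≤ 1 ∧ ball x d ⊆ ball (0:E3) R := by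
    intro x hx
    obtain ⟨d, hd, h⟩ := Metric.isOpen_iff.1 isOpen_ball x hx
    exact ⟨min d 1, lt_min hd one_pos, min_le_right _ _, (ball_subset_ball (min_le_left _ _)).trans h⟩
  set Z : Set E3 := {x | ∀ᶠ y in nhds x, u y = 0} with hZ
  have hZo : IsOpen Z := isOpen_iff_mem_nhds.2 fun x hx => eventually_eventually_nhds.2 hx
  have key : ball (0:E3) R ⊆ Z := by
    refine (convex_ball (0:E3) R).isPreconnected.subset_of_closure_inter_subset hZo ?_ ?_
    · refine ⟨x0, hx0, ?_⟩
      obtain ⟨d, hd, hd1, hs⟩ := hsub x0 hx0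
      have := ucp_local hd hd1 (fun x hx => hu x (hs hx)) hC0 (fun x hx => hC x (hs hx)) hflat
      exact Filter.mem_of_superset (ball_mem_nhds x0 (by linarith)) this
    · rintro x ⟨hxc, hx⟩
      obtain ⟨d, hd, hd1, hs⟩ := hsub x hx
      obtain ⟨y, hyZ, hy⟩ := Metric.mem_closure_iff.1 hxc (d/16) (by linarith)
      have hs2 : ball y (d/2) ⊆ ball (0:E3) R := by
        refine Subset.trans (ball_subset_ball' ?_) hs
        rw [dist_comm]; linarith
      have := ucp_local (x0 := y) (d := d/2) (by linarith) (by linarith) (fun x hx => hu x (hs2 hx)) hC0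
        (fun x hx => hC x (hs2 hx)) (flatAt_of_zero hyZ)
      exact Filter.mem_of_superset (isOpen_ball.mem_nhds (mem_ball.2 (by linarith))) this
  exact fun x hx => (key hx).self_of_nhds


theorem ibpC {F : Type*} [NormedAddCommGroup F] [NormedSpace ℝ F] {V : E3 → F} (i : Fin 3)
    (hV : ContDiff ℝ 1 V) (hcs : HasCompactSupport V) :
    Integrable (pd i V) ∧ ∫ x, pd i V x = 0 := by
  have hdiff : Differentiable ℝ V := hV.differentiable (by simp)
  have hcont : Continuous (pd i V) := by
    unfold pd
    exact (hV.continuous_fderiv (by simp)).clm_apply continuous_const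
  have hcs2 : HasCompactSupport (pd i V) := hcs.fderiv_apply ℝ (ee i)
  have hint := hcont.integrable_of_hasCompactSupport (μ := volume) hcs2
  refine ⟨hint, ?_⟩
  unfold pd at hint
  have := integral_smul_fderiv_eq_neg_fderiv_smul_of_integrable (𝕜 := ℝ) (μ := (volume : Measure E3))
    (f := fun _ => (1:ℝ)) (g := V) (v := ee i) (by simp) (by simpa using hint)
    (by simpa using hV.continuous.integrable_of_hasCompactSupport hcs)
    (fun x _ => differentiableAt_const _) (fun x _ => hdiff x)
  simpa [pd] using this

/-- Class of radial kernels. -/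
structure Ker (η : ℝ → ℝ) (B : ℝ) : Prop where
  smooth : ContDiff ℝ (⊤ : ℕ∞) η
  zero : ∀ t, 1 ≤ t → η t = 0
  bound : ∀ t, 0 ≤ t → |η t| ≤ B

theorem Ker.anti {η : ℝ → ℝ} {B : ℝ} (h : Ker η B) :
    ∃ H : ℝ → ℝ, Ker H (B / 2) ∧ ∀ t, HasDerivAt H (-(1/2) * η t) t := by
  have hc := h.smooth.continuous
  have hB : 0 ≤ B := (abs_nonneg _).trans (h.bound 0 le_rfl)
  have hd : ∀ t, HasDerivAt (fun t => -(1/2) * ∫ s in (1:ℝ)..t, η s) (-(1/2) * η t) t := by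
    intro t
    exact ((hc.integral_hasStrictDerivAt 1 t).hasDerivAt).const_mul _
  refine ⟨fun t => -(1/2) * ∫ s in (1:ℝ)..t, η s, ⟨?_, ?_, ?_⟩, hd⟩
  · rw [contDiff_infty_iff_deriv]
    refine ⟨fun t => (hd t).differentiableAt, ?_⟩
    rw [show deriv (fun t => -(1/2) * ∫ s in (1:ℝ)..t, η s) = fun t => -(1/2) * η t from
      funext fun t => (hd t).deriv]
    exact contDiff_const.mul h.smooth
  · intro t ht
    have : ∫ s in (1:ℝ)..t, η s = ∫ s in (1:ℝ)..t, (0:ℝ) := by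
      apply intervalIntegral.integral_congr
      intro s hs
      rw [uIcc_of_le ht] at hs
      exact h.zero s hs.1
    simp only [this]; simp
  · intro t ht
    by_cases ht1 : 1 ≤ t
    · have : ∫ s in (1:ℝ)..t, η s = ∫ s in (1:ℝ)..t, (0:ℝ) := by
        apply intervalIntegral.integral_congr
        intro s hs
        rw [uIcc_of_le ht1] at hs
        exact h.zero s hs.1
      simp only [this]; simp; linarith
    · push Not at ht1
      have := intervalIntegral.norm_integral_le_of_norm_le_const (a := 1) (b := t) (f := η) (C := B)
        (fun s hs => by
          rw [uIoc_of_ge ht1.le] at hs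
          exact h.bound s (by linarith [hs.1]))
      rw [Real.norm_eq_abs, abs_sub_comm, abs_of_pos (by linarith : 0 < 1 - t)] at this
      rw [abs_mul, show |-(1/2:ℝ)| = 1/2 by norm_num [abs_of_neg]]
      nlinarith

theorem Ker.cs {η : ℝ → ℝ} {B : ℝ} (h : Ker η B) {F : Type*} [NormedAddCommGroup F] [NormedSpace ℝ F]
   (u : E3 → F) : HasCompactSupport (fun y : E3 => η (‖y‖ ^ 2) • u y) := by
  refine HasCompactSupport.intro (isCompact_closedBall (0:E3) 1) fun y hy => ?_
  have : 1 < ‖y‖ := by simpa using hy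
  rw [h.zero _ (by nlinarith), zero_smul]

theorem Ker.contDiff {η : ℝ → ℝ} {B : ℝ} (h : Ker η B) : ContDiff ℝ (⊤ : ℕ∞) (fun y : E3 => η (‖y‖ ^ 2)) :=
  h.smooth.comp (contDiff_norm_sq ℝ)

theorem ker_deriv {u : E3 → ℂ} (hu : ContDiff ℝ 2 u) {η : ℝ → ℝ} {B : ℝ} (h : Ker η B) (s : ℝ) :
    HasDerivAt (fun r : ℝ => ∫ y : E3, η (‖y‖ ^ 2) • u (r • y))
      (∫ y : E3, η (‖y‖ ^ 2) • fderiv ℝ u (s • y) y) s := by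
  have hc : Continuous (fun p : ℝ × E3 => fderiv ℝ u (p.1 • p.2) p.2) := by
    have : Continuous (fderiv ℝ u) := hu.continuous_fderiv (by simp)
    exact (this.comp (by fun_prop)).clm_apply continuous_snd
  obtain ⟨M, hM⟩ := ((isCompact_closedBall s 1).prod (isCompact_closedBall (0:E3) 1)).exists_bound_of_continuousOn
    hc.continuousOn
  have hB : 0 ≤ B := (abs_nonneg _).trans (h.bound 0 le_rfl)
  have hηc := h.contDiff.continuous
  refine (hasDerivAt_integral_of_dominated_loc_of_deriv_le (μ := (volume : Measure E3))
    (F := fun r y => η (‖y‖ ^ 2) • u (r • y)) (F' := fun r y => η (‖y‖ ^ 2) • fderiv ℝ u (r • y) y)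
    (s := closedBall s 1) (bound := (closedBall (0:E3) 1).indicator fun _ => B * M)
    (closedBall_mem_nhds s one_pos) ?_ ?_ ?_ ?_ ?_ ?_).2
  · refine Filter.Eventually.of_forall fun r => Continuous.aestronglyMeasurable ?_
    exact hηc.smul (hu.continuous.comp (by fun_prop))
  · refine Continuous.integrable_of_hasCompactSupport ?_ (h.cs fun y => u (s • y))
    exact hηc.smul (hu.continuous.comp (by fun_prop))
  · refine Continuous.aestronglyMeasurable ?_
    exact hηc.smul (hc.comp (by fun_prop : Continuous fun y : E3 => (s, y)))
  · refine Filter.Eventually.of_forall fun y r hr => ?_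
    by_cases hy : y ∈ closedBall (0:E3) 1
    · rw [indicator_of_mem hy, norm_smul]
      have h2 := hM (r, y) ⟨hr, hy⟩
      exact mul_le_mul (h.bound _ (by positivity)) h2 (norm_nonneg _) hB
    · rw [indicator_of_notMem hy]
      have : 1 < ‖y‖ := by simpa using hy
      rw [h.zero _ (by nlinarith), zero_smul, norm_zero]
  · rw [integrable_indicator_iff measurableSet_closedBall]
    exact integrableOn_const (by exact (isCompact_closedBall (0:E3) 1).measure_lt_top.ne)
  · refine Filter.Eventually.of_forall fun y r hr => ?_
    have h1 : HasDerivAt (fun r : ℝ => r • y) y r := by simpa using (hasDerivAt_id r).smul_const y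
    have h2 := ((hu.differentiable (by simp)) (r • y)).hasFDerivAt.comp_hasDerivAt r h1
    exact h2.const_smul (η (‖y‖ ^ 2))

theorem fderiv_eq_sum {F : Type*} [NormedAddCommGroup F] [NormedSpace ℝ F] (u : E3 → F) (x y : E3) :
    fderiv ℝ u x y = ∑ i, y i • pd i u x := by
  conv_lhs => rw [x_decomp y]
  simp [pd]

theorem ker_ibp {u : E3 → ℂ} (hu : ContDiff ℝ 2 u) {η H : ℝ → ℝ} {B B' : ℝ} (h : Ker η B)
    (h' : Ker H B') (hH : ∀ t, HasDerivAt H (-(1/2) * η t) t) (s : ℝ) :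
    ∫ y : E3, η (‖y‖ ^ 2) • fderiv ℝ u (s • y) y = s • ∫ y : E3, H (‖y‖ ^ 2) • lap u (s • y) := by
  set V : Fin 3 → E3 → ℂ := fun i y => H (‖y‖ ^ 2) • pd i u (s • y + 0) with hV
  have hpu : ∀ i, ContDiff ℝ 1 (pd i u) := fun i => contDiff_pd' hu (by norm_num)
  have hVc : ∀ i, ContDiff ℝ 1 (V i) := fun i =>
    (h'.contDiff.of_le (by exact_mod_cast le_top)).smul ((hpu i).comp (by fun_prop))
  have key : ∀ i y, pd i (V i) y = s • (H (‖y‖ ^ 2) • pd i (pd i u) (s • y)) -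
      η (‖y‖ ^ 2) • (y i • pd i u (s • y)) := by
    intro i y
    have hcc : ContDiff ℝ 1 (fun y => pd i u (s • y + 0)) := (hpu i).comp (by fun_prop)
    change pd i (fun y => H (‖y‖ ^ 2) • pd i u (s • y + 0)) y = _
    rw [pd_smul (h'.contDiff.differentiable (by simp) y) (hcc.differentiable (by simp) y),
      pd_affine s 0 ((hpu i).differentiable (by simp) _), pd_radial (hH _)]
    simp only [add_zero, Complex.real_smul]
    push_cast
    ring
  have I := fun i => ibpC i (hVc i) (h'.cs fun y => pd i u (s • y + 0))
  have e : ∀ y, η (‖y‖ ^ 2) • fderiv ℝ u (s • y) y =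
      s • (H (‖y‖ ^ 2) • lap u (s • y)) - ∑ i, pd i (V i) y := by
    intro y
    simp only [key]
    rw [fderiv_eq_sum, lap, Finset.smul_sum, Finset.smul_sum, Finset.smul_sum, ← Finset.sum_sub_distrib]
    refine Finset.sum_congr rfl fun i _ => ?_
    abel
  simp only [e]
  rw [integral_sub, integral_finsetSum _ (fun i _ => (I i).1), Finset.sum_eq_zero (fun i _ => (I i).2), sub_zero,
    integral_smul]
  · refine Integrable.smul s ?_
    refine Continuous.integrable_of_hasCompactSupport ?_ (h'.cs fun y => lap u (s • y))
    exact h'.contDiff.continuous.smul ((continuous_lap hu).comp (by fun_prop))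
  · exact integrable_finsetSum _ fun i _ => (I i).1


theorem hel_bound {u : E3 → ℂ} (hu : ContDiff ℝ 2 u) {k r0 : ℝ} (hk : k ^ 2 * r0 ^ 2 ≤ 1)
    (hlap : ∀ y, ‖y‖ < r0 → lap u y = -(k ^ 2) • u y) (h0 : u 0 = 0) {M : ℝ}
    (hM : ∀ y, ‖y‖ ≤ r0 → ‖u y‖ ≤ M) (n : ℕ) : ∀ (η : ℝ → ℝ) (B : ℝ), Ker η B → ∀ r, 0 ≤ r → r < r0 →
      ‖∫ y : E3, η (‖y‖ ^ 2) • u (r • y)‖ ≤ (1/2) ^ n * (B * M * volume.real (closedBall (0:E3) 1)) := by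
  have hA : ∀ r, 0 ≤ r → r < r0 → ∀ y : E3, y ∈ closedBall (0:E3) 1 → ‖r • y‖ < r0 := by
    intro r hr hr0 y hy
    rw [norm_smul, Real.norm_eq_abs, abs_of_nonneg hr]
    have : ‖y‖ ≤ 1 := by simpa using hy
    nlinarith [norm_nonneg y]
  have hout : ∀ η B, Ker η B → ∀ y : E3, y ∉ closedBall (0:E3) 1 → η (‖y‖ ^ 2) = 0 := by
    intro η B h y hy
    have : 1 < ‖y‖ := by simpa using hy
    exact h.zero _ (by nlinarith)
  have hvol : 0 ≤ volume.real (closedBall (0:E3) 1) := by positivity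
  induction n with
  | zero =>
    intro η B h r hr hrr
    have hB : 0 ≤ B := (abs_nonneg _).trans (h.bound 0 le_rfl)
    rw [← setIntegral_eq_integral_of_forall_compl_eq_zero (s := closedBall (0:E3) 1)]
    · rw [pow_zero, one_mul]
      refine norm_setIntegral_le_of_norm_le_const (isCompact_closedBall (0:E3) 1).measure_lt_top ?_
      intro y hy
      rw [norm_smul]
      exact mul_le_mul (h.bound _ (by positivity)) (hM _ (hA r hr hrr y hy).le) (norm_nonneg _) hB
    · intro y hy
      rw [hout η B h y hy, zero_smul]
  | succ n ih =>
    intro η B h r hr hrr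
    obtain ⟨H, hH, hd⟩ := h.anti
    have hB : 0 ≤ B := (abs_nonneg _).trans (h.bound 0 le_rfl)
    have hM0 : 0 ≤ M := (norm_nonneg _).trans (hM 0 (by simp; linarith))
    have key : ∀ s ∈ Icc 0 r, HasDerivWithinAt (fun r : ℝ => ∫ y : E3, η (‖y‖ ^ 2) • u (r • y))
        (-(s * k ^ 2) • ∫ y : E3, H (‖y‖ ^ 2) • u (s • y)) (Icc 0 r) s := by
      intro s hs
      have h1 := ker_deriv hu h s
      rw [ker_ibp hu h hH hd] at h1
      have : ∫ y : E3, H (‖y‖ ^ 2) • lap u (s • y) = -(k ^ 2) • ∫ y : E3, H (‖y‖ ^ 2) • u (s • y) := by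
        rw [← integral_smul]
        refine integral_congr_ae (Filter.Eventually.of_forall fun y => ?_)
        beta_reduce
        by_cases hy : y ∈ closedBall (0:E3) 1
        · rw [hlap _ (hA s hs.1 (by linarith [hs.2]) y hy), smul_comm]
        · rw [hout H _ hH y hy]; simp
      rw [this, smul_smul, mul_neg] at h1
      exact h1.hasDerivWithinAt
    set W := B * M * volume.real (closedBall (0:E3) 1) with hW
    have hW0 : 0 ≤ W := by positivity
    have hb : ∀ s ∈ Icc 0 r, ‖-(s * k ^ 2) • ∫ y : E3, H (‖y‖ ^ 2) • u (s • y)‖ ≤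
        r0 * k ^ 2 * ((1/2) ^ (n+1) * W) := by
      intro s hs
      rw [norm_smul, norm_neg, Real.norm_eq_abs, abs_of_nonneg (mul_nonneg hs.1 (sq_nonneg k))]
      refine mul_le_mul (mul_le_mul_of_nonneg_right (by linarith [hs.2]) (sq_nonneg k)) ?_ (norm_nonneg _)
        (mul_nonneg (by linarith) (sq_nonneg k))
      refine (ih H (B/2) hH s hs.1 (by linarith [hs.2])).trans (le_of_eq ?_)
      rw [hW]; ring
    have := (convex_Icc 0 r).norm_image_sub_le_of_norm_hasDerivWithin_le key hb
      (left_mem_Icc.2 hr) (right_mem_Icc.2 hr)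
    simp only [zero_smul, h0, smul_zero, integral_zero, sub_zero] at this
    refine this.trans ?_
    rw [Real.norm_eq_abs, abs_of_nonneg hr]
    have hp : 0 ≤ (1/2:ℝ) ^ (n+1) * W := by positivity
    have : r0 * k ^ 2 * r ≤ 1 := by
      have : r0 * k ^ 2 * r ≤ r0 * k ^ 2 * r0 :=
        mul_le_mul_of_nonneg_left hrr.le (mul_nonneg (by linarith) (sq_nonneg k))
      nlinarith
    nlinarith

theorem hel_zero {u : E3 → ℂ} (hu : ContDiff ℝ 2 u) {k r0 : ℝ} (hk : k ^ 2 * r0 ^ 2 ≤ 1)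
    (hlap : ∀ y, ‖y‖ < r0 → lap u y = -(k ^ 2) • u y) (h0 : u 0 = 0) {η : ℝ → ℝ} {B : ℝ} (h : Ker η B)
    {r : ℝ} (hr : 0 ≤ r) (hr0 : r < r0) :
      ∫ y : E3, η (‖y‖ ^ 2) • u (r • y) = 0 := by
  obtain ⟨M, hM⟩ := (isCompact_closedBall (0:E3) r0).exists_bound_of_continuousOn hu.continuous.continuousOn
  have key := fun n => hel_bound hu hk hlap h0 (M := M) (fun y hy => hM y (by simpa using hy)) n η B h r hr hr0
  have hl : Filter.Tendsto (fun n : ℕ => (1/2:ℝ) ^ n * (B * M * volume.real (closedBall (0:E3) 1))) Filter.atTop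
      (nhds (0 * (B * M * volume.real (closedBall (0:E3) 1)))) :=
    (tendsto_pow_atTop_nhds_zero_of_lt_one (by norm_num) (by norm_num)).mul_const _
  rw [zero_mul] at hl
  have := ge_of_tendsto' hl key
  simpa using this


theorem pd_coordfun {f : ℝ → ℝ} {f' : ℝ} {x : E3} (j : Fin 3) (h : HasDerivAt f f' (x j)) (i : Fin 3) :
    pd i (fun y : E3 => f (y j)) x = f' * (if j = i then 1 else 0) := by
  have h1 : HasFDerivAt (fun y : E3 => y j) (EuclideanSpace.proj j : E3 →L[ℝ] ℝ) x :=
    (EuclideanSpace.proj j : E3 →L[ℝ] ℝ).hasFDerivAt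
  have := pd_eq (u := fun y : E3 => f (y j)) (h.comp_hasFDerivAt x h1) i
  rw [this]
  simp [ee_apply]

theorem lap_cos (k : ℝ) (x : E3) : lap (fun y : E3 => Real.cos (k * y 0)) x = -(k ^ 2) * Real.cos (k * x 0) := by
  have h1 : ∀ t : ℝ, HasDerivAt (fun t => Real.cos (k * t)) (-Real.sin (k * t) * k) t := by
    intro t
    have := HasDerivAt.cos ((hasDerivAt_id t).const_mul k)
    simpa using this
  have h2 : ∀ t : ℝ, ∀ c : ℝ, HasDerivAt (fun t => -Real.sin (k * t) * k * c) (-(Real.cos (k * t) * k) * k * c) t := by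
    intro t c
    have := (((HasDerivAt.sin ((hasDerivAt_id t).const_mul k)).fun_neg).mul_const k).mul_const c
    simpa using this
  unfold lap
  have : ∀ i, pd i (pd i (fun y : E3 => Real.cos (k * y 0))) x =
      -(Real.cos (k * x 0) * k) * k * (if (0:Fin 3) = i then 1 else 0) * (if (0:Fin 3) = i then 1 else 0) := by
    intro i
    rw [show pd i (fun y : E3 => Real.cos (k * y 0)) = fun y : E3 => -Real.sin (k * y 0) * k * (if (0:Fin 3) = i then 1 else 0)
      from funext fun y => pd_coordfun (f := fun t => Real.cos (k * t)) 0 (h1 _) i]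
    rw [pd_coordfun (f := fun t => -Real.sin (k * t) * k * (if (0:Fin 3) = i then 1 else 0)) 0 (h2 _ _) i]
  rw [Finset.sum_congr rfl fun i _ => this i, Fin.sum_univ_three]
  simp
  ring

theorem ker_std : Ker (fun t => Real.smoothTransition (1 - t)) 1 where
  smooth := Real.smoothTransition.contDiff.comp (by fun_prop)
  zero := fun t ht => Real.smoothTransition.zero_of_nonpos (by linarith)
  bound := fun t _ => by
    rw [abs_of_nonneg (Real.smoothTransition.nonneg _)]
    exact Real.smoothTransition.le_one _

theorem hel_smooth0 {V : E3 → ℂ} (hV : ContDiff ℝ 2 V) {k d : ℝ} (hd : 0 < d)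
    (hlap : ∀ y, ‖y‖ < d → lap V y = -(k ^ 2) • V y) : ContDiffAt ℝ (⊤ : ℕ∞) V 0 := by
  set r0 : ℝ := min (d / 2) (1 / (|k| + 1)) with hr0
  have hkp : 0 < |k| + 1 := by positivity
  have hr0p : 0 < r0 := lt_min (by linarith) (by positivity)
  have hkr : |k| * r0 ≤ 1 := by
    calc |k| * r0 ≤ |k| * (1 / (|k| + 1)) := by gcongr; exact min_le_right _ _
      _ ≤ 1 := by rw [mul_one_div, div_le_one hkp]; linarith
  have hk2 : k ^ 2 * r0 ^ 2 ≤ 1 := by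
    rw [← sq_abs k, ← mul_pow]
    exact pow_le_one₀ (by positivity) hkr
  set r : ℝ := r0 / 2 with hr
  have hrp : 0 < r := by positivity
  set η : ℝ → ℝ := fun t => Real.smoothTransition (1 - t) with hη
  have hK : Ker η 1 := ker_std
  have hηc := hK.contDiff.continuous
  set c : ℝ := ∫ y : E3, η (‖y‖ ^ 2) * Real.cos (k * (r • y) 0) with hc
  have hcc : Continuous (fun y : E3 => η (‖y‖ ^ 2) * Real.cos (k * (r • y) 0)) :=
    hηc.mul (by fun_prop)
  have hccs : HasCompactSupport (fun y : E3 => η (‖y‖ ^ 2) * Real.cos (k * (r • y) 0)) :=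
    hK.cs fun y => Real.cos (k * (r • y) 0)
  have hcpos : 0 < c := by
    refine Continuous.integral_pos_of_hasCompactSupport_nonneg_nonzero (x := 0) hcc hccs ?_ ?_
    · intro y
      by_cases hy : ‖y‖ ≤ 1
      · refine mul_nonneg (Real.smoothTransition.nonneg _) ?_
        apply (Real.cos_pos_of_le_one _).le
        have h1 : |(r • y) 0| ≤ ‖r • y‖ := by
          have := PiLp.norm_apply_le (r • y) 0
          simpa using this
        rw [norm_smul, Real.norm_eq_abs, abs_of_pos hrp] at h1
        rw [abs_mul]
        have h2 : |(r • y) 0| ≤ r0 := by nlinarith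
        calc _ ≤ |k| * r0 := by gcongr
          _ ≤ 1 := hkr
      · have : η (‖y‖ ^ 2) = 0 := hK.zero _ (by push Not at hy; nlinarith)
        simp [this]
    · simp [hη, Real.smoothTransition.one_of_one_le]
  have key : ∀ x : E3, ‖x‖ < d / 2 → ∫ y : E3, η (‖y‖ ^ 2) • V (r • y + x) = c • V x := by
    intro x hx
    set u : E3 → ℂ := fun y => V ((1:ℝ) • y + x) - Real.cos (k * y 0) • V x with hu
    have hu1 : ContDiff ℝ 2 (fun y : E3 => V ((1:ℝ) • y + x)) := hV.comp (by fun_prop)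
    have hcos : ContDiff ℝ 2 (fun y : E3 => Real.cos (k * y 0)) :=
      Real.contDiff_cos.comp (contDiff_const.mul (EuclideanSpace.proj (0:Fin 3) : E3 →L[ℝ] ℝ).contDiff)
    have hu2 : ContDiff ℝ 2 (fun y : E3 => Real.cos (k * y 0) • V x) := hcos.smul contDiff_const
    have hus : ContDiff ℝ 2 u := hu1.sub hu2
    have h := hel_zero hus hk2 (r0 := r0) (by
      intro y hy
      have hy2 : ‖y‖ < d / 2 := lt_of_lt_of_le hy (min_le_left _ _)
      rw [hu, lap_sub hu1.contDiffAt hu2.contDiffAt, lap_affine 1 x hV.contDiffAt,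
        show lap (fun y : E3 => Real.cos (k * y 0) • V x) y = _ from
          lap_clm (u := fun y : E3 => Real.cos (k * y 0)) ((ContinuousLinearMap.id ℝ ℝ).smulRight (V x))
            hcos.contDiffAt, lap_cos,
        hlap _ (by
          refine (norm_add_le _ _).trans_lt ?_
          rw [one_smul]; linarith)]
      simp only [ContinuousLinearMap.smulRight_apply, ContinuousLinearMap.id_apply, Complex.real_smul]
      push_cast
      ring) (by simp [hu]) hK hrp.le (by rw [hr]; linarith)
    have e : ∀ y : E3, η (‖y‖ ^ 2) • u (r • y) = η (‖y‖ ^ 2) • V (r • y + x) -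
        (η (‖y‖ ^ 2) * Real.cos (k * (r • y) 0)) • V x := by
      intro y
      simp only [hu, smul_sub, one_smul, smul_smul]
    simp only [e] at h
    rw [integral_sub, integral_smul_const, sub_eq_zero] at h
    · exact h
    · refine Continuous.integrable_of_hasCompactSupport ?_ (hK.cs fun y => V (r • y + x))
      exact hηc.smul (hV.continuous.comp (by fun_prop))
    · exact (hcc.integrable_of_hasCompactSupport hccs).smul_const _
  set g : E3 → ℝ := fun z => η (‖r⁻¹ • z‖ ^ 2) with hg
  have hgs : ContDiff ℝ (⊤ : ℕ∞) g := hK.contDiff.comp (by fun_prop)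
  have hgc : HasCompactSupport g := by
    refine HasCompactSupport.intro (isCompact_closedBall (0:E3) r) fun z hz => ?_
    have hz' : r < ‖z‖ := by simpa using hz
    apply hK.zero
    rw [norm_smul, norm_inv, Real.norm_eq_abs, abs_of_pos hrp]
    have : 1 ≤ r⁻¹ * ‖z‖ := by
      rw [← div_eq_inv_mul, one_le_div hrp]; exact hz'.le
    nlinarith
  have conv := HasCompactSupport.contDiff_convolution_right (μ := (volume : Measure E3)) (f := V)
    (ContinuousLinearMap.lsmul ℝ ℝ : ℝ →L[ℝ] ℂ →L[ℝ] ℂ).flip hgc hV.continuous.locallyIntegrable hgs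
  have key2 : ∀ x : E3, ‖x‖ < d / 2 → V x = (c⁻¹ * |(r ^ 3)⁻¹|) •
      (MeasureTheory.convolution V g (ContinuousLinearMap.lsmul ℝ ℝ : ℝ →L[ℝ] ℂ →L[ℝ] ℂ).flip volume) x := by
    intro x hx
    have h1 := key x hx
    have h2 := Measure.integral_comp_smul (volume : Measure E3) (fun z => g z • V (z + x)) r
    have h3 := integral_add_right_eq_self (μ := (volume : Measure E3)) (fun t => g (t - x) • V t) x
    simp only [add_sub_cancel_right] at h3
    rw [h3, finrank_euclideanSpace_fin] at h2
    have e1 : ∀ y : E3, g (r • y) = η (‖y‖ ^ 2) := by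
      intro y; simp only [hg]; rw [smul_smul, inv_mul_cancel₀ hrp.ne', one_smul]
    simp only [e1] at h2
    rw [h2] at h1
    rw [convolution_def, mul_smul]
    have e2 : ∀ t : E3, (ContinuousLinearMap.lsmul ℝ ℝ : ℝ →L[ℝ] ℂ →L[ℝ] ℂ).flip (V t) (g (x - t)) = g (t - x) • V t := by
      intro t
      have : g (x - t) = g (t - x) := by
        simp only [hg]; rw [← neg_sub t x, smul_neg, norm_neg]
      rw [this]; rfl
    simp only [e2]
    rw [h1, smul_smul, inv_mul_cancel₀ hcpos.ne', one_smul]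
  have hev : V =ᶠ[nhds 0] fun x => (c⁻¹ * |(r ^ 3)⁻¹|) •
      (MeasureTheory.convolution V g (ContinuousLinearMap.lsmul ℝ ℝ : ℝ →L[ℝ] ℂ →L[ℝ] ℂ).flip volume) x := by
    filter_upwards [ball_mem_nhds (0:E3) (half_pos hd)] with x hx
    exact key2 x (by simpa using hx)
  exact (conv.const_smul _).contDiffAt.congr_of_eventuallyEq hev

theorem hel_smooth {v : E3 → ℂ} {k R : ℝ} (hv : ∀ x ∈ ball (0:E3) R, ContDiffAt ℝ 2 v x)
    (hlap : ∀ x ∈ ball (0:E3) R, lap v x = -(k ^ 2) • v x) :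
    ∀ x ∈ ball (0:E3) R, ContDiffAt ℝ (⊤ : ℕ∞) v x := by
  intro x0 hx0
  obtain ⟨d, hd, hsub⟩ := Metric.isOpen_iff.1 isOpen_ball x0 hx0
  have hmem : ∀ y : E3, ‖y‖ < d → (1:ℝ) • y + x0 ∈ ball (0:E3) R := by
    intro y hy; exact hsub (by simpa [dist_eq_norm] using hy)
  set U : E3 → ℂ := fun y => v ((1:ℝ) • y + x0) with hU
  have hUc : ∀ y, ‖y‖ < d → ContDiffAt ℝ 2 U y := by
    intro y hy
    exact (hv _ (hmem y hy)).comp y (by fun_prop)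
  have hF : ContDiff ℝ 2 (fun y => chi d y • U y) := chi_smul_contDiff (n := 2) hd hUc
  have hloc : ∀ y : E3, ‖y‖ < d / 2 → (fun y => chi d y • U y) =ᶠ[nhds y] U := by
    intro y hy
    have : ∀ᶠ z in nhds y, ‖z‖ < d / 2 :=
        continuous_norm.continuousAt.eventually (gt_mem_nhds hy)
    filter_upwards [this] with z hz
    simp [chi_one hd hz.le]
  have h1 := hel_smooth0 hF (k := k) (half_pos hd) (by
    intro y hy
    rw [lap_congr (hloc y hy), (hloc y hy).eq_of_nhds, hU, lap_affine 1 x0 (hv _ (hmem y (by linarith))),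
      hlap _ (hmem y (by linarith))]
    simp)
  have h2 : ContDiffAt ℝ (⊤ : ℕ∞) U 0 := h1.congr_of_eventuallyEq (hloc 0 (by simpa using half_pos hd)).symm
  have h3 : ContDiffAt ℝ (⊤ : ℕ∞) (fun x => U (x - x0)) x0 := by
    have h2' : ContDiffAt ℝ (⊤ : ℕ∞) U (x0 - x0) := by rwa [sub_self]
    exact ContDiffAt.comp (f := fun x => x - x0) x0 h2' (by fun_prop)
  simpa [hU] using h3


/-- Iterated partial derivatives along a list of indices. -/
noncomputable def DD : List (Fin 3) → (E3 → ℂ) → (E3 → ℂ)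
  | [], v => v
  | i :: l, v => pd i (DD l v)

/-- Smooth on the ball. -/
def Sm (R : ℝ) (v : E3 → ℂ) : Prop := ∀ x ∈ ball (0:E3) R, ContDiffAt ℝ (⊤ : ℕ∞) v x

theorem Sm.pd {R : ℝ} {v : E3 → ℂ} (h : Sm R v) (i : Fin 3) : Sm R (pd i v) := fun x hx =>
  contDiffAt_pd (h x hx) (by norm_cast)

theorem Sm.two {R : ℝ} {v : E3 → ℂ} (h : Sm R v) {x : E3} (hx : x ∈ ball (0:E3) R) : ContDiffAt ℝ 2 v x :=
  (h x hx).of_le (by exact WithTop.coe_le_coe.2 le_top)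

theorem Sm.diff {R : ℝ} {v : E3 → ℂ} (h : Sm R v) {x : E3} (hx : x ∈ ball (0:E3) R) : DifferentiableAt ℝ v x :=
  (h x hx).differentiableAt (by simp)

theorem Sm.DD {R : ℝ} {v : E3 → ℂ} (h : Sm R v) (l : List (Fin 3)) : Sm R (DD l v) := by
  induction l with
  | nil => exact h
  | cons i l ih => exact ih.pd i

theorem eqOn_pd {R : ℝ} {u v : E3 → ℂ} (h : ∀ x ∈ ball (0:E3) R, u x = v x) (i : Fin 3) :
    ∀ x ∈ ball (0:E3) R, pd i u x = pd i v x := fun _ hx =>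
  pd_congr i (Filter.mem_of_superset (isOpen_ball.mem_nhds hx) h)

theorem DD_perm {R : ℝ} {v : E3 → ℂ} (hv : Sm R v) {l l' : List (Fin 3)} (h : l.Perm l') :
    ∀ x ∈ ball (0:E3) R, DD l v x = DD l' v x := by
  induction h with
  | nil => exact fun _ _ => rfl
  | cons i _ ih => exact eqOn_pd ih i
  | swap i j l => exact fun x hx => pd_symm ((hv.DD l).two hx) j i
  | trans _ _ ih1 ih2 => exact fun x hx => (ih1 x hx).trans (ih2 x hx)

theorem DD_append (l l' : List (Fin 3)) (v : E3 → ℂ) : DD (l ++ l') v = DD l (DD l' v) := by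
  induction l with
  | nil => rfl
  | cons i l ih => simp only [List.cons_append, DD, ih]

theorem hel_pd {R k : ℝ} {v : E3 → ℂ} (hv : Sm R v) (h : ∀ x ∈ ball (0:E3) R, lap v x = -(k ^ 2) • v x)
    (j : Fin 3) : ∀ x ∈ ball (0:E3) R, lap (pd j v) x = -(k ^ 2) • pd j v x := by
  intro x hx
  have h1 : ∀ i, pd i (pd i (pd j v)) x = pd j (pd i (pd i v)) x := by
    intro i
    rw [eqOn_pd (fun y hy => pd_symm (hv.two hy) i j) i x hx]
    exact pd_symm ((hv.pd i).two hx) i j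
  have h2 : pd j (lap v) x = ∑ i, pd j (pd i (pd i v)) x := by
    have e : lap v = fun y => (pd 0 (pd 0 v) y + pd 1 (pd 1 v) y) + pd 2 (pd 2 v) y := funext fun y => lap_three v y
    have hd : ∀ i, DifferentiableAt ℝ (pd i (pd i v)) x := fun i => ((hv.pd i).pd i).diff hx
    rw [e, pd_add (u := fun y => pd 0 (pd 0 v) y + pd 1 (pd 1 v) y) ((hd 0).add (hd 1)) (hd 2), pd_add (hd 0) (hd 1), Fin.sum_univ_three]
  have h3 : pd j (lap v) x = pd j (fun y => (-(k ^ 2)) • v y) x :=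
    eqOn_pd h j x hx
  have h4 : pd j (fun y => (-(k ^ 2)) • v y) x = (-(k ^ 2)) • pd j v x :=
    pd_clm ((-(k ^ 2)) • ContinuousLinearMap.id ℝ ℂ) (hv.diff hx) j
  unfold lap
  rw [Finset.sum_congr rfl fun i _ => h1 i, ← h2, h3, h4]

theorem hel_DD {R k : ℝ} {v : E3 → ℂ} (hv : Sm R v) (h : ∀ x ∈ ball (0:E3) R, lap v x = -(k ^ 2) • v x)
    (l : List (Fin 3)) : ∀ x ∈ ball (0:E3) R, lap (DD l v) x = -(k ^ 2) • DD l v x := by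
  induction l with
  | nil => exact h
  | cons i l ih => exact hel_pd (hv.DD l) ih i

theorem norm_fderiv_le_sum (u : E3 → ℂ) (x : E3) {m : ℝ} (h : ∀ i, ‖pd i u x‖ ≤ m) : ‖fderiv ℝ u x‖ ≤ 3 * m := by
  have hm : 0 ≤ m := (norm_nonneg _).trans (h 0)
  refine ContinuousLinearMap.opNorm_le_bound _ (by positivity) fun y => ?_
  rw [fderiv_eq_sum]
  refine (norm_sum_le _ _).trans ?_
  have : ∀ i ∈ Finset.univ, ‖y i • pd i u x‖ ≤ ‖y‖ * m := by
    intro i _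
    rw [norm_smul]
    exact mul_le_mul (PiLp.norm_apply_le y i) (h i) (norm_nonneg _) (norm_nonneg _)
  refine (Finset.sum_le_sum this).trans (le_of_eq ?_)
  simp; ring

theorem growth {R : ℝ} (hR : 0 < R) (N : ℕ) : ∀ v : E3 → ℂ, Sm R v →
    (∀ l : List (Fin 3), l.length < N → DD l v 0 = 0) →
    ∃ C r : ℝ, 0 ≤ C ∧ 0 < r ∧ ∀ x, ‖x‖ < r → ‖v x‖ ≤ C * ‖x‖ ^ N := by
  induction N with
  | zero =>
    intro v hv _
    have hc : ContinuousAt v 0 := (hv.diff (by simpa using hR)).continuousAt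
    have : ∀ᶠ x in nhds (0:E3), ‖v x‖ < ‖v 0‖ + 1 := hc.norm.eventually (gt_mem_nhds (by linarith))
    obtain ⟨r, hr, h⟩ := Metric.eventually_nhds_iff.1 this
    exact ⟨‖v 0‖ + 1, r, by positivity, hr, fun x hx => by simpa using (h (y := x) (by simpa using hx)).le⟩
  | succ N ih =>
    intro v hv hD
    have : ∀ i, ∃ C r : ℝ, 0 ≤ C ∧ 0 < r ∧ ∀ x, ‖x‖ < r → ‖pd i v x‖ ≤ C * ‖x‖ ^ N := by
      intro i
      refine ih (pd i v) (hv.pd i) fun l hl => ?_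
      have := hD (l ++ [i]) (by simpa using hl)
      rwa [DD_append] at this
    choose C r hC hr h using this
    have hm : ∀ f : Fin 3 → ℝ, (∀ i, 0 ≤ f i) → ∀ i, f i ≤ f 0 + f 1 + f 2 := by
      intro f hf i
      have h0 := hf 0; have h1 := hf 1; have h2 := hf 2
      fin_cases i <;> simp <;> linarith
    refine ⟨3 * (C 0 + C 1 + C 2), min (min (r 0) (min (r 1) (r 2))) R, by
      have := hC 0; have := hC 1; have := hC 2; positivity,
      lt_min (lt_min (hr 0) (lt_min (hr 1) (hr 2))) hR, fun x hx => ?_⟩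
    simp only [lt_min_iff] at hx
    obtain ⟨⟨hx0, hx1, hx2⟩, hxR⟩ := hx
    have hxr : ∀ i, ‖x‖ < r i := by intro i; fin_cases i <;> assumption
    have hb : ∀ y ∈ closedBall (0:E3) ‖x‖, ‖fderiv ℝ v y‖ ≤ 3 * ((C 0 + C 1 + C 2) * ‖x‖ ^ N) := by
      intro y hy
      have hy' : ‖y‖ ≤ ‖x‖ := by simpa using hy
      refine norm_fderiv_le_sum v y fun i => (h i y (hy'.trans_lt (hxr i))).trans ?_
      exact mul_le_mul (hm C hC i) (pow_le_pow_left₀ (norm_nonneg _) hy' N) (by positivity)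
        (by have := hC 0; have := hC 1; have := hC 2; positivity)
    have := (convex_closedBall (0:E3) ‖x‖).norm_image_sub_le_of_norm_fderiv_le (𝕜 := ℝ) (f := v) (x := 0) (y := x)
      (fun y hy => hv.diff (by
        have hy' : ‖y‖ ≤ ‖x‖ := by simpa using hy
        simpa using hy'.trans_lt hxR)) hb (by simp) (by simp)
    have h0 : v 0 = 0 := hD [] (by simp)
    rw [h0, sub_zero, sub_zero] at this
    refine this.trans (le_of_eq ?_)
    rw [pow_succ]; ring

theorem flat_of_DD {R : ℝ} (hR : 0 < R) {v : E3 → ℂ} (hv : Sm R v) (hD : ∀ l : List (Fin 3), DD l v 0 = 0) :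
    FlatAt v 0 := by
  intro K
  obtain ⟨C, r, hC, hr, h⟩ := growth hR K v hv fun l _ => hD l
  have : ∀ i, ∃ C r : ℝ, 0 ≤ C ∧ 0 < r ∧ ∀ x, ‖x‖ < r → ‖pd i v x‖ ≤ C * ‖x‖ ^ K := by
    intro i
    refine growth hR K (pd i v) (hv.pd i) fun l hl => ?_
    have := hD (l ++ [i])
    rwa [DD_append] at this
  choose C' r' hC' hr' h' using this
  have hm : ∀ f : Fin 3 → ℝ, (∀ i, 0 ≤ f i) → ∀ i, f i ≤ f 0 + f 1 + f 2 := by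
    intro f hf i
    have h0 := hf 0; have h1 := hf 1; have h2 := hf 2
    fin_cases i <;> simp <;> linarith
  refine ⟨C + (C' 0 + C' 1 + C' 2), min r (min (r' 0) (min (r' 1) (r' 2))),
    lt_min hr (lt_min (hr' 0) (lt_min (hr' 1) (hr' 2))), fun x hx => ?_⟩
  rw [sub_zero] at hx ⊢
  simp only [lt_min_iff] at hx
  obtain ⟨hxr, hx0, hx1, hx2⟩ := hx
  have hxr' : ∀ i, ‖x‖ < r' i := by intro i; fin_cases i <;> assumption
  have := hC' 0; have := hC' 1; have := hC' 2
  constructor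
  · refine (h x hxr).trans ?_
    gcongr; linarith
  · intro i
    refine (h' i x (hxr' i)).trans ?_
    gcongr
    linarith [hm C' hC' i]

/-- Leading Taylor term. -/
noncomputable def TT (N : ℕ) (v : E3 → ℂ) (x : E3) : ℂ :=
  ((N.factorial : ℂ))⁻¹ * ∑ f : Fin N → Fin 3, (∏ j, (x (f j) : ℂ)) * DD (List.ofFn f) v 0

theorem TT_succ {R : ℝ} (hR : 0 < R) (N : ℕ) {v : E3 → ℂ} (hv : Sm R v) (x : E3) :
    TT (N + 1) v x = ((N : ℂ) + 1)⁻¹ * ∑ i, (x i : ℂ) * TT N (pd i v) x := by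
  unfold TT
  rw [← (Fin.consEquiv fun _ => Fin 3).sum_comp, Fintype.sum_prod_type, Nat.factorial_succ]
  push_cast
  rw [mul_inv, mul_assoc]
  congr 1
  rw [Finset.mul_sum]
  refine Finset.sum_congr rfl fun i _ => ?_
  rw [mul_left_comm]
  congr 1
  rw [Finset.mul_sum]
  refine Finset.sum_congr rfl fun f _ => ?_
  have e : List.ofFn (Fin.cons i f : Fin (N+1) → Fin 3) = i :: List.ofFn f := by
    rw [List.ofFn_succ]; simp
  have p : DD (i :: List.ofFn f) v 0 = DD (List.ofFn f) (pd i v) 0 := by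
    have : DD (List.ofFn f) (pd i v) = DD (List.ofFn f ++ [i]) v := by rw [DD_append]; rfl
    rw [this]
    exact DD_perm hv (List.perm_append_singleton i _).symm 0 (by simpa using hR)
  simp only [Fin.consEquiv, Equiv.coe_fn_mk]
  rw [e, p, Fin.prod_univ_succ]
  simp [mul_assoc]

theorem taylor_lim {R : ℝ} (hR : 0 < R) (N : ℕ) : ∀ v : E3 → ℂ, Sm R v →
    (∀ l : List (Fin 3), l.length < N → DD l v 0 = 0) → ∀ x : E3,
    Filter.Tendsto (fun t : ℝ => (t ^ N)⁻¹ • v (t • x)) (nhdsWithin 0 (Ioi 0)) (nhds (TT N v x)) := by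
  induction N with
  | zero =>
    intro v hv _ x
    have hc : ContinuousAt v 0 := (hv.diff (by simpa using hR)).continuousAt
    have hc2 : ContinuousAt (fun t : ℝ => v (t • x)) 0 := by
      refine ContinuousAt.comp (f := fun t : ℝ => t • x) ?_ (by fun_prop)
      simpa using hc
    have := hc2.tendsto.mono_left (nhdsWithin_le_nhds (s := Ioi 0))
    simpa [TT, DD] using this
  | succ N ih =>
    intro v hv hD x
    have h1 : ∀ i, Filter.Tendsto (fun t : ℝ => (t ^ N)⁻¹ • pd i v (t • x)) (nhdsWithin 0 (Ioi 0))
        (nhds (TT N (pd i v) x)) := by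
      intro i
      refine ih (pd i v) (hv.pd i) (fun l hl => ?_) x
      have := hD (l ++ [i]) (by simpa using hl)
      rwa [DD_append] at this
    set L : ℂ := ∑ i, (x i) • TT N (pd i v) x with hL
    have h2 : Filter.Tendsto (fun t : ℝ => (t ^ N)⁻¹ • fderiv ℝ v (t • x) x) (nhdsWithin 0 (Ioi 0)) (nhds L) := by
      have := tendsto_finsetSum (f := fun i (t : ℝ) => (x i) • ((t ^ N)⁻¹ • pd i v (t • x))) Finset.univ
        (fun i _ => (h1 i).const_smul (x i))
      refine this.congr fun t => ?_
      rw [fderiv_eq_sum, Finset.smul_sum]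
      exact Finset.sum_congr rfl fun i _ => smul_comm _ _ _
    have h0 : v 0 = 0 := hD [] (by simp)
    have hT : TT (N + 1) v x = ((N : ℝ) + 1)⁻¹ • L := by
      rw [TT_succ hR N hv, hL, Complex.real_smul]
      push_cast
      simp only [Complex.real_smul]
    rw [hT]
    rw [Metric.tendsto_nhds]
    intro ε hε
    have h3 := (Metric.tendsto_nhds.1 h2) (ε / 2) (half_pos hε)
    obtain ⟨a, ha, hh⟩ := mem_nhdsGT_iff_exists_Ioo_subset.1 h3
    have ha : 0 < a := ha
    have hcR : ∀ᶠ t in nhdsWithin (0:ℝ) (Ioi 0), |t| * (‖x‖ + 1) < R := by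
      have : ContinuousAt (fun t : ℝ => |t| * (‖x‖ + 1)) 0 := by fun_prop
      exact (this.eventually (gt_mem_nhds (by simpa using hR))).filter_mono nhdsWithin_le_nhds
    filter_upwards [hcR, Ioo_mem_nhdsGT ha] with t htR hta
    have ht : 0 < t := hta.1
    have hin : ∀ s ∈ Icc 0 t, s • x ∈ ball (0:E3) R := by
      intro s hs
      rw [abs_of_pos ht] at htR
      have : s * ‖x‖ < R := by nlinarith [norm_nonneg x, hs.1, hs.2]
      simpa [norm_smul, abs_of_nonneg hs.1] using this
    set ψ : ℝ → ℂ := fun s => v (s • x) - (s ^ (N+1) * ((N : ℝ) + 1)⁻¹) • L with hψ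
    have hd : ∀ s ∈ Icc 0 t, HasDerivWithinAt ψ (fderiv ℝ v (s • x) x - s ^ N • L) (Icc 0 t) s := by
      intro s hs
      have e1 : HasDerivAt (fun s : ℝ => s • x) x s := by simpa using (hasDerivAt_id s).smul_const x
      have e2 := (hv.diff (hin s hs)).hasFDerivAt.comp_hasDerivAt s e1
      have e3 : HasDerivAt (fun s : ℝ => (s ^ (N+1) * ((N : ℝ) + 1)⁻¹) • L) (s ^ N • L) s := by
        have := ((hasDerivAt_pow (N+1) s).mul_const ((N : ℝ) + 1)⁻¹).smul_const L
        have e4 : (((N + 1 : ℕ) : ℝ) * s ^ (N + 1 - 1) * ((N : ℝ) + 1)⁻¹) = s ^ N := by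
          have : ((N:ℝ) + 1) ≠ 0 := by positivity
          push_cast
          field_simp
        rwa [e4] at this
      exact (e2.sub e3).hasDerivWithinAt
    have hb : ∀ s ∈ Icc 0 t, ‖fderiv ℝ v (s • x) x - s ^ N • L‖ ≤ ε / 2 * t ^ N := by
      intro s hs
      rcases hs.1.eq_or_lt with h00 | hsp
      · have : fderiv ℝ v (s • x) x - s ^ N • L = 0 := by
          rw [← h00, zero_smul, fderiv_eq_sum, hL]
          rcases N with _ | N
          · simp [TT, DD]
          · have : ∀ i, pd i v 0 = 0 := fun i => hD [i] (by simp)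
            simp [this]
        rw [this, norm_zero]; positivity
      · have h5 : dist ((s ^ N)⁻¹ • fderiv ℝ v (s • x) x) L < ε / 2 := hh ⟨hsp, hs.2.trans_lt hta.2⟩
        have e : fderiv ℝ v (s • x) x - s ^ N • L = s ^ N • ((s ^ N)⁻¹ • fderiv ℝ v (s • x) x - L) := by
          rw [smul_sub, smul_smul, mul_inv_cancel₀ (by positivity), one_smul]
        rw [e, norm_smul, norm_pow, Real.norm_eq_abs, abs_of_pos hsp, ← dist_eq_norm, mul_comm]
        exact mul_le_mul h5.le (pow_le_pow_left₀ hsp.le hs.2 N) (by positivity) (by positivity)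
    have := (convex_Icc 0 t).norm_image_sub_le_of_norm_hasDerivWithin_le hd hb
      (left_mem_Icc.2 ht.le) (right_mem_Icc.2 ht.le)
    have e0 : ψ 0 = 0 := by simp [hψ, h0]
    rw [e0, sub_zero, sub_zero, Real.norm_eq_abs, abs_of_pos ht] at this
    rw [dist_eq_norm]
    have e : (t ^ (N+1))⁻¹ • v (t • x) - ((N:ℝ) + 1)⁻¹ • L = (t ^ (N+1))⁻¹ • ψ t := by
      simp only [hψ, smul_sub, smul_smul]
      congr 2
      rw [← mul_assoc, inv_mul_cancel₀ (by positivity), one_mul]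
    rw [e, norm_smul, norm_inv, norm_pow, Real.norm_eq_abs, abs_of_pos ht, inv_mul_lt_iff₀ (by positivity)]
    refine this.trans_lt ?_
    have : 0 < t ^ (N+1) := by positivity
    rw [mul_assoc, ← pow_succ]
    nlinarith


theorem count3 (l : List (Fin 3)) : l.count 0 + l.count 1 + l.count 2 = l.length := by
  induction l with
  | nil => simp
  | cons i l ih =>
    rw [List.length_cons, ← ih]
    fin_cases i <;> simp [List.count_cons] <;> ring

/-- Standard list with prescribed counts. -/
def stdL (a b c : ℕ) : List (Fin 3) := List.replicate a 0 ++ (List.replicate b 1 ++ List.replicate c 2)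

theorem perm_std (l : List (Fin 3)) : l.Perm (stdL (l.count 0) (l.count 1) (l.count 2)) := by
  rw [List.perm_iff_count]
  intro i
  fin_cases i <;> simp [stdL, List.count_replicate]

theorem perm_of_counts {l l' : List (Fin 3)} (h0 : l.count 0 = l'.count 0) (h1 : l.count 1 = l'.count 1)
    (h2 : l.count 2 = l'.count 2) : l.Perm l' := by
  rw [List.perm_iff_count]
  intro i
  fin_cases i <;> simp [*]

theorem corner_algebra (N : ℕ) (D : List (Fin 3) → ℂ) (hperm : ∀ l l' : List (Fin 3), l.Perm l' → D l = D l')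
    (hrec : ∀ l : List (Fin 3), l.length + 2 = N → ∑ i, D (i :: i :: l) = 0)
    (hint : ∀ ρ : Fin 3 → ℂ, (∀ i, 0 < (ρ i).re) → ∑ i, ρ i ^ 2 = 0 →
      ∑ f : Fin N → Fin 3, D (List.ofFn f) * ∏ i, (((List.ofFn f).count i).factorial : ℂ) /
        ρ i ^ ((List.ofFn f).count i + 1) = 0) :
    ∀ f : Fin N → Fin 3, D (List.ofFn f) = 0 := by
  classical
  by_contra hcon
  push Not at hcon
  obtain ⟨f0, hf0⟩ := hcon
  obtain ⟨fs, hfs, hmax⟩ := Finset.exists_max_image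
    (Finset.univ.filter fun f : Fin N → Fin 3 => D (List.ofFn f) ≠ 0) (fun f => (List.ofFn f).count 1)
    ⟨f0, by simpa using hf0⟩
  set m := (List.ofFn fs).count 1 with hm
  have hfs' : D (List.ofFn fs) ≠ 0 := by simpa using hfs
  have hmax' : ∀ f : Fin N → Fin 3, D (List.ofFn f) ≠ 0 → (List.ofFn f).count 1 ≤ m := fun f hf =>
    hmax f (by simpa using hf)
  have hlist : ∀ l : List (Fin 3), l.length = N → m < l.count 1 → D l = 0 := by
    intro l hl hlt
    by_contra hne
    subst hl
    have h := hmax' l.get (by rwa [List.ofFn_get])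
    rw [List.ofFn_get] at h
    omega
  -- weights
  set w : (Fin N → Fin 3) → ℕ := fun f => ((List.ofFn f).count 0).factorial * ((List.ofFn f).count 1).factorial *
    ((List.ofFn f).count 2).factorial with hw
  have hwpos : ∀ f, 0 < w f := fun f => by simp only [hw]; positivity
  have S : ∀ j : ℂ, j ^ 2 = -1 → j.re = 0 →
      ∑ f : Fin N → Fin 3, (if (List.ofFn f).count 1 = m then D (List.ofFn f) * w f * (-j) ^ (List.ofFn f).count 2 else 0) = 0 := by
    intro j hj hjre
    have hj0 : j ≠ 0 := by
      rintro rfl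
      norm_num at hj
    have hl0 : (1 - j) ≠ 0 := by
      intro h
      have := congrArg Complex.re h
      simp [hjre] at this
    set r0 : ℝ → ℂ := fun t => (1 - j) - 2 * (t:ℂ) ^ 2 * (1 + j) with hr0
    set r2 : ℝ → ℂ := fun t => (1 + j) + 2 * (t:ℂ) ^ 2 * (j - 1) with hr2
    have hc0 : Continuous r0 := by fun_prop
    have hc2 : Continuous r2 := by fun_prop
    have hre0 : ∀ t, (r0 t).re = 1 - 2 * t ^ 2 := by
      intro t
      simp only [hr0, ← Complex.ofReal_pow]
      simp [hjre]
      ring_nf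
      simp [← Complex.ofReal_pow]
    have hre2 : ∀ t, (r2 t).re = 1 - 2 * t ^ 2 := by
      intro t
      simp only [hr2, ← Complex.ofReal_pow]
      simp [hjre]
      ring_nf
      simp [← Complex.ofReal_pow]
    have hr00 : r0 0 = 1 - j := by simp [hr0]
    have hr20 : r2 0 = j * (1 - j) := by simp only [hr2]; push_cast; linear_combination hj
    set H : ℝ → ℂ := fun t => ∑ f : Fin N → Fin 3, D (List.ofFn f) * w f *
      ((r0 t ^ ((List.ofFn f).count 0 + 1))⁻¹ * (r2 t ^ ((List.ofFn f).count 2 + 1))⁻¹ *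
        (4 * (t:ℂ)) ^ (m - (List.ofFn f).count 1)) with hH
    have hHc : ContinuousAt H 0 := by
      refine tendsto_finsetSum _ fun f _ => ?_
      have h0 : ContinuousAt (fun t => (r0 t ^ ((List.ofFn f).count 0 + 1))⁻¹) 0 :=
        (hc0.continuousAt.pow _).inv₀ (by rw [Pi.pow_apply, hr00]; exact pow_ne_zero _ hl0)
      have h2 : ContinuousAt (fun t => (r2 t ^ ((List.ofFn f).count 2 + 1))⁻¹) 0 :=
        (hc2.continuousAt.pow _).inv₀ (by rw [Pi.pow_apply, hr20]; exact pow_ne_zero _ (mul_ne_zero hj0 hl0))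
      have h1 : ContinuousAt (fun t : ℝ => (4 * (t:ℂ)) ^ (m - (List.ofFn f).count 1)) 0 := by fun_prop
      exact continuousAt_const.mul ((h0.mul h2).mul h1)
    have hHz : ∀ t : ℝ, 0 < t → t < 1/2 → H t = 0 := by
      intro t ht ht2
      have hpos : 0 < 1 - 2 * t ^ 2 := by nlinarith
      have h := hint ![r0 t, 4 * (t:ℂ), r2 t] (by
        intro i
        fin_cases i
        · simpa [hre0] using hpos
        · simpa using ht
        · simpa [hre2] using hpos) (by
        rw [Fin.sum_univ_three]
        simp only [Matrix.cons_val_zero, Matrix.cons_val_one, Matrix.cons_val, hr0, hr2]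
        linear_combination (2 + 8 * (t:ℂ)^2 + 8 * (t:ℂ)^4) * hj)
      have ht0 : (4 * (t:ℂ)) ≠ 0 := mul_ne_zero (by norm_num) (by exact_mod_cast ht.ne')
      have h' := congrArg (fun z => (4 * (t:ℂ)) ^ (m+1) * z) h
      beta_reduce at h'
      rw [mul_zero, Finset.mul_sum] at h'
      rw [hH]
      beta_reduce
      rw [← h']
      refine Finset.sum_congr rfl fun f _ => ?_
      by_cases hle : (List.ofFn f).count 1 ≤ m
      · have e : m + 1 = (m - (List.ofFn f).count 1) + ((List.ofFn f).count 1 + 1) := by omega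
        rw [Fin.prod_univ_three]
        simp only [Matrix.cons_val_zero, Matrix.cons_val_one, Matrix.cons_val, hw]
        rw [e, pow_add _ (m - (List.ofFn f).count 1)]
        have := pow_ne_zero ((List.ofFn f).count 1 + 1) ht0
        rw [div_eq_mul_inv, div_eq_mul_inv, div_eq_mul_inv]
        push_cast
        linear_combination (-(D (List.ofFn f)) * ((List.ofFn f).count 0).factorial * ((List.ofFn f).count 1).factorial * ((List.ofFn f).count 2).factorial * (r0 t ^ ((List.ofFn f).count 0 + 1))⁻¹ * (r2 t ^ ((List.ofFn f).count 2 + 1))⁻¹ *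
          (4 * (t:ℂ)) ^ (m - (List.ofFn f).count 1)) * (mul_inv_cancel₀ this)
      · rw [hlist _ (by simp) (not_le.1 hle)]; simp
    have hH0 : H 0 = 0 := by
      have h1 : Filter.Tendsto H (nhdsWithin 0 (Ioi 0)) (nhds (H 0)) := hHc.tendsto.mono_left nhdsWithin_le_nhds
      refine tendsto_nhds_unique h1 (tendsto_const_nhds.congr' ?_)
      filter_upwards [Ioo_mem_nhdsGT (show (0:ℝ) < 1/2 by norm_num)] with t ht
      exact (hHz t ht.1 ht.2).symm
    have h' := congrArg (fun z => (1 - j) ^ (N - m + 2) * j * z) hH0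
    beta_reduce at h'
    rw [mul_zero, hH] at h'
    beta_reduce at h'
    rw [Finset.mul_sum] at h'
    refine Eq.trans ?_ h'
    refine Finset.sum_congr rfl fun f _ => ?_
    have e1 := count3 (List.ofFn f)
    rw [List.length_ofFn] at e1
    rcases lt_trichotomy ((List.ofFn f).count 1) m with hlt | heq | hgt
    · rw [if_neg hlt.ne]
      simp [show m - (List.ofFn f).count 1 ≠ 0 by omega]
    · rw [if_pos heq, heq, Nat.sub_self, pow_zero, hr00, hr20]
      have e2 : N - m + 2 = ((List.ofFn f).count 0 + 1) + ((List.ofFn f).count 2 + 1) := by omega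
      rw [e2, pow_add (1 - j) ((List.ofFn f).count 0 + 1), mul_pow j (1-j)]
      have e3 : (-j) ^ (List.ofFn f).count 2 * j ^ ((List.ofFn f).count 2) = 1 := by
        rw [← mul_pow, show -j * j = 1 by linear_combination -hj, one_pow]
      have a0 := pow_ne_zero ((List.ofFn f).count 0 + 1) hl0
      have a2 := pow_ne_zero ((List.ofFn f).count 2 + 1) hl0
      have a3 := pow_ne_zero ((List.ofFn f).count 2) hj0
      rw [pow_succ j]
      have hA : (-j) ^ (List.ofFn f).count 2 = (j ^ ((List.ofFn f).count 2))⁻¹ := eq_inv_of_mul_eq_one_left e3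
      rw [hA]
      field_simp
    · rw [if_neg hgt.ne', hlist _ (by simp) hgt]; simp
  -- the recursion
  have hg : ∀ a c : ℕ, a + m + (c + 2) = N → D (stdL a m (c+2)) = - D (stdL (a+2) m c) := by
    intro a c hac
    have h := hrec (stdL a m c) (by simp [stdL]; omega)
    rw [Fin.sum_univ_three] at h
    have h1 : D (1 :: 1 :: stdL a m c) = 0 := hlist _ (by simp [stdL]; omega) (by
      simp [stdL, List.count_replicate])
    have h0 : D (0 :: 0 :: stdL a m c) = D (stdL (a+2) m c) := hperm _ _ (by
      apply perm_of_counts <;> simp [stdL, List.count_replicate])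
    have h2 : D (2 :: 2 :: stdL a m c) = D (stdL a m (c+2)) := hperm _ _ (by
      apply perm_of_counts <;> simp [stdL, List.count_replicate])
    rw [h0, h1, h2] at h
    linear_combination h
  have hg2 : ∀ c a : ℕ, a + m + c = N → (-Complex.I) ^ c * D (stdL a m c) =
      (-Complex.I) ^ (c % 2) * D (stdL (N - m - c % 2) m (c % 2)) := by
    intro c
    induction c using Nat.strong_induction_on with
    | _ c ih =>
      intro a hac
      match c, ih, hac with
      | 0, _, hac => simp; congr 2; omega
      | 1, _, hac => simp; congr 2; omega
      | c + 2, ih, hac =>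
        rw [hg a c hac, Nat.add_mod_right, ← ih c (by omega) (a + 2) (by omega), pow_add]
        have : (-Complex.I) ^ 2 = -1 := by simp
        rw [this]; ring
  have hG : ∀ f : Fin N → Fin 3, (List.ofFn f).count 1 = m → (List.ofFn f).count 2 % 2 = (List.ofFn fs).count 2 % 2 →
      (-Complex.I) ^ ((List.ofFn f).count 2) * D (List.ofFn f) =
      (-Complex.I) ^ ((List.ofFn fs).count 2) * D (List.ofFn fs) := by
    intro f hf1 hf2
    have e1 := count3 (List.ofFn f)
    have e2 := count3 (List.ofFn fs)
    rw [List.length_ofFn] at e1 e2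
    rw [hperm _ _ (perm_std (List.ofFn f)), hperm _ _ (perm_std (List.ofFn fs)), hf1, ← hm]
    refine (hg2 _ _ (by omega)).trans (Eq.trans ?_ (hg2 _ _ (by omega)).symm)
    rw [hf2]
  have S1 := S Complex.I (by simp) (by simp)
  have S2 := S (-Complex.I) (by simp) (by simp)
  set g : ℂ := (-Complex.I) ^ ((List.ofFn fs).count 2) * D (List.ofFn fs) with hgdef
  have hg0 : g ≠ 0 := mul_ne_zero (pow_ne_zero _ (neg_ne_zero.2 Complex.I_ne_zero)) hfs'
  set p := (List.ofFn fs).count 2 with hp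
  have S3 : ∑ f : Fin N → Fin 3, g * ((if (List.ofFn f).count 1 = m ∧ (List.ofFn f).count 2 % 2 = p % 2 then 2 * w f else 0 : ℕ) : ℂ) = 0 := by
    have e := congrArg₂ (fun a b : ℂ => a + (-1) ^ p * b) S1 S2
    beta_reduce at e
    rw [mul_zero, add_zero] at e
    refine Eq.trans ?_ e
    rw [Finset.mul_sum, ← Finset.sum_add_distrib]
    refine Finset.sum_congr rfl fun f _ => ?_
    by_cases h1 : (List.ofFn f).count 1 = m
    · have hs : (-(-Complex.I)) ^ (List.ofFn f).count 2 = (-1) ^ (List.ofFn f).count 2 * (-Complex.I) ^ (List.ofFn f).count 2 := by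
        rw [← mul_pow]; simp
      by_cases h2 : (List.ofFn f).count 2 % 2 = p % 2
      · have h3 := hG f h1 h2
        have h4 : (-1 : ℂ) ^ p * (-1) ^ (List.ofFn f).count 2 = 1 := by
          rw [← pow_add, Even.neg_one_pow]; rw [Nat.even_iff]; omega
        simp only [h1, h2, and_self, if_true, hs]
        push_cast
        rw [← h3]
        linear_combination (-(D (List.ofFn f)) * w f * (-Complex.I) ^ (List.ofFn f).count 2) * h4
      · have h4 : (-1 : ℂ) ^ p * (-1) ^ (List.ofFn f).count 2 = -1 := by
          rw [← pow_add, Odd.neg_one_pow]; rw [Nat.odd_iff]; omega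
        simp only [h1, h2, and_false, if_false, if_true, hs]
        push_cast
        linear_combination (-(D (List.ofFn f)) * w f * (-Complex.I) ^ (List.ofFn f).count 2) * h4
    · simp [h1]
  rw [← Finset.mul_sum] at S3
  rcases mul_eq_zero.1 S3 with h | h
  · exact hg0 h
  · rw [← Nat.cast_sum, Nat.cast_eq_zero, Finset.sum_eq_zero_iff] at h
    have := h fs (Finset.mem_univ _)
    simp [← hm, ← hp] at this
    have := hwpos fs
    omega


theorem laplace1_norm (n : ℕ) (c : ℂ) (t : ℝ) (ht : 0 < t) :
    ‖(t:ℂ) ^ n * Complex.exp (-(c * t))‖ = t ^ (n:ℝ) * Real.exp (-c.re * t) := by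
  rw [norm_mul, norm_pow, Complex.norm_exp, Complex.norm_real, Real.norm_of_nonneg ht.le, Real.rpow_natCast]
  simp

theorem laplace1_int (n : ℕ) (c : ℂ) (hc : 0 < c.re) :
    IntegrableOn (fun t : ℝ => (t:ℂ) ^ n * Complex.exp (-(c * t))) (Ioi 0) := by
  have h := integrableOn_rpow_mul_exp_neg_mul_rpow (s := n) (p := 1) (b := c.re)
    (by have : (0:ℝ) ≤ n := n.cast_nonneg
        linarith) (by norm_num) hc
  refine Integrable.mono' h ?_ ?_
  · apply Continuous.aestronglyMeasurable; fun_prop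
  · filter_upwards [ae_restrict_mem measurableSet_Ioi] with t ht
    rw [laplace1_norm n c t ht, Real.rpow_one]

theorem laplace1 (n : ℕ) (c : ℂ) (hc : 0 < c.re) :
    ∫ t in Ioi (0:ℝ), (t:ℂ) ^ n * Complex.exp (-(c * t)) = (n.factorial : ℂ) / c ^ (n + 1) := by
  have hc0 : c ≠ 0 := by rintro rfl; simp at hc
  have hder : ∀ n : ℕ, ∀ t : ℝ, HasDerivAt (fun t : ℝ => (t:ℂ) ^ n * Complex.exp (-(c * t)))
      ((n:ℂ) * ((t:ℂ) ^ (n-1) * Complex.exp (-(c * t))) - c * ((t:ℂ) ^ n * Complex.exp (-(c * t)))) t := by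
    intro n t
    have h1 : HasDerivAt (fun t : ℂ => t ^ n * Complex.exp (-(c * t)))
      ((n:ℂ) * ((t:ℂ) ^ (n-1) * Complex.exp (-(c * t))) - c * ((t:ℂ) ^ n * Complex.exp (-(c * t)))) (t:ℂ) := by
      have h2 := (hasDerivAt_pow n (t:ℂ)).mul (((hasDerivAt_id (t:ℂ)).const_mul c).neg.cexp)
      refine h2.congr_deriv ?_
      simp; ring
    exact h1.comp_ofReal
  have hlim : ∀ n : ℕ, Filter.Tendsto (fun t : ℝ => (t:ℂ) ^ n * Complex.exp (-(c * t))) Filter.atTop (nhds 0) := by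
    intro n
    rw [tendsto_zero_iff_norm_tendsto_zero]
    refine (tendsto_rpow_mul_exp_neg_mul_atTop_nhds_zero n c.re hc).congr' ?_
    filter_upwards [Filter.eventually_gt_atTop 0] with t ht
    rw [laplace1_norm n c t ht]
  have key : ∀ n : ℕ, ∫ t in Ioi (0:ℝ), ((n:ℂ) * ((t:ℂ) ^ (n-1) * Complex.exp (-(c * t))) - c * ((t:ℂ) ^ n * Complex.exp (-(c * t))))
      = 0 - ((0:ℝ):ℂ) ^ n * Complex.exp (-(c * (0:ℝ))) := by
    intro n
    refine integral_Ioi_of_hasDerivAt_of_tendsto (hder n 0).continuousAt.continuousWithinAt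
      (fun x _ => hder n x) ?_ (hlim n)
    exact ((laplace1_int (n-1) c hc).const_mul _).sub ((laplace1_int n c hc).const_mul _)
  induction n with
  | zero =>
    have h := key 0
    rw [integral_sub ((laplace1_int _ c hc).const_mul _) ((laplace1_int _ c hc).const_mul _),
      integral_const_mul, integral_const_mul] at h
    simp at h ⊢
    field_simp
    exact h
  | succ n ih =>
    have h := key (n+1)
    rw [integral_sub ((laplace1_int _ c hc).const_mul _) ((laplace1_int _ c hc).const_mul _),
      integral_const_mul, integral_const_mul, Nat.add_sub_cancel, ih] at h
    simp only [Complex.ofReal_zero, ne_eq, Nat.succ_ne_zero, not_false_eq_true, zero_pow, zero_mul, sub_zero] at h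
    rw [eq_div_iff (pow_ne_zero _ hc0), Nat.factorial_succ]
    push_cast at h ⊢
    rw [sub_eq_zero, mul_div_assoc', div_eq_iff (pow_ne_zero _ hc0)] at h
    rw [pow_succ _ (n+1)]
    linear_combination -h

/-- open octant -/
def Oct : Set E3 := {x | ∀ i, 0 < x i}

theorem isOpen_Oct : IsOpen Oct := by
  have : Oct = ⋂ i, {x : E3 | 0 < x i} := by ext; simp [Oct]
  rw [this]
  exact isOpen_iInter_of_finite fun i => isOpen_lt continuous_const (by fun_prop)

theorem prod_count {N : ℕ} (f : Fin N → Fin 3) (y : Fin 3 → ℂ) :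
    ∏ j, y (f j) = ∏ i, y i ^ (List.ofFn f).count i := by
  rw [← List.prod_ofFn, show (fun j => y (f j)) = y ∘ f from rfl, ← List.map_ofFn, Finset.prod_list_map_count]
  refine Finset.prod_subset (Finset.subset_univ _) fun i _ hi => ?_
  rw [List.count_eq_zero.2 (by simpa using hi), pow_zero]

theorem laplace3_aux (n : Fin 3 → ℕ) (ρ : Fin 3 → ℂ) (hρ : ∀ i, 0 < (ρ i).re) :
    IntegrableOn (fun x : E3 => (∏ i, (x i : ℂ) ^ n i) * Complex.exp (-∑ i, ρ i * x i)) Oct ∧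
    ∫ x in Oct, (∏ i, (x i : ℂ) ^ n i) * Complex.exp (-∑ i, ρ i * x i) = ∏ i, ((n i).factorial : ℂ) / ρ i ^ (n i + 1) := by
  have hme : MeasurableEmbedding (@WithLp.ofLp 2 (Fin 3 → ℝ)) :=
    (MeasurableEquiv.toLp 2 (Fin 3 → ℝ)).symm.measurableEmbedding
  have e : Oct.indicator (fun x : E3 => (∏ i, (x i : ℂ) ^ n i) * Complex.exp (-∑ i, ρ i * x i)) =
      fun x : E3 => (fun y : Fin 3 → ℝ => ∏ i, (Ioi (0:ℝ)).indicator (fun t : ℝ => (t:ℂ) ^ n i * Complex.exp (-(ρ i * t))) (y i)) (WithLp.ofLp x) := by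
    funext x
    by_cases hx : x ∈ Oct
    · rw [indicator_of_mem hx]
      beta_reduce
      rw [Finset.prod_congr rfl fun i _ => indicator_of_mem (show WithLp.ofLp x i ∈ Ioi (0:ℝ) from hx i) _,
        Finset.prod_mul_distrib, ← Complex.exp_sum, Finset.sum_neg_distrib]
    · rw [indicator_of_notMem hx]
      simp only [Oct, mem_setOf_eq, not_forall] at hx
      obtain ⟨i, hi⟩ := hx
      symm
      exact Finset.prod_eq_zero (Finset.mem_univ i) (indicator_of_notMem hi _)
  have hint : Integrable (fun y : Fin 3 → ℝ => ∏ i, (Ioi (0:ℝ)).indicator (fun t : ℝ => (t:ℂ) ^ n i * Complex.exp (-(ρ i * t))) (y i)) volume :=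
    Integrable.fintype_prod (f := fun i => (Ioi (0:ℝ)).indicator (fun t : ℝ => (t:ℂ) ^ n i * Complex.exp (-(ρ i * t))))
      fun i => (integrable_indicator_iff measurableSet_Ioi).2 (laplace1_int (n i) (ρ i) (hρ i))
  constructor
  · rw [← integrable_indicator_iff isOpen_Oct.measurableSet, e]
    exact ((PiLp.volume_preserving_ofLp (Fin 3)).integrable_comp_emb hme).2 hint
  · rw [← integral_indicator isOpen_Oct.measurableSet, e,
      (PiLp.volume_preserving_ofLp (Fin 3)).integral_comp hme,
      integral_fintype_prod_volume_eq_prod (fun i => (Ioi (0:ℝ)).indicator (fun t : ℝ => (t:ℂ) ^ n i * Complex.exp (-(ρ i * t))))]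
    refine Finset.prod_congr rfl fun i _ => ?_
    rw [integral_indicator measurableSet_Ioi, laplace1 _ _ (hρ i)]

theorem laplace_TT (N : ℕ) (v : E3 → ℂ) (ρ : Fin 3 → ℂ) (hρ : ∀ i, 0 < (ρ i).re) :
    ∫ x in Oct, TT N v x * Complex.exp (-∑ i, ρ i * x i) =
    (N.factorial : ℂ)⁻¹ * ∑ f : Fin N → Fin 3, DD (List.ofFn f) v 0 * ∏ i, (((List.ofFn f).count i).factorial : ℂ) /
        ρ i ^ ((List.ofFn f).count i + 1) := by
  have e : ∀ x : E3, TT N v x * Complex.exp (-∑ i, ρ i * x i) = (N.factorial : ℂ)⁻¹ * ∑ f : Fin N → Fin 3,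
      DD (List.ofFn f) v 0 * ((∏ i, (x i : ℂ) ^ ((List.ofFn f).count i)) * Complex.exp (-∑ i, ρ i * x i)) := by
    intro x
    rw [TT, mul_assoc, Finset.sum_mul]
    congr 1
    refine Finset.sum_congr rfl fun f _ => ?_
    rw [prod_count f (fun i => (x i : ℂ))]
    ring
  simp_rw [e]
  rw [integral_const_mul, integral_finsetSum]
  · congr 1
    refine Finset.sum_congr rfl fun f _ => ?_
    rw [integral_const_mul, (laplace3_aux (fun i => (List.ofFn f).count i) ρ hρ).2]
  · intro f _
    exact (laplace3_aux (fun i => (List.ofFn f).count i) ρ hρ).1.const_mul _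

/-- polynomial times exponential is integrable on the octant -/
theorem int_poly_exp (n : ℕ) (a : Fin 3 → ℝ) (ha : ∀ i, 0 < a i) :
    IntegrableOn (fun x : E3 => ‖x‖ ^ n * Real.exp (-∑ i, a i * x i)) Oct := by
  obtain ⟨μ, hμ, hμa⟩ : ∃ μ : ℝ, 0 < μ ∧ ∀ i, μ ≤ a i := by
    refine ⟨min (a 0) (min (a 1) (a 2)), by simp [ha], fun i => ?_⟩
    fin_cases i <;> simp
  have hI := (laplace3_aux (fun _ => 0) (fun _ => ((μ/2 : ℝ) : ℂ)) (fun _ => by rw [Complex.ofReal_re]; positivity)).1.norm.const_mul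
    ((2/μ)^n * n.factorial)
  refine Integrable.mono' hI ?_ ?_
  · apply Continuous.aestronglyMeasurable; fun_prop
  · filter_upwards [ae_restrict_mem isOpen_Oct.measurableSet] with x hx
    have hs : ‖x‖ ≤ ∑ i, x i := by
      have h0 := hx 0
      have h1 := hx 1
      have h2 := hx 2
      rw [EuclideanSpace.norm_eq, Fin.sum_univ_three, Fin.sum_univ_three]
      apply Real.sqrt_le_iff.2
      simp only [Real.norm_eq_abs, sq_abs]
      constructor
      · positivity
      · nlinarith [mul_pos h0 h1, mul_pos h0 h2, mul_pos h1 h2]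
    have hs0 : 0 ≤ ∑ i, x i := (norm_nonneg x).trans hs
    have e1 : ∑ i, a i * x i ≥ μ * ∑ i, x i := by
      rw [Finset.mul_sum]
      exact Finset.sum_le_sum fun i _ => mul_le_mul_of_nonneg_right (hμa i) (hx i).le
    have e2 : ‖x‖ ^ n ≤ (2/μ)^n * n.factorial * Real.exp (μ/2 * ∑ i, x i) := by
      have := Real.pow_div_factorial_le_exp (μ/2 * ∑ i, x i) (by positivity) n
      rw [div_le_iff₀ (by positivity)] at this
      calc ‖x‖ ^ n ≤ (∑ i, x i)^n := by gcongr
        _ = (2/μ)^n * (μ/2 * ∑ i, x i)^n := by rw [← mul_pow]; congr 1; field_simp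
        _ ≤ (2/μ)^n * (Real.exp (μ/2 * ∑ i, x i) * n.factorial) := by gcongr
        _ = _ := by ring
    rw [Real.norm_of_nonneg (by positivity)]
    have e3 : ‖(∏ i, (x i : ℂ) ^ 0) * Complex.exp (-∑ i, ((μ/2 : ℝ) : ℂ) * x i)‖ = Real.exp (-(μ/2 * ∑ i, x i)) := by
      rw [Finset.mul_sum]
      simp only [pow_zero, Finset.prod_const_one, one_mul, Complex.norm_exp]
      congr 1
      simp [-Fin.sum_univ_three]
    rw [e3]
    calc ‖x‖ ^ n * Real.exp (-∑ i, a i * x i) ≤ ((2/μ)^n * n.factorial * Real.exp (μ/2 * ∑ i, x i)) * Real.exp (-(μ * ∑ i, x i)) := by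
          gcongr
      _ = (2/μ)^n * n.factorial * Real.exp (-(μ/2 * ∑ i, x i)) := by
          rw [mul_assoc, ← Real.exp_add]; congr 2; ring


theorem Oct_sub : Oct ⊆ octant := fun x hx i => (hx i).le

theorem isClosed_octant : IsClosed octant := by
  have : octant = ⋂ i, {x : E3 | 0 ≤ x i} := by ext; simp [octant]
  rw [this]
  exact isClosed_iInter fun i => isClosed_le continuous_const (by fun_prop)

theorem line_tendsto (p : E3) (i : Fin 3) : Filter.Tendsto (fun t : ℝ => p + t • ee i) (nhds 0) (nhds p) := by
  have : Continuous (fun t : ℝ => p + t • ee i) := by fun_prop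
  simpa using this.tendsto 0

theorem interior_octant : interior octant = Oct := by
  refine subset_antisymm ?_ (interior_maximal Oct_sub isOpen_Oct)
  intro x hx i
  have h1 := (line_tendsto x i).eventually (mem_interior_iff_mem_nhds.1 hx)
  have h2 : ∀ᶠ t : ℝ in nhdsWithin 0 (Iio 0), t < 0 := eventually_mem_nhdsWithin
  obtain ⟨t, h3, h4⟩ := ((h1.filter_mono nhdsWithin_le_nhds).and h2).exists
  have := h3 i
  simp [ee] at this
  linarith

theorem frontier_octant : frontier octant = octant \ Oct := by
  rw [frontier, isClosed_octant.closure_eq, interior_octant]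

section glue
variable {F : Type*} [NormedAddCommGroup F] [NormedSpace ℝ F]

theorem glue0 {U S : Set E3} (hU : IsOpen U) (hS : IsClosed S) {f : E3 → F} (hf : ∀ x ∈ U, ContinuousAt f x)
    (h0 : ∀ x ∈ U, x ∈ frontier S → f x = 0) : ∀ x ∈ U, ContinuousAt (Sᶜ.indicator f) x := by
  intro x hx
  by_cases h1 : x ∈ S
  · by_cases h2 : x ∈ interior S
    · refine (continuousAt_const (y := (0:F))).congr ?_
      filter_upwards [isOpen_interior.mem_nhds h2] with y hy
      rw [indicator_of_notMem (by simpa using interior_subset hy)]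
    · have hz := h0 x hx ⟨subset_closure h1, h2⟩
      have := hf x hx
      rw [ContinuousAt, hz, tendsto_zero_iff_norm_tendsto_zero] at this
      rw [ContinuousAt, indicator_of_notMem (by simpa using h1), tendsto_zero_iff_norm_tendsto_zero]
      exact squeeze_zero (fun _ => norm_nonneg _) (fun y => norm_indicator_le_norm_self _ _) this
  · refine (hf x hx).congr ?_
    filter_upwards [hS.isOpen_compl.mem_nhds h1] with y hy
    rw [indicator_of_mem hy]

theorem glue1 {U S : Set E3} (hU : IsOpen U) (hS : IsClosed S) {f : E3 → F} (hf : ∀ x ∈ U, DifferentiableAt ℝ f x)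
    (h0 : ∀ x ∈ U, x ∈ frontier S → f x = 0 ∧ fderiv ℝ f x = 0) :
    ∀ x ∈ U, HasFDerivAt (Sᶜ.indicator f) (Sᶜ.indicator (fderiv ℝ f) x) x := by
  intro x hx
  by_cases h1 : x ∈ S
  · rw [indicator_of_notMem (by simpa using h1)]
    by_cases h2 : x ∈ interior S
    · refine (hasFDerivAt_const (0:F) x).congr_of_eventuallyEq ?_
      filter_upwards [isOpen_interior.mem_nhds h2] with y hy
      rw [indicator_of_notMem (by simpa using interior_subset hy)]
    · obtain ⟨hz, hz'⟩ := h0 x hx ⟨subset_closure h1, h2⟩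
      have := (hf x hx).hasFDerivAt
      rw [hz', hasFDerivAt_iff_isLittleO] at this
      rw [hasFDerivAt_iff_isLittleO]
      refine Asymptotics.IsBigO.trans_isLittleO ?_ this
      refine Asymptotics.IsBigO.of_bound 1 (Filter.Eventually.of_forall fun y => ?_)
      beta_reduce
      rw [indicator_of_notMem (show x ∉ Sᶜ by simpa using h1), hz]
      simpa using norm_indicator_le_norm_self f y
  · rw [indicator_of_mem h1]
    refine (hf x hx).hasFDerivAt.congr_of_eventuallyEq ?_
    filter_upwards [hS.isOpen_compl.mem_nhds h1] with y hy
    rw [indicator_of_mem hy]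

theorem glue2 {U S : Set E3} (hU : IsOpen U) (hS : IsClosed S) {f : E3 → F} (hf : ∀ x ∈ U, ContDiffAt ℝ 2 f x)
    (h0 : ∀ x ∈ U, x ∈ frontier S → f x = 0 ∧ fderiv ℝ f x = 0 ∧ fderiv ℝ (fderiv ℝ f) x = 0) :
    ∀ x ∈ U, ContDiffAt ℝ 2 (Sᶜ.indicator f) x := by
  have g1 := glue1 hU hS (fun x hx => (hf x hx).differentiableAt (by norm_num)) (fun x hx h => ⟨(h0 x hx h).1, (h0 x hx h).2.1⟩)
  have hf1 : ∀ x ∈ U, ContDiffAt ℝ 1 (fderiv ℝ f) x := fun x hx => (hf x hx).fderiv_right (by norm_num)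
  have g2 := glue1 hU hS (fun x hx => (hf1 x hx).differentiableAt (by norm_num)) (fun x hx h => (h0 x hx h).2)
  have hf2 : ∀ x ∈ U, ContinuousAt (fderiv ℝ (fderiv ℝ f)) x := fun x hx =>
    ((hf1 x hx).fderiv_right (m := 0) (by norm_num)).continuousAt
  have g3 := glue0 (F := E3 →L[ℝ] E3 →L[ℝ] F) hU hS hf2 (fun x hx h => (h0 x hx h).2.2)
  have a1 : ContDiffOn ℝ 1 (Sᶜ.indicator (fderiv ℝ f)) U := by
    rw [show (1 : WithTop ℕ∞) = 0 + 1 by norm_num, contDiffOn_succ_iff_fderiv_of_isOpen hU]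
    refine ⟨fun x hx => (g2 x hx).differentiableAt.differentiableWithinAt, by simp, ?_⟩
    rw [contDiffOn_zero]
    refine ContinuousOn.congr (f := Sᶜ.indicator (fderiv ℝ (fderiv ℝ f))) (fun x hx => (g3 x hx).continuousWithinAt) ?_
    intro x hx
    exact (g2 x hx).fderiv
  have a2 : ContDiffOn ℝ 2 (Sᶜ.indicator f) U := by
    rw [show (2 : WithTop ℕ∞) = 1 + 1 by norm_num, contDiffOn_succ_iff_fderiv_of_isOpen hU]
    refine ⟨fun x hx => (g1 x hx).differentiableAt.differentiableWithinAt, by simp, ?_⟩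
    exact a1.congr fun x hx => (g1 x hx).fderiv
  exact fun x hx => a2.contDiffAt (hU.mem_nhds hx)

theorem fderiv_zero_of_basis {G : E3 → F} {x : E3} (h : ∀ i, pd i G x = 0) : fderiv ℝ G x = 0 := by
  ext y
  rw [fderiv_eq_sum]
  simp [h]

end glue

theorem gamma_hess {w : E3 → ℂ} {R k : ℝ} (hw : ∀ x ∈ ball (0:E3) R, ContDiffAt ℝ 2 w x)
    (hG : ∀ x ∈ ball (0:E3) R, x ∈ octant → x ∉ Oct → w x = 0 ∧ fderiv ℝ w x = 0)
    (hlap : ∀ x ∈ ball (0:E3) R, x ∉ octant → lap w x = -(k^2) • w x) :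
    ∀ x ∈ ball (0:E3) R, x ∈ octant → x ∉ Oct → fderiv ℝ (fderiv ℝ w) x = 0 := by
  intro p hp hpo hpn
  obtain ⟨i, hi⟩ : ∃ i, ¬ 0 < p i := by simpa [Oct] using hpn
  have hi0 : p i = 0 := le_antisymm (not_lt.1 hi) (hpo i)
  have hGd : DifferentiableAt ℝ (fderiv ℝ w) p :=
    ((hw p hp).fderiv_right (m := 1) (by norm_num)).differentiableAt (by norm_num)
  have hB : ∀ j l, pd j (pd l w) p = pd j (fderiv ℝ w) p (ee l) := by
    intro j l
    exact pd_clm (ContinuousLinearMap.apply ℝ ℂ (ee l)) hGd j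
  have hj : ∀ j, j ≠ i → pd j (fderiv ℝ w) p = 0 := by
    intro j hji
    have h1 := (hasLine hGd j).hasDerivWithinAt (s := Ici 0)
    have h2 : HasDerivWithinAt (fun t : ℝ => fderiv ℝ w (p + t • ee j)) 0 (Ici 0) 0 := by
      refine (hasDerivWithinAt_const (0:ℝ) (Ici 0) (0 : E3 →L[ℝ] ℂ)).congr_of_eventuallyEq ?_ ?_
      · have h3 := (line_tendsto p j).eventually (isOpen_ball.mem_nhds hp)
        filter_upwards [h3.filter_mono nhdsWithin_le_nhds, eventually_mem_nhdsWithin] with t ht ht0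
        refine (hG _ ht ?_ ?_).2
        · intro l
          have : 0 ≤ (ee j) l := by rw [ee_apply]; split_ifs <;> norm_num
          have := hpo l
          have ht0' : (0:ℝ) ≤ t := ht0
          simp only [PiLp.add_apply, PiLp.smul_apply, smul_eq_mul]
          positivity
        · intro hO
          have := hO i
          simp [ee, hi0, hji.symm] at this
      · simpa using (hG p hp hpo hpn).2
    exact (uniqueDiffWithinAt_Ici (0:ℝ)).eq_deriv _ h1 h2
  have hlap0 : lap w p = 0 := by
    have hc : ContinuousAt (lap w) p := by
      refine tendsto_finsetSum _ fun l _ => ?_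
      have h1 : ContDiffAt ℝ 1 (pd l w) p := contDiffAt_pd (hw p hp) (by norm_num)
      have h2 : ContDiffAt ℝ 0 (pd l (pd l w)) p := contDiffAt_pd h1 (by norm_num)
      exact h2.continuousAt
    have hcw : ContinuousAt w p := (hw p hp).continuousAt
    have hl := (line_tendsto p i).mono_left (nhdsWithin_le_nhds (s := Iio 0))
    have t1 := hc.tendsto.comp hl
    have t2 := ((hcw.tendsto.comp hl).const_smul (-(k^2)))
    rw [(hG p hp hpo hpn).1, smul_zero] at t2
    refine tendsto_nhds_unique t1 (t2.congr' ?_)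
    have h3 := (line_tendsto p i).eventually (isOpen_ball.mem_nhds hp)
    filter_upwards [h3.filter_mono nhdsWithin_le_nhds, eventually_mem_nhdsWithin] with t ht ht0
    refine (hlap _ ht ?_).symm
    intro hO
    have := hO i
    simp [ee, hi0] at this
    exact absurd ht0 (not_lt.2 this)
  have hii : pd i (pd i w) p = 0 := by
    rw [lap, Finset.sum_eq_single i] at hlap0
    · exact hlap0
    · intro j _ hji
      rw [hB, hj j hji]; rfl
    · simp
  refine fderiv_zero_of_basis fun j => ?_
  by_cases hji : j = i
  · subst hji
    ext y
    have : ∀ l, pd j (fderiv ℝ w) p (ee l) = 0 := by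
      intro l
      rw [← hB]
      by_cases hl : l = j
      · rw [hl, hii]
      · rw [pd_symm (hw p hp), hB, hj l hl]; rfl
    conv_lhs => rw [x_decomp y]
    rw [map_sum]
    simp [this]
  · exact hj j hji

theorem glue_outside {w : E3 → ℂ} {R k : ℝ} (hR : 0 < R) (hw : ∀ x ∈ ball (0:E3) R, ContDiffAt ℝ 2 w x)
    (hG : ∀ x ∈ ball (0:E3) R, x ∈ octant → x ∉ Oct → w x = 0 ∧ fderiv ℝ w x = 0)
    (hlap : ∀ x ∈ ball (0:E3) R, x ∉ octant → lap w x = -(k^2) • w x) :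
    ∀ x ∈ ball (0:E3) R, x ∉ Oct → w x = 0 := by
  have hH := gamma_hess hw hG hlap
  have hfr : ∀ x ∈ ball (0:E3) R, x ∈ frontier octant → w x = 0 ∧ fderiv ℝ w x = 0 ∧ fderiv ℝ (fderiv ℝ w) x = 0 := by
    intro x hx hf
    rw [frontier_octant] at hf
    exact ⟨(hG x hx hf.1 hf.2).1, (hG x hx hf.1 hf.2).2, hH x hx hf.1 hf.2⟩
  have hg := glue2 isOpen_ball isClosed_octant hw hfr
  -- Laplacian
  have hl : ∀ x ∈ ball (0:E3) R, ‖lap (octantᶜ.indicator w) x‖ ≤ k^2 * ‖octantᶜ.indicator w x‖ := by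
    intro x hx
    by_cases h1 : x ∈ octant
    · by_cases h2 : x ∈ Oct
      · have : lap (octantᶜ.indicator w) x = 0 := by
          rw [lap_congr (v := fun _ => (0:ℂ))]
          · rw [lap_zero]
          · filter_upwards [isOpen_Oct.mem_nhds h2] with y hy
            rw [indicator_of_notMem (by simpa using Oct_sub hy)]
        rw [this, norm_zero]; positivity
      · -- limit from outside
        obtain ⟨i, hi⟩ : ∃ i, ¬ 0 < x i := by simpa [Oct] using h2
        have hi0 : x i = 0 := le_antisymm (not_lt.1 hi) (h1 i)
        have hc : ContinuousAt (lap (octantᶜ.indicator w)) x := by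
          refine tendsto_finsetSum _ fun l _ => ?_
          have h1 : ContDiffAt ℝ 1 (pd l (octantᶜ.indicator w)) x := contDiffAt_pd (hg x hx) (by norm_num)
          have h2 : ContDiffAt ℝ 0 (pd l (pd l (octantᶜ.indicator w))) x := contDiffAt_pd h1 (by norm_num)
          exact h2.continuousAt
        have hl := (line_tendsto x i).mono_left (nhdsWithin_le_nhds (s := Iio 0))
        have t1 := (hc.tendsto.comp hl).norm
        have t2 := ((hg x hx).continuousAt.tendsto.comp hl).norm.const_mul (k^2)
        refine le_of_tendsto_of_tendsto t1 t2 ?_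
        have h3 := (line_tendsto x i).eventually (isOpen_ball.mem_nhds hx)
        filter_upwards [h3.filter_mono nhdsWithin_le_nhds, eventually_mem_nhdsWithin] with t ht ht0
        have hO : x + t • ee i ∈ octantᶜ := by
          intro hO
          have := hO i
          simp [ee, hi0] at this
          exact absurd ht0 (not_lt.2 this)
        simp only [Function.comp]
        rw [lap_congr (v := w), hlap _ ht hO, indicator_of_mem hO, norm_smul]
        · simp
        · filter_upwards [isClosed_octant.isOpen_compl.mem_nhds hO] with y hy
          rw [indicator_of_mem hy]
    · rw [lap_congr (v := w), hlap _ hx h1, indicator_of_mem h1, norm_smul]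
      · simp
      · filter_upwards [isClosed_octant.isOpen_compl.mem_nhds h1] with y hy
        rw [indicator_of_mem hy]
  -- base point
  have hbase : ((R/4) • (ee 0 + ee 1 + ee 2) : E3) ∈ ball (0:E3) R := by
    rw [mem_ball_zero_iff, norm_smul, Real.norm_of_nonneg (by positivity)]
    have h3 : ‖ee 0 + ee 1 + ee 2‖ ≤ 3 := by
      refine (norm_add₃_le).trans ?_
      simp [norm_ee]; norm_num
    nlinarith
  have hbO : ((R/4) • (ee 0 + ee 1 + ee 2) : E3) ∈ Oct := by
    intro i
    fin_cases i <;> simp [ee] <;> exact hR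
  have hz := ucp_ball hbase hg (by positivity) hl (flatAt_of_zero (by
    filter_upwards [isOpen_Oct.mem_nhds hbO] with y hy
    rw [indicator_of_notMem (by simpa using Oct_sub hy)]))
  intro x hx hxO
  by_cases h1 : x ∈ octant
  · exact (hG x hx h1 hxO).1
  · have := hz x hx
    rwa [indicator_of_mem h1] at this


theorem lap_off {u : E3 → ℂ} {R : ℝ} (hu : ∀ x ∈ ball (0:E3) R, ContDiffAt ℝ 2 u x)
    (h0 : ∀ x ∈ ball (0:E3) R, x ∉ Oct → u x = 0) : ∀ x ∈ ball (0:E3) R, x ∉ Oct → lap u x = 0 := by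
  intro x hx hxO
  obtain ⟨i, hi⟩ : ∃ i, ¬ 0 < x i := by simpa [Oct] using hxO
  have hc : ContinuousAt (lap u) x := by
    refine tendsto_finsetSum _ fun l _ => ?_
    have h1 : ContDiffAt ℝ 1 (pd l u) x := contDiffAt_pd (hu x hx) (by norm_num)
    have h2 : ContDiffAt ℝ 0 (pd l (pd l u)) x := contDiffAt_pd h1 (by norm_num)
    exact h2.continuousAt
  have hl := (line_tendsto x i).mono_left (nhdsWithin_le_nhds (s := Iio 0))
  refine tendsto_nhds_unique (hc.tendsto.comp hl) (tendsto_const_nhds.congr' ?_)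
  have h3 := (line_tendsto x i).eventually (isOpen_ball.mem_nhds hx)
  filter_upwards [h3.filter_mono nhdsWithin_le_nhds, eventually_mem_nhdsWithin] with t ht ht0
  have hO : x + t • ee i ∈ octantᶜ := by
    intro hO
    have h4 := hO i
    have h5 : t < 0 := ht0
    simp [ee] at h4
    linarith
  simp only [Function.comp]
  rw [lap_congr (v := fun _ => (0:ℂ)), lap_zero]
  filter_upwards [isClosed_octant.isOpen_compl.mem_nhds hO, isOpen_ball.mem_nhds ht] with y hy hyb
  exact h0 y hyb fun h => hy (Oct_sub h)

theorem Oct_smul {t : ℝ} (ht : 0 < t) (x : E3) : t • x ∈ Oct ↔ x ∈ Oct := by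
  simp [Oct, ht]

theorem scal_int {F : Type*} [NormedAddCommGroup F] [NormedSpace ℝ F] (G : E3 → F) {t : ℝ} (ht : 0 < t) :
    ∫ x, G x = t ^ 3 • ∫ y, G (t • y) := by
  rw [Measure.integral_comp_smul volume G t, finrank_euclideanSpace_fin, abs_of_pos (by positivity), smul_smul,
    mul_inv_cancel₀ (by positivity), one_smul]

theorem int_poly_exp_t (n : ℕ) (a : Fin 3 → ℝ) (ha : ∀ i, 0 < a i) {t : ℝ} (ht : 0 < t) :
    IntegrableOn (fun x : E3 => Real.exp (-((∑ i, a i * x i) / t)) * ‖x‖ ^ n) Oct := by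
  refine (int_poly_exp n (fun i => a i / t) (fun i => div_pos (ha i) ht)).congr (Filter.Eventually.of_forall fun x => ?_)
  beta_reduce
  rw [mul_comm, Finset.sum_div]
  congr 4
  funext i
  ring

theorem scal_poly (n : ℕ) (a : Fin 3 → ℝ) {t : ℝ} (ht : 0 < t) :
    ∫ x in Oct, Real.exp (-((∑ i, a i * x i) / t)) * ‖x‖ ^ n =
      t ^ (n+3) * ∫ x in Oct, Real.exp (-((∑ i, a i * x i))) * ‖x‖ ^ n := by
  rw [← integral_indicator isOpen_Oct.measurableSet, ← integral_indicator isOpen_Oct.measurableSet,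
    scal_int _ ht, smul_eq_mul, pow_add, mul_comm (t^n), mul_assoc]
  congr 1
  rw [← integral_const_mul]
  congr 1
  funext y
  by_cases hy : y ∈ Oct
  · rw [indicator_of_mem hy, indicator_of_mem ((Oct_smul ht y).2 hy), norm_smul, Real.norm_of_nonneg ht.le, mul_pow]
    have : (∑ i, a i * (t • y) i) / t = ∑ i, a i * y i := by
      rw [Finset.sum_div]
      refine Finset.sum_congr rfl fun i _ => ?_
      simp; field_simp
    rw [this]; ring
  · rw [indicator_of_notMem hy, indicator_of_notMem (fun h => hy ((Oct_smul ht y).1 h)), mul_zero]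

theorem carleman_bound {f : E3 → ℂ} (hf : ContDiff ℝ 2 f) {δ : ℝ} (hδ : 0 < δ) (hsupp : ∀ x, δ < ‖x‖ → f x = 0)
    (hoff : ∀ x, x ∉ Oct → f x = 0) {N : ℕ} {B C : ℝ} (hB : 0 ≤ B) (hC : 0 ≤ C)
    (hlap : ∀ x ∈ Oct, ‖lap f x‖ ≤ B * ‖f x‖ + C * ‖x‖ ^ N) (a : Fin 3 → ℝ) (ha : ∀ i, 0 < a i) :
    ∃ C' t0 : ℝ, 0 ≤ C' ∧ 0 < t0 ∧ ∀ t, 0 < t → t < t0 →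
      ∫ x, Real.exp (-((∑ i, a i * x i) / t)) * ‖f x‖ ^ 2 ≤ C' * t ^ (2 * N + 5) := by
  set α : ℝ := ∑ i, a i ^ 2 with hα
  have hαp : 0 < α := Finset.sum_pos (fun i _ => pow_pos (ha i) 2) ⟨0, Finset.mem_univ _⟩
  set I : ℝ := ∫ x in Oct, Real.exp (-((∑ i, a i * x i))) * ‖x‖ ^ (2 * N) with hI
  have hI0 : 0 ≤ I := integral_nonneg fun x => by positivity
  refine ⟨16 * δ^2 * C^2 * I / α, Real.sqrt (α / (16 * δ^2*B^2 + 1)), by positivity, by positivity, ?_⟩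
  intro t ht ht0
  have ht2 : t^2 * (16 * δ^2 * B^2) ≤ α := by
    have h1 : t^2 < α / (16 * δ^2*B^2 + 1) := by
      rwa [Real.lt_sqrt ht.le] at ht0
    rw [lt_div_iff₀ (by positivity)] at h1
    nlinarith [sq_nonneg t]
  have hcar := lin_carleman hf hδ hsupp (WithLp.toLp 2 (fun i => a i / (2 * t)))
  have e1 : ∀ x : E3, -(2 * ∑ j, (WithLp.toLp 2 (fun i => a i / (2 * t)) : E3) j * x j) = -((∑ i, a i * x i) / t) := by
    intro x
    rw [Finset.mul_sum, Finset.sum_div]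
    congr 1
    refine Finset.sum_congr rfl fun i _ => ?_
    simp; field_simp
  have e2 : ‖(WithLp.toLp 2 (fun i => a i / (2 * t)) : E3)‖ ^ 2 = α / (4 * t^2) := by
    rw [norm_sq_E3, hα, Fin.sum_univ_three]
    simp only []
    field_simp
    norm_num
    ring
  simp only [e1] at hcar
  rw [e2] at hcar
  set F := ∫ x, Real.exp (-((∑ i, a i * x i) / t)) * ‖f x‖ ^ 2 with hF
  have hcs : HasCompactSupport f := HasCompactSupport.of_support_subset_isCompact (isCompact_closedBall (0:E3) δ) (by
    intro x hx
    rw [mem_closedBall_zero_iff]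
    by_contra hcon
    exact hx (hsupp x (not_le.1 hcon)))
  have hFint : Integrable (fun x => Real.exp (-((∑ i, a i * x i) / t)) * ‖f x‖ ^ 2) := by
    apply Continuous.integrable_of_hasCompactSupport
    · have := hf.continuous
      fun_prop
    · refine hcs.mono ?_
      intro x hx hx2
      simp [hx2] at hx
  have hPint := int_poly_exp_t (2*N) a ha ht
  have hle : ∫ x, Real.exp (-((∑ i, a i * x i) / t)) * ‖lap f x‖ ^ 2 ≤ 2 * B^2 * F + 2 * C^2 * (t^(2*N+3) * I) := by
    rw [hI, ← scal_poly (2*N) a ht, hF, ← integral_indicator isOpen_Oct.measurableSet, ← integral_const_mul,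
      ← integral_const_mul, ← integral_add (hFint.const_mul _) (((integrable_indicator_iff isOpen_Oct.measurableSet).2 hPint).const_mul _)]
    refine integral_mono_of_nonneg (Filter.Eventually.of_forall fun x => by positivity)
      ((hFint.const_mul _).add (((integrable_indicator_iff isOpen_Oct.measurableSet).2 hPint).const_mul _))
      (Filter.Eventually.of_forall fun x => ?_)
    beta_reduce
    by_cases hx : x ∈ Oct
    · rw [indicator_of_mem hx]
      have h1 : ‖lap f x‖ ^ 2 ≤ 2 * B^2 * ‖f x‖^2 + 2 * C^2 * ‖x‖^(2*N) := by
        calc ‖lap f x‖ ^ 2 ≤ (B * ‖f x‖ + C * ‖x‖ ^ N)^2 := by gcongr; exact hlap x hx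
          _ ≤ 2 * B^2 * ‖f x‖^2 + 2 * C^2 * (‖x‖^N)^2 := by nlinarith [sq_nonneg (B * ‖f x‖ - C * ‖x‖ ^ N)]
          _ = _ := by rw [← pow_mul, mul_comm N 2]
      have h2 := mul_le_mul_of_nonneg_left h1 (Real.exp_nonneg (-((∑ i, a i * x i) / t)))
      linarith
    · have h3 := lap_off (R := ‖x‖+1) (fun x _ => hf.contDiffAt) (fun y _ h => hoff y h) x (by simp) hx
      rw [indicator_of_notMem hx, h3, hoff x hx]
      simp
  have hF0 : 0 ≤ F := integral_nonneg fun x => by positivity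
  have h1 : α / (4 * t^2) * F ≤ δ^2 * (2 * B^2 * F + 2 * C^2 * (t^(2*N+3) * I)) :=
    hcar.trans (mul_le_mul_of_nonneg_left hle (by positivity))
  have h2 : α * F ≤ 4 * t^2 * (δ^2 * (2 * B^2 * F + 2 * C^2 * (t^(2*N+3) * I))) := by
    rw [div_mul_eq_mul_div, div_le_iff₀ (by positivity)] at h1
    linarith
  have h3 : t^2 * (16 * δ^2 * B^2) * F ≤ α * F := mul_le_mul_of_nonneg_right ht2 hF0
  rw [div_mul_eq_mul_div, le_div_iff₀ hαp, show 2 * N + 5 = (2*N+3) + 2 by ring, pow_add t (2*N+3)]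
  nlinarith

theorem l1_bound {f : E3 → ℂ} (hf : ContDiff ℝ 2 f) {δ : ℝ} (hδ : 0 < δ) (hsupp : ∀ x, δ < ‖x‖ → f x = 0)
    (hoff : ∀ x, x ∉ Oct → f x = 0) {N : ℕ} {B C : ℝ} (hB : 0 ≤ B) (hC : 0 ≤ C)
    (hlap : ∀ x ∈ Oct, ‖lap f x‖ ≤ B * ‖f x‖ + C * ‖x‖ ^ N) (a : Fin 3 → ℝ) (ha : ∀ i, 0 < a i) :
    ∃ C' t0 : ℝ, 0 ≤ C' ∧ 0 < t0 ∧ ∀ t, 0 < t → t < t0 →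
      ∫ x, Real.exp (-((∑ i, a i * x i) / t)) * ‖f x‖ ≤ C' * t ^ (N + 4) := by
  obtain ⟨C1, t0, hC1, ht0, h⟩ := carleman_bound hf hδ hsupp hoff hB hC hlap a ha
  set I : ℝ := ∫ x in Oct, Real.exp (-((∑ i, a i * x i))) * ‖x‖ ^ 0 with hI
  have hI0 : 0 ≤ I := integral_nonneg fun x => by positivity
  refine ⟨I + C1, t0, by positivity, ht0, fun t ht htt => ?_⟩
  have hcs : HasCompactSupport f := HasCompactSupport.of_support_subset_isCompact (isCompact_closedBall (0:E3) δ) (by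
    intro x hx
    rw [mem_closedBall_zero_iff]
    by_contra hcon
    exact hx (hsupp x (not_le.1 hcon)))
  have hFint : Integrable (fun x => Real.exp (-((∑ i, a i * x i) / t)) * ‖f x‖ ^ 2) := by
    apply Continuous.integrable_of_hasCompactSupport
    · have := hf.continuous
      fun_prop
    · refine hcs.mono ?_
      intro x hx hx2
      simp [hx2] at hx
  have hPint := (integrable_indicator_iff isOpen_Oct.measurableSet).2 (int_poly_exp_t 0 a ha ht)
  have h1 : ∫ x, Real.exp (-((∑ i, a i * x i) / t)) * ‖f x‖ ≤
      t^(N+1) * (t^(0+3) * I) + (t^(N+1))⁻¹ * ∫ x, Real.exp (-((∑ i, a i * x i) / t)) * ‖f x‖ ^ 2 := by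
    rw [hI, ← scal_poly 0 a ht, ← integral_indicator isOpen_Oct.measurableSet, ← integral_const_mul,
      ← integral_const_mul, ← integral_add (hPint.const_mul _) (hFint.const_mul _)]
    refine integral_mono_of_nonneg (Filter.Eventually.of_forall fun x => by positivity)
      ((hPint.const_mul _).add (hFint.const_mul _)) (Filter.Eventually.of_forall fun x => ?_)
    beta_reduce
    by_cases hx : x ∈ Oct
    · rw [indicator_of_mem hx]
      have hT : 0 < t^(N+1) := by positivity
      have h2 : ‖f x‖ ≤ t^(N+1) + (t^(N+1))⁻¹ * ‖f x‖^2 := by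
        rw [← sub_nonneg]
        have : t^(N+1) + (t^(N+1))⁻¹ * ‖f x‖^2 - ‖f x‖ = (t^(N+1))⁻¹ * ((t^(N+1) - ‖f x‖)^2 + t^(N+1) * ‖f x‖) := by
          field_simp; ring
        rw [this]; positivity
      have h3 := mul_le_mul_of_nonneg_left h2 (Real.exp_nonneg (-((∑ i, a i * x i) / t)))
      rw [pow_zero]
      linarith
    · rw [indicator_of_notMem hx, hoff x hx]; simp
  refine h1.trans ?_
  have h4 : (t^(N+1))⁻¹ * ∫ x, Real.exp (-((∑ i, a i * x i) / t)) * ‖f x‖ ^ 2 ≤ (t^(N+1))⁻¹ * (C1 * t ^ (2 * N + 5)) :=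
    mul_le_mul_of_nonneg_left (h t ht htt) (by positivity)
  have h5 : (t^(N+1))⁻¹ * (C1 * t ^ (2 * N + 5)) = C1 * t^(N+4) := by
    rw [show 2 * N + 5 = (N+1) + (N+4) by ring, pow_add t (N+1)]
    field_simp
  rw [h5] at h4
  have h6 : t^(N+1) * (t^(0+3) * I) = I * t^(N+4) := by ring
  rw [h6]
  linarith


theorem pd_mulC {u v : E3 → ℂ} {x : E3} (hu : DifferentiableAt ℝ u x) (hv : DifferentiableAt ℝ v x) (i : Fin 3) :
    pd i (fun y => u y * v y) x = u x * pd i v x + pd i u x * v x := by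
  unfold pd
  rw [fderiv_fun_mul hu hv]
  simp; ring

theorem pd_cexp (c : Fin 3 → ℂ) (x : E3) (i : Fin 3) :
    pd i (fun y : E3 => Complex.exp (-∑ j, c j * y j)) x = -c i * Complex.exp (-∑ j, c j * x j) := by
  refine pd_eq_of_hasLine (by fun_prop) ?_
  have e : ∀ t : ℝ, Complex.exp (-∑ j, c j * ((x + t • ee i) j : ℝ)) =
      Complex.exp (-∑ j, c j * x j) * Complex.exp (-c i * t) := by
    intro t
    rw [← Complex.exp_add]
    congr 1
    have : ∑ j, c j * (((x + t • ee i) j : ℝ) : ℂ) = ∑ j, c j * x j + c i * t := by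
      rw [← Finset.sum_erase_add _ _ (Finset.mem_univ i), ← Finset.sum_erase_add (a := i) _ (fun j => c j * (x j : ℂ)) (Finset.mem_univ i)]
      rw [add_assoc]
      congr 1
      · refine Finset.sum_congr rfl fun j hj => ?_
        have hne : j ≠ i := Finset.ne_of_mem_erase hj
        simp [ee, hne]
      · simp [ee]; ring
    rw [this]; ring
  simp only [e]
  have h1 : HasDerivAt (fun z : ℂ => Complex.exp (-∑ j, c j * x j) * Complex.exp (-c i * z))
      (-c i * Complex.exp (-∑ j, c j * x j)) ((0:ℝ) : ℂ) := by
    have h2 := (((hasDerivAt_id ((0:ℝ):ℂ)).const_mul (-c i)).cexp).const_mul (Complex.exp (-∑ j, c j * x j))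
    refine h2.congr_deriv ?_
    simp; ring
  exact h1.comp_ofReal

theorem green {f : E3 → ℂ} (hf : ContDiff ℝ 2 f) (hcs : HasCompactSupport f) (c : Fin 3 → ℂ) (hc : ∑ i, c i ^ 2 = 0) :
    Integrable (fun x => Complex.exp (-∑ j, c j * x j) * lap f x) ∧ ∫ x, Complex.exp (-∑ j, c j * x j) * lap f x = 0 := by
  have hg : ContDiff ℝ (⊤:ℕ∞) (fun x : E3 => Complex.exp (-∑ j, c j * x j)) := by
    apply ContDiff.cexp
    apply ContDiff.neg
    refine ContDiff.sum fun j _ => contDiff_const.mul ?_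
    exact Complex.ofRealCLM.contDiff.comp (EuclideanSpace.proj j : E3 →L[ℝ] ℝ).contDiff
  have hpdf : ∀ i, ContDiff ℝ 1 (pd i f) := fun i => contDiff_pd' hf (by norm_num)
  have hg1 : ContDiff ℝ 1 (fun x : E3 => Complex.exp (-∑ j, c j * x j)) := hg.of_le (WithTop.coe_le_coe.2 le_top)
  have hf1 : ContDiff ℝ 1 f := hf.of_le (by norm_num)
  set V : Fin 3 → E3 → ℂ := fun i x => Complex.exp (-∑ j, c j * x j) * (pd i f x + c i * f x) with hV
  have hVd : ∀ i, ContDiff ℝ 1 (V i) := fun i => hg1.mul ((hpdf i).add (contDiff_const.mul hf1))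
  have hVc : ∀ i, HasCompactSupport (V i) := by
    intro i
    have h1 : HasCompactSupport (pd i f) := by
      refine (hcs.fderiv (𝕜 := ℝ)).mono ?_
      intro x hx hx2
      exact hx (by simp [pd, hx2])
    have h2 : HasCompactSupport (fun x => pd i f x + c i * f x) := h1.add (hcs.mul_left)
    exact h2.mul_left
  have key : ∀ x, ∑ i, pd i (V i) x = Complex.exp (-∑ j, c j * x j) * lap f x := by
    intro x
    have : ∀ i, pd i (V i) x = Complex.exp (-∑ j, c j * x j) * (pd i (pd i f) x) - c i ^ 2 * (Complex.exp (-∑ j, c j * x j) * f x) := by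
      intro i
      have d1 : DifferentiableAt ℝ (pd i f) x := (hpdf i).differentiable (by norm_num) x
      have d2 : DifferentiableAt ℝ f x := hf1.differentiable (by norm_num) x
      have d3 := hg1.differentiable (by norm_num) x
      have e1 : pd i (fun y => pd i f y + c i * f y) x = pd i (pd i f) x + c i * pd i f x := by
        rw [pd_add d1 (d2.const_mul _)]
        congr 1
        rw [pd_mulC (u := fun _ => c i) (by fun_prop) d2]
        simp [pd]
      simp only [hV]
      rw [pd_mulC (v := fun y => pd i f y + c i * f y) d3 (d1.add (d2.const_mul _)), pd_cexp, e1]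
      ring
    rw [Finset.sum_congr rfl fun i _ => this i, Finset.sum_sub_distrib, ← Finset.sum_mul, hc, lap, Finset.mul_sum]
    simp
  have hI := fun i => ibpC i (hVd i) (hVc i)
  simp_rw [← key]
  refine ⟨integrable_finsetSum _ fun i _ => (hI i).1, ?_⟩
  rw [integral_finsetSum _ fun i _ => (hI i).1]
  simp [(hI _).2]

theorem norm_cexp_sum (ρ : Fin 3 → ℂ) (t : ℝ) (x : E3) :
    ‖Complex.exp (-((∑ i, ρ i * x i) / t))‖ = Real.exp (-((∑ i, (ρ i).re * x i) / t)) := by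
  rw [Complex.norm_exp]
  congr 1
  rw [Complex.neg_re, Complex.div_ofReal_re, Complex.re_sum]
  simp

theorem lemH {f : E3 → ℂ} (hf : ContDiff ℝ 2 f) {δ : ℝ} (hδ : 0 < δ) (hsupp : ∀ x, δ < ‖x‖ → f x = 0)
    (hoff : ∀ x, x ∉ Oct → f x = 0) {N : ℕ} {B C C2 : ℝ} (hB : 0 ≤ B) (hC : 0 ≤ C) (hC2 : 0 ≤ C2)
    (hlap : ∀ x ∈ Oct, ‖lap f x‖ ≤ B * ‖f x‖ + C * ‖x‖ ^ N)
    {P : E3 → ℂ} (hPm : Measurable P) (hPoff : ∀ x, x ∉ Oct → P x = 0)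
    (hP : ∀ x ∈ Oct, ‖P x - lap f x‖ ≤ B * ‖f x‖ + C2 * ‖x‖ ^ (N+1))
    (ρ : Fin 3 → ℂ) (hρ : ∀ i, 0 < (ρ i).re) (hρ2 : ∑ i, ρ i ^ 2 = 0) :
    ∃ C' t0 : ℝ, 0 ≤ C' ∧ 0 < t0 ∧ ∀ t, 0 < t → t < t0 →
      ‖∫ x, Complex.exp (-((∑ i, ρ i * x i) / t)) * P x‖ ≤ C' * t ^ (N + 4) := by
  obtain ⟨C1, t0, hC1, ht0, h⟩ := l1_bound hf hδ hsupp hoff hB hC hlap (fun i => (ρ i).re) hρ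
  set I : ℝ := ∫ x in Oct, Real.exp (-((∑ i, (ρ i).re * x i))) * ‖x‖ ^ (N+1) with hI
  have hI0 : 0 ≤ I := integral_nonneg fun x => by positivity
  refine ⟨B * C1 + C2 * I, t0, by positivity, ht0, fun t ht htt => ?_⟩
  have hcs : HasCompactSupport f := HasCompactSupport.of_support_subset_isCompact (isCompact_closedBall (0:E3) δ) (by
    intro x hx
    rw [mem_closedBall_zero_iff]
    by_contra hcon
    exact hx (hsupp x (not_le.1 hcon)))
  have hfint : Integrable (fun x => Real.exp (-((∑ i, (ρ i).re * x i) / t)) * ‖f x‖) := by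
    apply Continuous.integrable_of_hasCompactSupport
    · have := hf.continuous
      fun_prop
    · refine hcs.mono ?_
      intro x hx hx2
      simp [hx2] at hx
  have hPint := (integrable_indicator_iff isOpen_Oct.measurableSet).2 (int_poly_exp_t (N+1) (fun i => (ρ i).re) hρ ht)
  have hgr := green hf hcs (fun i => ρ i / t) (by
    simp only [div_pow]
    rw [← Finset.sum_div, hρ2, zero_div])
  have ee : ∀ x : E3, -∑ j, ρ j / (t:ℂ) * x j = -((∑ i, ρ i * x i) / t) := by
    intro x
    rw [Finset.sum_div]
    congr 1
    refine Finset.sum_congr rfl fun i _ => ?_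
    ring
  simp only [ee] at hgr
  have hbd : ∀ x, ‖Complex.exp (-((∑ i, ρ i * x i) / t)) * (P x - lap f x)‖ ≤
      B * (Real.exp (-((∑ i, (ρ i).re * x i) / t)) * ‖f x‖) +
      C2 * Oct.indicator (fun x : E3 => Real.exp (-((∑ i, (ρ i).re * x i) / t)) * ‖x‖ ^ (N+1)) x := by
    intro x
    rw [norm_mul, norm_cexp_sum]
    by_cases hx : x ∈ Oct
    · rw [indicator_of_mem hx]
      have := mul_le_mul_of_nonneg_left (hP x hx) (Real.exp_nonneg (-((∑ i, (ρ i).re * x i) / t)))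
      linarith
    · have h3 := lap_off (R := ‖x‖+1) (fun x _ => hf.contDiffAt) (fun y _ h => hoff y h) x (by simp) hx
      rw [indicator_of_notMem hx, h3, hPoff x hx, hoff x hx]
      simp
  have hbint := (hfint.const_mul B).add (hPint.const_mul C2)
  have hdint : Integrable (fun x => Complex.exp (-((∑ i, ρ i * x i) / t)) * (P x - lap f x)) := by
    refine Integrable.mono' hbint ?_ (Filter.Eventually.of_forall hbd)
    have h1 : Continuous fun x : E3 => Complex.exp (-((∑ i, ρ i * x i) / t)) := by fun_prop
    exact (h1.measurable.mul (hPm.sub (continuous_lap hf).measurable)).aestronglyMeasurable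
  have hsum : ∫ x, Complex.exp (-((∑ i, ρ i * x i) / t)) * P x =
      ∫ x, Complex.exp (-((∑ i, ρ i * x i) / t)) * (P x - lap f x) := by
    have h1 : (fun x : E3 => Complex.exp (-((∑ i, ρ i * x i) / t)) * P x) = fun x =>
      Complex.exp (-((∑ i, ρ i * x i) / t)) * (P x - lap f x) + Complex.exp (-((∑ i, ρ i * x i) / t)) * lap f x := by
      funext x; ring
    rw [h1, integral_add hdint hgr.1, hgr.2, add_zero]
  rw [hsum]
  refine (norm_integral_le_of_norm_le hbint (Filter.Eventually.of_forall hbd)).trans ?_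
  simp only [Pi.add_apply]
  rw [integral_add (hfint.const_mul B) (hPint.const_mul C2), integral_const_mul, integral_const_mul,
    integral_indicator isOpen_Oct.measurableSet, scal_poly _ _ ht, ← hI]
  have h1 := mul_le_mul_of_nonneg_left (h t ht htt) hB
  have h2 : C2 * (t^(N+1+3) * I) = C2 * I * t^(N+4) := by ring
  rw [h2]
  linarith

theorem lemI {N : ℕ} {C : ℝ} {P L : E3 → ℂ} (hPm : Measurable P) (hPoff : ∀ x, x ∉ Oct → P x = 0)
    (hP : ∀ x, ‖P x‖ ≤ C * ‖x‖ ^ N)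
    (hlim : ∀ x ∈ Oct, Filter.Tendsto (fun t : ℝ => (t^N)⁻¹ • P (t • x)) (nhdsWithin 0 (Ioi 0)) (nhds (L x)))
    (ρ : Fin 3 → ℂ) (hρ : ∀ i, 0 < (ρ i).re) :
    Filter.Tendsto (fun t : ℝ => (t^(N+3))⁻¹ • ∫ x, Complex.exp (-((∑ i, ρ i * x i) / t)) * P x)
      (nhdsWithin 0 (Ioi 0)) (nhds (∫ x in Oct, L x * Complex.exp (-∑ i, ρ i * x i))) := by
  have e : ∀ t : ℝ, 0 < t → (t^(N+3))⁻¹ • ∫ x, Complex.exp (-((∑ i, ρ i * x i) / t)) * P x =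
      ∫ x in Oct, ((t^N)⁻¹ • P (t • x)) * Complex.exp (-∑ i, ρ i * x i) := by
    intro t ht
    rw [scal_int _ ht, smul_smul, ← integral_indicator isOpen_Oct.measurableSet, ← integral_smul]
    congr 1
    funext y
    have htc : (t:ℂ) ≠ 0 := by exact_mod_cast ht.ne'
    by_cases hy : y ∈ Oct
    · rw [indicator_of_mem hy]
      have h1 : (∑ i, ρ i * ((t • y) i : ℝ)) / (t:ℂ) = ∑ i, ρ i * y i := by
        rw [Finset.sum_div]
        refine Finset.sum_congr rfl fun i _ => ?_
        simp; field_simp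
      have h2 : (t^(N+3))⁻¹ * t^3 = (t^N)⁻¹ := by rw [pow_add]; field_simp
      rw [h1, h2]
      simp only [Complex.real_smul]; ring
    · rw [indicator_of_notMem hy, hPoff _ (fun h => hy ((Oct_smul ht y).1 h))]
      simp
  have hint := ((int_poly_exp N (fun i => (ρ i).re) hρ).const_mul C)
  have hD : Filter.Tendsto (fun t : ℝ => ∫ x in Oct, ((t^N)⁻¹ • P (t • x)) * Complex.exp (-∑ i, ρ i * x i))
      (nhdsWithin 0 (Ioi 0)) (nhds (∫ x in Oct, L x * Complex.exp (-∑ i, ρ i * x i))) := by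
    refine tendsto_integral_filter_of_dominated_convergence _ ?_ ?_ hint ?_
    · refine Filter.Eventually.of_forall fun t => Measurable.aestronglyMeasurable ?_
      have h1 : Continuous fun x : E3 => Complex.exp (-∑ i, ρ i * x i) := by fun_prop
      have h2 : Measurable fun x : E3 => P (t • x) :=
        hPm.comp (continuous_const_smul t).measurable
      have h3 : Measurable fun x : E3 => (t^N)⁻¹ • P (t • x) := h2.const_smul (t^N)⁻¹
      exact h3.mul h1.measurable
    · filter_upwards [eventually_mem_nhdsWithin] with t ht
      have ht' : 0 < t := ht
      refine Filter.Eventually.of_forall fun x => ?_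
      have h1 := norm_cexp_sum ρ 1 x
      simp only [Complex.ofReal_one, div_one] at h1
      rw [norm_mul, h1, norm_smul, ← mul_assoc]
      refine mul_le_mul_of_nonneg_right ?_ (Real.exp_nonneg _)
      have h2 := hP (t • x)
      rw [norm_smul, Real.norm_of_nonneg ht'.le, mul_pow] at h2
      rw [norm_inv, norm_pow, Real.norm_of_nonneg ht'.le, inv_mul_le_iff₀ (by positivity)]
      linarith
    · filter_upwards [ae_restrict_mem isOpen_Oct.measurableSet] with x hx
      exact (hlim x hx).mul_const _
  refine hD.congr' ?_
  filter_upwards [eventually_mem_nhdsWithin] with t ht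
  exact (e t ht).symm

theorem lemHI {f : E3 → ℂ} (hf : ContDiff ℝ 2 f) {δ : ℝ} (hδ : 0 < δ) (hsupp : ∀ x, δ < ‖x‖ → f x = 0)
    (hoff : ∀ x, x ∉ Oct → f x = 0) {N : ℕ} {B C C2 : ℝ} (hB : 0 ≤ B) (hC : 0 ≤ C) (hC2 : 0 ≤ C2)
    (hlap : ∀ x ∈ Oct, ‖lap f x‖ ≤ B * ‖f x‖ + C * ‖x‖ ^ N)
    {P L : E3 → ℂ} (hPm : Measurable P) (hPoff : ∀ x, x ∉ Oct → P x = 0)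
    (hP : ∀ x ∈ Oct, ‖P x - lap f x‖ ≤ B * ‖f x‖ + C2 * ‖x‖ ^ (N+1))
    (hPC : ∀ x, ‖P x‖ ≤ C * ‖x‖ ^ N)
    (hlim : ∀ x ∈ Oct, Filter.Tendsto (fun t : ℝ => (t^N)⁻¹ • P (t • x)) (nhdsWithin 0 (Ioi 0)) (nhds (L x)))
    (ρ : Fin 3 → ℂ) (hρ : ∀ i, 0 < (ρ i).re) (hρ2 : ∑ i, ρ i ^ 2 = 0) :
    ∫ x in Oct, L x * Complex.exp (-∑ i, ρ i * x i) = 0 := by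
  obtain ⟨C', t0, hC', ht0, h⟩ := lemH hf hδ hsupp hoff hB hC hC2 hlap hPm hPoff hP ρ hρ hρ2
  refine tendsto_nhds_unique (lemI hPm hPoff hPC hlim ρ hρ) ?_
  rw [tendsto_zero_iff_norm_tendsto_zero]
  have hz : Filter.Tendsto (fun t : ℝ => C' * t) (nhdsWithin 0 (Ioi 0)) (nhds 0) := by
    have : Continuous fun t : ℝ => C' * t := by fun_prop
    simpa using (this.tendsto 0).mono_left (nhdsWithin_le_nhds (s := Ioi 0))
  refine squeeze_zero' (Filter.Eventually.of_forall fun _ => norm_nonneg _) ?_ hz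
  filter_upwards [Ioo_mem_nhdsGT ht0] with t ht
  have ht' := ht.1
  rw [norm_smul, norm_inv, norm_pow, Real.norm_of_nonneg ht.1.le, inv_mul_le_iff₀ (by positivity)]
  refine (h t ht.1 ht.2).trans (le_of_eq ?_)
  ring


theorem cutE {w : E3 → ℂ} {R δ : ℝ} (hw : ∀ x ∈ ball (0:E3) R, ContDiffAt ℝ 2 w x) (hδ : 0 < δ) (hδR : δ ≤ R)
    (m : ℕ) : ∃ K : ℝ, 0 ≤ K ∧ ∀ x : E3, ‖lap (fun y => chi δ y • w y) x - chi δ x • lap w x‖ ≤ K * ‖x‖ ^ m := by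
  have hb : ∀ x : E3, ‖x‖ < δ → x ∈ ball (0:E3) R := fun x hx => by
    rw [mem_ball_zero_iff]; linarith
  have hf : ContDiff ℝ 2 (fun y => chi δ y • w y) := by
    have := chi_smul_contDiff (n := 2) hδ (u := w) fun x hx => hw x (hb x hx)
    exact this
  have hlw : Continuous (fun x => chi δ x • lap w x) := by
    have := chi_smul_contDiff (n := 0) hδ (u := lap w) fun x hx => by
      unfold lap
      refine ContDiffAt.sum fun i _ => ?_
      have h1 : ContDiffAt ℝ 1 (pd i w) x := contDiffAt_pd (hw x (hb x hx)) (by norm_num)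
      exact contDiffAt_pd h1 (by norm_num)
    exact this.continuous
  set Ef : E3 → ℂ := fun x => lap (fun y => chi δ y • w y) x - chi δ x • lap w x with hEf
  have hEc : Continuous Ef := (continuous_lap hf).sub hlw
  obtain ⟨K, hK⟩ := (isCompact_closedBall (0:E3) δ).exists_bound_of_continuousOn hEc.continuousOn
  have hK0 : 0 ≤ K := (norm_nonneg _).trans (hK 0 (by simp [hδ.le]))
  refine ⟨K * (2 / δ) ^ m, by positivity, fun x => ?_⟩
  change ‖Ef x‖ ≤ _
  by_cases h1 : ‖x‖ < δ / 2
  · have h2 : (fun y => chi δ y • w y) =ᶠ[nhds x] w := by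
      have : ∀ᶠ y in nhds x, ‖y‖ < δ / 2 := (continuous_norm.tendsto x).eventually (gt_mem_nhds h1)
      filter_upwards [this] with y hy
      rw [chi_one hδ hy.le, one_smul]
    have : Ef x = 0 := by
      simp only [hEf]
      rw [lap_congr h2, chi_one hδ h1.le, one_smul, sub_self]
    rw [this, norm_zero]; positivity
  by_cases h3 : ‖x‖ ≤ δ
  · have h4 := hK x (by simpa using h3)
    push Not at h1
    have h5 : 1 ≤ 2 / δ * ‖x‖ := by
      rw [div_mul_eq_mul_div, le_div_iff₀ hδ]; linarith
    calc ‖Ef x‖ ≤ K * 1 := by simpa using h4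
      _ ≤ K * (2 / δ * ‖x‖) ^ m := by gcongr; exact one_le_pow₀ h5
      _ = _ := by rw [mul_pow]; ring
  · push Not at h3
    have h2 : (fun y => chi δ y • w y) =ᶠ[nhds x] fun _ => 0 := by
      have : ∀ᶠ y in nhds x, δ < ‖y‖ := (continuous_norm.tendsto x).eventually (lt_mem_nhds h3)
      filter_upwards [this] with y hy
      rw [chi_zero hδ (by linarith), zero_smul]
    have : Ef x = 0 := by
      simp only [hEf]
      rw [lap_congr h2, chi_zero hδ (by linarith), zero_smul, sub_zero, lap_zero]
    rw [this, norm_zero]; positivity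

theorem vanish_step {k R M : ℝ} (hk : 0 < k) (hR : 0 < R) {v w q : E3 → ℂ} (hv : Sm R v)
    (hlapv : ∀ x ∈ ball (0:E3) R, lap v x = -(k ^ 2) • v x)
    (hw : ∀ x ∈ ball (0:E3) R, ContDiffAt ℝ 2 w x)
    (hw0 : ∀ x ∈ ball (0:E3) R, x ∉ Oct → w x = 0)
    (hwlap : ∀ x ∈ ball (0:E3) R, x ∈ Oct → lap w x = (k:ℂ)^2 * (q x - 1) * v x - (k:ℂ)^2 * q x * w x)
    (hqm : Measurable q) (hqM : ∀ x, ‖q x‖ ≤ M)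
    (hqlim : ∀ x ∈ Oct, Filter.Tendsto (fun t : ℝ => q (t • x)) (nhdsWithin 0 (Ioi 0)) (nhds (q 0)))
    (hq0 : q 0 ≠ 1) (N : ℕ) (hN : ∀ l : List (Fin 3), l.length < N → DD l v 0 = 0) :
    ∀ l : List (Fin 3), l.length = N → DD l v 0 = 0 := by
  have h0R : (0:E3) ∈ ball (0:E3) R := by simpa using hR
  have hM : 0 ≤ M := (norm_nonneg _).trans (hqM 0)
  obtain ⟨Cg, r, hCg, hr, hg⟩ := growth hR N v hv hN
  set δ : ℝ := min r R with hδd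
  have hδ : 0 < δ := lt_min hr hR
  have hδR : δ ≤ R := min_le_right _ _
  have hδr : δ ≤ r := min_le_left _ _
  have hb : ∀ x : E3, ‖x‖ < δ → x ∈ ball (0:E3) R := fun x hx => by
    rw [mem_ball_zero_iff]; linarith
  set f : E3 → ℂ := fun y => chi δ y • w y with hfd
  have hf : ContDiff ℝ 2 f := by
    have := chi_smul_contDiff (n := 2) hδ (u := w) fun x hx => hw x (hb x hx)
    exact this
  have hcv : Continuous (fun x => chi δ x • v x) := by
    have := chi_smul_contDiff (n := 0) hδ (u := v) fun x hx => ((hv x (hb x hx)).of_le (by simp))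
    exact this.continuous
  have hsupp : ∀ x, δ < ‖x‖ → f x = 0 := fun x hx => by
    simp only [hfd]; rw [chi_zero hδ (by linarith), zero_smul]
  have hoff : ∀ x, x ∉ Oct → f x = 0 := fun x hx => by
    simp only [hfd]
    by_cases h : ‖x‖ < δ
    · rw [hw0 x (hb x h) hx, smul_zero]
    · rw [chi_zero hδ (by linarith), zero_smul]
  obtain ⟨K1, hK1, hE1⟩ := cutE hw hδ hδR N
  obtain ⟨K2, hK2, hE2⟩ := cutE hw hδ hδR (N+1)
  set P : E3 → ℂ := Oct.indicator (fun x => (k:ℂ)^2 * (q x - 1) * (chi δ x • v x)) with hPd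
  have hPm : Measurable P :=
    ((measurable_const.mul (hqm.sub measurable_const)).mul hcv.measurable).indicator isOpen_Oct.measurableSet
  have hPoff : ∀ x, x ∉ Oct → P x = 0 := fun x hx => indicator_of_notMem hx _
  have hPin : ∀ x ∈ Oct, P x = (k:ℂ)^2 * (q x - 1) * (chi δ x • v x) := fun x hx => indicator_of_mem hx _
  have hPC0 : ∀ x, ‖P x‖ ≤ (k^2 * (M + 1) * Cg) * ‖x‖ ^ N := by
    intro x
    by_cases hx : x ∈ Oct
    · rw [hPin x hx]
      by_cases h : ‖x‖ < δ
      · rw [norm_mul, norm_mul, norm_smul, norm_pow, Complex.norm_real, Real.norm_of_nonneg hk.le,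
          Real.norm_of_nonneg (chi_nonneg _ _)]
        have h1 : ‖q x - 1‖ ≤ M + 1 := by
          refine (norm_sub_le _ _).trans ?_
          rw [norm_one]; linarith [hqM x]
        have h2 := hg x (by linarith)
        calc k^2 * ‖q x - 1‖ * (chi δ x * ‖v x‖) ≤ k^2 * (M+1) * (1 * (Cg * ‖x‖^N)) := by
              have h3 := chi_nonneg δ x
              have h4 := chi_le δ x
              gcongr
          _ = _ := by ring
      · rw [chi_zero hδ (by linarith), zero_smul, mul_zero, norm_zero]; positivity
    · rw [hPoff x hx, norm_zero]; positivity
  have hkey : ∀ x ∈ Oct, P x - lap f x = (k:ℂ)^2 * q x * f x - (lap f x - chi δ x • lap w x) := by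
    intro x hx
    rw [hPin x hx]
    simp only [hfd]
    by_cases h : ‖x‖ < δ
    · rw [hwlap x (hb x h) hx]
      simp only [Complex.real_smul]; ring
    · rw [chi_zero hδ (by linarith)]; simp
  have hqf : ∀ x, ‖(k:ℂ)^2 * q x * f x‖ ≤ k^2 * M * ‖f x‖ := by
    intro x
    rw [norm_mul, norm_mul, norm_pow, Complex.norm_real, Real.norm_of_nonneg hk.le]
    gcongr
    exact hqM x
  set C : ℝ := k^2 * (M + 1) * Cg + K1 with hCd
  have hC : 0 ≤ C := by positivity
  have hlap : ∀ x ∈ Oct, ‖lap f x‖ ≤ k^2 * M * ‖f x‖ + C * ‖x‖ ^ N := by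
    intro x hx
    have h1 : lap f x = P x - (k:ℂ)^2 * q x * f x + (lap f x - chi δ x • lap w x) := by
      linear_combination -(hkey x hx)
    rw [h1]
    refine (norm_add_le _ _).trans ?_
    have h2 := norm_sub_le (P x) ((k:ℂ)^2 * q x * f x)
    have h3 := hqf x
    have h4 := hPC0 x
    have h5 := hE1 x
    rw [hCd, add_mul]
    linarith
  have hP : ∀ x ∈ Oct, ‖P x - lap f x‖ ≤ k^2 * M * ‖f x‖ + K2 * ‖x‖ ^ (N+1) := by
    intro x hx
    rw [hkey x hx]
    refine (norm_sub_le _ _).trans ?_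
    exact add_le_add (hqf x) (hE2 x)
  have hPC : ∀ x, ‖P x‖ ≤ C * ‖x‖ ^ N := fun x => by
    refine (hPC0 x).trans ?_
    gcongr
    rw [hCd]; linarith
  have hlim : ∀ x ∈ Oct, Filter.Tendsto (fun t : ℝ => (t^N)⁻¹ • P (t • x)) (nhdsWithin 0 (Ioi 0))
      (nhds ((k:ℂ)^2 * (q 0 - 1) * TT N v x)) := by
    intro x hx
    have h1 := (((hqlim x hx).sub_const 1).const_mul ((k:ℂ)^2)).mul (taylor_lim hR N v hv hN x)
    refine h1.congr' ?_
    have h2 : ∀ᶠ t : ℝ in nhdsWithin 0 (Ioi 0), ‖t • x‖ < δ / 2 := by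
      have h3 : Continuous fun t : ℝ => ‖t • x‖ := by fun_prop
      have h4 := h3.tendsto 0
      simp only [zero_smul, norm_zero] at h4
      exact (h4.mono_left nhdsWithin_le_nhds).eventually (gt_mem_nhds (by positivity))
    filter_upwards [h2, eventually_mem_nhdsWithin] with t ht ht0
    rw [hPin _ ((Oct_smul ht0 x).2 hx), chi_one hδ ht.le, one_smul]
    simp only [Complex.real_smul]; ring
  have hfin := corner_algebra N (fun l => DD l v 0) (fun l l' h => DD_perm hv h 0 h0R)
    (fun l hl => by
      have := hel_DD hv hlapv l 0 h0R
      rw [hN l (by omega), smul_zero] at this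
      exact this)
    (fun ρ hρ hρ2 => by
      have h1 := lemHI hf hδ hsupp hoff (by positivity) hC hK2 hlap hPm hPoff hP hPC hlim ρ hρ hρ2
      simp only [mul_assoc] at h1
      rw [integral_const_mul, integral_const_mul, laplace_TT N v ρ hρ] at h1
      have hk' : (k:ℂ)^2 ≠ 0 := by
        have : (k:ℂ) ≠ 0 := by exact_mod_cast hk.ne'
        exact pow_ne_zero _ this
      have h2 := (mul_eq_zero.1 h1).resolve_left hk'
      have h3 := (mul_eq_zero.1 h2).resolve_left (sub_ne_zero.2 hq0)
      have h4 : ((N.factorial : ℂ))⁻¹ ≠ 0 := inv_ne_zero (by exact_mod_cast N.factorial_ne_zero)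
      exact (mul_eq_zero.1 h3).resolve_left h4)
  intro l hl
  subst hl
  have := hfin l.get
  simpa using this

theorem transmission_corner_3D
    (k : ℝ) (hk : 0 < k) (R : ℝ) (hR : 0 < R)
    (SR ΓR : Set (EuclideanSpace ℝ (Fin 3)))
    (hSR : SR = interior octant ∩ ball 0 R)
    (hΓR : ΓR = frontier octant ∩ ball 0 R)
    (q : EuclideanSpace ℝ (Fin 3) → ℂ)
    (hqmeas : Measurable q) (hqbdd : ∃ M : ℝ, ∀ x, ‖q x‖ ≤ M)
    (hqout : ∀ x ∈ ball 0 R \ closure SR, q x = 1)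
    (hqHolder : ∃ α > (1 / 4 : ℝ), ∃ C ≥ (0 : ℝ),
      ∀ x ∈ closure SR, ∀ y ∈ closure SR, ‖q x - q y‖ ≤ C * ‖x - y‖ ^ α)
    (hqO : q 0 ≠ 1)
    (v₁ v₂ : EuclideanSpace ℝ (Fin 3) → ℂ)
    (hv₁smooth : ContDiffOn ℝ 2 v₁ (ball 0 R))
    (hv₂smooth : ContDiffOn ℝ 2 v₂ (ball 0 R))
    (hv₁pde : ∀ x ∈ ball (0 : EuclideanSpace ℝ (Fin 3)) R,
      laplacian3 v₁ x + (k : ℂ) ^ 2 * v₁ x = 0)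
    (hv₂pde : ∀ x ∈ ball (0 : EuclideanSpace ℝ (Fin 3)) R,
      laplacian3 v₂ x + (k : ℂ) ^ 2 * q x * v₂ x = 0)
    (htrans : ∀ x ∈ ΓR, v₁ x = v₂ x ∧ fderiv ℝ v₁ x = fderiv ℝ v₂ x) :
    ∀ x ∈ ball (0 : EuclideanSpace ℝ (Fin 3)) R, v₁ x = 0 ∧ v₂ x = 0 := by
  obtain ⟨M, hqM⟩ := hqbdd
  have hM : 0 ≤ M := (norm_nonneg _).trans (hqM 0)
  have h0R : (0:E3) ∈ ball (0:E3) R := by simpa using hR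
  have c1 : ∀ x ∈ ball (0:E3) R, ContDiffAt ℝ 2 v₁ x := fun x hx => hv₁smooth.contDiffAt (isOpen_ball.mem_nhds hx)
  have c2 : ∀ x ∈ ball (0:E3) R, ContDiffAt ℝ 2 v₂ x := fun x hx => hv₂smooth.contDiffAt (isOpen_ball.mem_nhds hx)
  have l1 : ∀ x ∈ ball (0:E3) R, lap v₁ x = -(k ^ 2) • v₁ x := by
    intro x hx
    have := hv₁pde x hx
    rw [laplacian3_eq] at this
    simp only [Complex.real_smul]; push_cast
    linear_combination this
  have l2 : ∀ x ∈ ball (0:E3) R, lap v₂ x = -((k:ℂ)^2 * q x * v₂ x) := by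
    intro x hx
    have := hv₂pde x hx
    rw [laplacian3_eq] at this
    linear_combination this
  have hSo : SR = Oct ∩ ball 0 R := by rw [hSR, interior_octant]
  have hcl : closure SR ⊆ octant := by
    refine closure_minimal ?_ isClosed_octant
    rw [hSo]; exact fun x hx => Oct_sub hx.1
  set w : E3 → ℂ := fun y => v₁ y - v₂ y with hwd
  have hw : ∀ x ∈ ball (0:E3) R, ContDiffAt ℝ 2 w x := fun x hx => (c1 x hx).sub (c2 x hx)
  have lw : ∀ x ∈ ball (0:E3) R, lap w x = (k:ℂ)^2 * (q x - 1) * v₁ x - (k:ℂ)^2 * q x * w x := by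
    intro x hx
    rw [hwd, lap_sub (c1 x hx) (c2 x hx), l1 x hx, l2 x hx]
    simp only [Complex.real_smul]; push_cast; ring
  have hw0 : ∀ x ∈ ball (0:E3) R, x ∉ Oct → w x = 0 := by
    refine glue_outside (k := k) hR hw ?_ ?_
    · intro x hx ho hn
      have h := htrans x (by rw [hΓR, frontier_octant]; exact ⟨⟨ho, hn⟩, hx⟩)
      refine ⟨sub_eq_zero.2 h.1, ?_⟩
      have d1 := (c1 x hx).differentiableAt (by simp)
      have d2 := (c2 x hx).differentiableAt (by simp)
      rw [hwd, fderiv_fun_sub d1 d2, h.2, sub_self]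
    · intro x hx ho
      rw [lw x hx, hqout x ⟨hx, fun h => ho (hcl h)⟩]
      simp only [Complex.real_smul]; push_cast; ring
  have hev : ∀ x ∈ Oct, ∀ᶠ t : ℝ in nhdsWithin 0 (Ioi 0), t • x ∈ SR := by
    intro x hx
    have h3 : Continuous fun t : ℝ => t • x := by fun_prop
    have h4 := h3.tendsto 0
    simp only [zero_smul] at h4
    have h5 := (h4.mono_left (nhdsWithin_le_nhds (s := Ioi 0))).eventually (isOpen_ball.mem_nhds h0R)
    filter_upwards [h5, eventually_mem_nhdsWithin] with t ht ht0
    rw [hSo]; exact ⟨(Oct_smul ht0 x).2 hx, ht⟩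
  have hqlim : ∀ x ∈ Oct, Filter.Tendsto (fun t : ℝ => q (t • x)) (nhdsWithin 0 (Ioi 0)) (nhds (q 0)) := by
    intro x hx
    obtain ⟨α, hα, C, hC, hH⟩ := hqHolder
    have hα0 : 0 < α := by linarith
    have h3 : Continuous fun t : ℝ => t • x := by fun_prop
    have h4 := (h3.tendsto 0).mono_left (nhdsWithin_le_nhds (s := Ioi 0))
    simp only [zero_smul] at h4
    have h0 : (0:E3) ∈ closure SR := mem_closure_of_tendsto h4 (hev x hx)
    rw [tendsto_iff_norm_sub_tendsto_zero]
    have h6 : Filter.Tendsto (fun t : ℝ => C * ‖t • x - 0‖ ^ α) (nhdsWithin 0 (Ioi 0)) (nhds 0) := by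
      have h7 : Continuous fun t : ℝ => C * ‖t • x - 0‖ ^ α := by
        refine continuous_const.mul ?_
        exact Continuous.rpow_const (by fun_prop) fun _ => Or.inr hα0.le
      have h8 := (h7.tendsto 0).mono_left (nhdsWithin_le_nhds (s := Ioi 0))
      simpa [Real.zero_rpow hα0.ne'] using h8
    refine squeeze_zero' (Filter.Eventually.of_forall fun _ => norm_nonneg _) ?_ h6
    filter_upwards [hev x hx] with t ht
    exact hH _ (subset_closure ht) _ h0
  have hv : Sm R v₁ := hel_smooth c1 l1
  have hDN : ∀ N : ℕ, ∀ l : List (Fin 3), l.length = N → DD l v₁ 0 = 0 := by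
    intro N
    induction N using Nat.strong_induction_on with
    | _ N ih =>
      exact vanish_step hk hR hv l1 hw hw0 (fun x hx _ => lw x hx) hqmeas hqM hqlim hqO N
        fun l hl => ih _ hl l rfl
  have hv1 : ∀ x ∈ ball (0:E3) R, v₁ x = 0 := by
    refine ucp_ball h0R c1 (C := k^2) (by positivity) ?_ (flat_of_DD hR hv fun l => hDN _ l rfl)
    intro x hx
    rw [l1 x hx, norm_smul, norm_neg, norm_pow, Real.norm_of_nonneg hk.le]
  have hv2 : ∀ x ∈ ball (0:E3) R, v₂ x = 0 := by
    have hx0 : (-(R/2)) • ee 0 ∈ ball (0:E3) R := by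
      rw [mem_ball_zero_iff, norm_smul, norm_ee, norm_neg, Real.norm_of_nonneg (by positivity)]; linarith
    refine ucp_ball hx0 c2 (C := k^2 * M) (by positivity) ?_ (flatAt_of_zero ?_)
    · intro x hx
      rw [l2 x hx, norm_neg, norm_mul, norm_mul, norm_pow, Complex.norm_real, Real.norm_of_nonneg hk.le]
      gcongr
      exact hqM x
    · have hc : Continuous fun x : E3 => x 0 := by fun_prop
      have h1 : ∀ᶠ x in nhds ((-(R/2)) • ee 0), x 0 < 0 := by
        refine (hc.tendsto _).eventually (gt_mem_nhds ?_)
        simp [ee_apply, hR]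
      filter_upwards [h1, isOpen_ball.mem_nhds hx0] with x h2 h3
      have h4 := hw0 x h3 fun h => absurd (h 0) (by linarith)
      have h5 := hv1 x h3
      simp only [hwd, h5] at h4
      simpa using h4
  exact fun x hx => ⟨hv1 x hx, hv2 x hx⟩
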